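/- For every integer p ≥ 3 and every real λ, the family 𝒢_p(λ) of p-colorable signed graphs with smallest eigenvalue at least -λ has a finite forbidden subgraph characterization within the class 𝒢_p of p-colorable signed graphs if and only if λ < λ*. -/

import Mathlib

/-- A (candidate) signed graph: a natural number `n` together with a real `n × n` matrix. -/
abbrev SG : Type := Σ n : ℕ, Matrix (Fin n) (Fin n) ℝ

/-- `G` is a signed graph: its matrix is symmetric, with zero diagonal and
off-diagonal entries in `{-1, 0, 1}`. -/
def IsSignedGraph (G : SG) : Prop :=
  G.2.IsSymm ∧ (∀ i, G.2 i i = 0) ∧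
    ∀ i j, i ≠ j → G.2 i j = -1 ∨ G.2 i j = 0 ∨ G.2 i j = 1

/-- A signed graph is `p`-colorable if there is a coloring of the vertices by `p` colors
such that endpoints of negative edges get identical colors and endpoints of positive
edges get different colors. -/
def SGColorable (p : ℕ) (G : SG) : Prop :=
  ∃ c : Fin G.1 → Fin p, ∀ u v, (G.2 u v = -1 → c u = c v) ∧ (G.2 u v = 1 → c u ≠ c v)

/-- `B` is an induced subgraph of `A`. -/
def SGInduced (B A : SG) : Prop :=
  ∃ f : Fin B.1 → Fin A.1, Function.Injective f ∧ ∀ u v, B.2 u v = A.2 (f u) (f v)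

/-- The smallest eigenvalue of a signed graph. -/
noncomputable def sgLam1 (G : SG) : ℝ :=
  sInf {t : ℝ | ∃ x : Fin G.1 → ℝ, x ≠ 0 ∧ G.2.mulVec x = t • x}

/-- `ℋ` has a finite forbidden subgraph characterization within the class `𝒢`:
there is a finite set `ℱ ⊆ 𝒢` such that `ℋ` consists exactly of the members of `𝒢`
containing no member of `ℱ` as an induced subgraph. -/
def HasFFSC (𝒢 ℋ : Set SG) : Prop :=
  ∃ ℱ : Set SG, ℱ.Finite ∧ ℱ ⊆ 𝒢 ∧ ∀ G ∈ 𝒢, (G ∈ ℋ ↔ ∀ F ∈ ℱ, ¬ SGInduced F G)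

/-- The class `𝒢_p` of `p`-colorable signed graphs. -/
def classGp (p : ℕ) : Set SG := {G | IsSignedGraph G ∧ SGColorable p G}

/-- The family `𝒢_p(λ)` of `p`-colorable signed graphs with smallest eigenvalue at
least `-λ`. -/
def classGpLam (p : ℕ) (lam : ℝ) : Set SG := {G ∈ classGp p | -lam ≤ sgLam1 G}

set_option linter.unusedSectionVars false

/-- A finite tree with a parent map and a depth function, rooted at `root`. -/
structure RTree (N : Type*) where
  root : N
  par : N → N
  dep : N → ℕ
  dep_root : dep root = 0
  dep_par : ∀ i, i ≠ root → dep i = dep (par i) + 1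

namespace RTree

variable {N : Type*} [Fintype N] [DecidableEq N]

/-- The basic vector `e_i - e_{par i}` of the tree. -/
def row (R : RTree N) (i k : N) : ℝ := (if i = k then 1 else 0) - (if R.par i = k then 1 else 0)

/-- A pair vector records a flow and a residual at every node; `target` is the vector it
represents. -/
def target (R : RTree N) (z : N → ℝ × ℝ) (k : N) : ℝ :=
  (z k).2 + ∑ i, (z i).1 * R.row i k

/-- The inner product of pair vectors, flows being weighted by `e`. -/
def ip (e : ℝ) (z w : N → ℝ × ℝ) : ℝ := ∑ i, ((z i).2 * (w i).2 + e * ((z i).1 * (w i).1))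

section ip

omit [DecidableEq N]

lemma ip_comm (e : ℝ) (z w : N → ℝ × ℝ) : ip e z w = ip e w z := by
  unfold ip; exact Finset.sum_congr rfl fun i _ => by ring

lemma ip_add_left (e : ℝ) (z z' w : N → ℝ × ℝ) : ip e (z + z') w = ip e z w + ip e z' w := by
  unfold ip; rw [← Finset.sum_add_distrib]
  exact Finset.sum_congr rfl fun i _ => by simp; ring

lemma ip_add_right (e : ℝ) (z z' w : N → ℝ × ℝ) : ip e w (z + z') = ip e w z + ip e w z' := by
  rw [ip_comm, ip_add_left, ip_comm e z, ip_comm e z']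

lemma ip_smul_left (e a : ℝ) (z w : N → ℝ × ℝ) : ip e (a • z) w = a * ip e z w := by
  unfold ip; rw [Finset.mul_sum]
  exact Finset.sum_congr rfl fun i _ => by simp; ring

lemma ip_smul_right (e a : ℝ) (z w : N → ℝ × ℝ) : ip e w (a • z) = a * ip e w z := by
  rw [ip_comm, ip_smul_left, ip_comm]

lemma ip_self_nonneg {e : ℝ} (he : 0 ≤ e) (z : N → ℝ × ℝ) : 0 ≤ ip e z z := by
  unfold ip
  exact Finset.sum_nonneg fun i _ => by
    have := mul_nonneg he (mul_self_nonneg (z i).1)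
    nlinarith [mul_self_nonneg (z i).2]

lemma ip_nonneg {e : ℝ} (he : 0 ≤ e) {z w : N → ℝ × ℝ} (hz : ∀ i, 0 ≤ z i) (hw : ∀ i, 0 ≤ w i) :
    0 ≤ ip e z w := by
  unfold ip
  refine Finset.sum_nonneg fun i _ => ?_
  have h1 := hz i
  have h2 := hw i
  rw [Prod.le_def] at h1 h2
  simp only [Prod.fst_zero, Prod.snd_zero] at h1 h2
  exact add_nonneg (mul_nonneg h1.2 h2.2) (mul_nonneg he (mul_nonneg h1.1 h2.1))

lemma two_ip_le {e : ℝ} (he : 0 ≤ e) (z w : N → ℝ × ℝ) :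
    2 * ip e z w ≤ ip e z z + ip e w w := by
  have := ip_self_nonneg he (z + (-1 : ℝ) • w)
  simp only [ip_add_left, ip_add_right, ip_smul_left, ip_smul_right] at this
  rw [ip_comm e w z] at this
  linarith

end ip

lemma ip_single_left (e : ℝ) (u : N) (p : ℝ × ℝ) (w : N → ℝ × ℝ) :
    ip e (Pi.single u p) w = p.2 * (w u).2 + e * (p.1 * (w u).1) := by
  unfold ip
  rw [Finset.sum_eq_single u]
  · simp
  · intro b _ hb; simp [hb]
  · simp

lemma ip_single_right (e : ℝ) (u : N) (p : ℝ × ℝ) (w : N → ℝ × ℝ) :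
    ip e w (Pi.single u p) = p.2 * (w u).2 + e * (p.1 * (w u).1) := by
  rw [ip_comm, ip_single_left]

variable (R : RTree N)

lemma target_add (z w : N → ℝ × ℝ) : R.target (z + w) = R.target z + R.target w := by
  funext k
  simp only [target, Pi.add_apply, Prod.fst_add, Prod.snd_add, add_mul, Finset.sum_add_distrib]
  ring

lemma target_smul (a : ℝ) (z : N → ℝ × ℝ) : R.target (a • z) = a • R.target z := by
  funext k
  simp only [target, Pi.smul_apply, Prod.smul_fst, Prod.smul_snd, smul_eq_mul, mul_add,
    Finset.mul_sum, mul_assoc]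

lemma target_zero : R.target (0 : N → ℝ × ℝ) = 0 := by
  funext k; simp [target]

lemma target_single (u : N) (p : ℝ × ℝ) :
    R.target (Pi.single u p) = (p.1 + p.2) • Pi.single u 1 + (-p.1) • Pi.single (R.par u) 1 := by
  funext k
  simp only [target, Pi.add_apply, Pi.smul_apply, smul_eq_mul]
  rw [Finset.sum_eq_single u]
  · simp only [Pi.single_eq_same, row, Pi.single_apply]
    simp only [eq_comm (a := u) (b := k), eq_comm (a := R.par u) (b := k)]
    split_ifs <;> simp [add_comm]
  · intro b _ hb; simp [hb]
  · simp

/-- The chain pair vector representing the unit vector at `u`. -/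
noncomputable def chainAux (s : ℝ) : ℕ → N → N → ℝ × ℝ
  | 0, u => Pi.single u (0, 1)
  | n + 1, u => Pi.single u (s, 1 - s) + s • chainAux s n (R.par u)

/-- The chain pair vector of `u`, ended at depth one. -/
noncomputable def chain (s : ℝ) (u : N) : N → ℝ × ℝ := R.chainAux s (R.dep u - 1) u

lemma ne_root_of_dep {u : N} (h : 1 ≤ R.dep u) : u ≠ R.root := by
  rintro rfl; rw [R.dep_root] at h; omega

lemma dep_par_of {u : N} (h : 1 ≤ R.dep u) : R.dep (R.par u) + 1 = R.dep u :=
  (R.dep_par u (R.ne_root_of_dep h)).symm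

lemma par_ne {u : N} (h : 1 ≤ R.dep u) : R.par u ≠ u := by
  intro h'
  have := R.dep_par_of h
  rw [h'] at this; omega

lemma chain_base (s : ℝ) {u : N} (h : R.dep u ≤ 1) : R.chain s u = Pi.single u (0, 1) := by
  unfold chain; rw [Nat.sub_eq_zero_of_le h]; rfl

lemma chain_step (s : ℝ) {u : N} (h : 2 ≤ R.dep u) :
    R.chain s u = Pi.single u (s, 1 - s) + s • R.chain s (R.par u) := by
  unfold chain
  have h1 := R.dep_par_of (u := u) (by omega)
  obtain ⟨n, hn⟩ : ∃ n, R.dep u - 1 = n + 1 := ⟨R.dep u - 2, by omega⟩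
  rw [hn, show R.dep (R.par u) - 1 = n by omega]; rfl

/-- Induction along parents. -/
lemma par_induction {P : N → Prop} (h0 : ∀ u, R.dep u ≤ 1 → P u)
    (h1 : ∀ u, 2 ≤ R.dep u → P (R.par u) → P u) (u : N) : P u := by
  induction hn : R.dep u using Nat.strong_induction_on generalizing u with
  | _ n ih =>
    by_cases h : R.dep u ≤ 1
    · exact h0 u h
    · have := R.dep_par_of (u := u) (by omega)
      exact h1 u (by omega) (ih _ (by omega) _ rfl)

lemma target_chain (s : ℝ) (u : N) : R.target (R.chain s u) = Pi.single u 1 := by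
  induction u using R.par_induction with
  | h0 u h => rw [R.chain_base s h, target_single]; simp
  | h1 u h ih =>
    rw [R.chain_step s h, target_add, target_smul, ih, target_single]
    funext k; simp

lemma chain_apply_of_le (s : ℝ) {u v : N} (hne : u ≠ v) (h : R.dep v ≤ R.dep u) :
    R.chain s v u = 0 := by
  induction v using R.par_induction with
  | h0 v hv => rw [R.chain_base s hv]; simp [hne]
  | h1 v hv ih =>
    have := R.dep_par_of (u := v) (by omega)
    rw [R.chain_step s hv]
    have h2 := ih (by rintro rfl; omega) (by omega)
    simp [hne, h2]

lemma chain_apply_self (s : ℝ) {u : N} (h : 2 ≤ R.dep u) : R.chain s u u = (s, 1 - s) := by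
  have := R.dep_par_of (u := u) (by omega)
  rw [R.chain_step s h]
  have h2 := R.chain_apply_of_le s (u := u) (v := R.par u) (R.par_ne (by omega)).symm (by omega)
  simp [h2]

lemma chain_fst_eq_zero (s : ℝ) {u : N} (h : R.dep u ≤ 1) (v : N) : (R.chain s v u).1 = 0 := by
  induction v using R.par_induction with
  | h0 v hv =>
    rw [R.chain_base s hv]
    by_cases h : u = v
    · subst h; simp
    · simp [h]
  | h1 v hv ih =>
    rw [R.chain_step s hv]
    have hne : u ≠ v := by rintro rfl; omega
    simp [hne, ih]

lemma chain_nonneg {s : ℝ} (h0 : 0 ≤ s) (h1 : s ≤ 1) (u i : N) : 0 ≤ R.chain s u i := by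
  induction u using R.par_induction with
  | h0 v hv =>
    rw [R.chain_base s hv]
    by_cases h : i = v
    · subst h; simp [Prod.le_def]
    · simp [h]
  | h1 v hv ih =>
    rw [R.chain_step s hv]
    refine add_nonneg ?_ (smul_nonneg h0 ih)
    by_cases h : i = v
    · subst h; simp [Prod.le_def, h0, h1]
    · simp [h]

/-- The chain vectors live on any parent closed set containing their node. -/
lemma chain_support (s : ℝ) {S : Finset N} (hS : ∀ i ∈ S, i ≠ R.root → R.par i ∈ S) {u i : N}
    (hu : u ∈ S) (hi : i ∉ S) : R.chain s u i = 0 := by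
  induction u using R.par_induction with
  | h0 v hv =>
    rw [R.chain_base s hv]
    simp [show i ≠ v by rintro rfl; exact hi hu]
  | h1 v hv ih =>
    rw [R.chain_step s hv]
    simp [show i ≠ v by rintro rfl; exact hi hu,
      ih (hS v hu (R.ne_root_of_dep (by omega)))]

lemma ip_chain_step (e s : ℝ) {u v : N} (hne : u ≠ v) (h : R.dep v ≤ R.dep u)
    (h2 : 2 ≤ R.dep u) :
    ip e (R.chain s u) (R.chain s v) = s * ip e (R.chain s (R.par u)) (R.chain s v) := by
  rw [R.chain_step s h2, ip_add_left, ip_smul_left, ip_single_left,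
    R.chain_apply_of_le s hne h]
  simp

lemma ip_single_chain_self (e s : ℝ) {u : N} (h : 2 ≤ R.dep u) (p : ℝ × ℝ) :
    ip e (Pi.single u p) (R.chain s u) = p.2 * (1 - s) + e * (p.1 * s) := by
  rw [ip_single_left, R.chain_apply_self s h]

lemma ip_single_chain_zero (e s : ℝ) {u v : N} (hne : u ≠ v) (h : R.dep v ≤ R.dep u)
    (p : ℝ × ℝ) : ip e (Pi.single u p) (R.chain s v) = 0 := by
  rw [ip_single_left, R.chain_apply_of_le s hne h]; simp

lemma ip_chain_self (e s : ℝ) {u : N} (h : 2 ≤ R.dep u) :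
    ip e (R.chain s u) (R.chain s u) =
      (1 - s) ^ 2 + e * s ^ 2 + s ^ 2 * ip e (R.chain s (R.par u)) (R.chain s (R.par u)) := by
  have := R.dep_par_of (u := u) (by omega)
  have h0 := R.ip_single_chain_zero e s (u := u) (v := R.par u) (R.par_ne (by omega)).symm
    (by omega) (s, 1 - s)
  rw [R.chain_step s h]
  simp only [ip_add_left, ip_add_right, ip_smul_left, ip_smul_right]
  rw [h0, ip_comm e (R.chain s (R.par u)) (Pi.single u _), h0, ip_single_left]
  simp; ring

/-- The cost of a chain at its critical parameters. -/
lemma ip_chain_self_eq {e s : ℝ} (he : e * s = (1 - s) ^ 2) (u : N) :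
    ip e (R.chain s u) (R.chain s u) = (1 - s) + s * (s ^ 2) ^ (R.dep u - 1) := by
  induction u using R.par_induction with
  | h0 v hv =>
    rw [R.chain_base s hv, ip_single_left, Nat.sub_eq_zero_of_le hv]; simp
  | h1 v hv ih =>
    have := R.dep_par_of (u := v) (by omega)
    rw [R.ip_chain_self e s hv, ih]
    obtain ⟨n, hn⟩ : ∃ n, R.dep v - 1 = n + 1 := ⟨R.dep v - 2, by omega⟩
    rw [hn, show R.dep (R.par v) - 1 = n by omega, pow_succ]
    have : e * s ^ 2 = (1 - s) ^ 2 * s := by rw [← he]; ring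
    rw [this]; ring

end RTree

namespace RTree
variable {N : Type*} [Fintype N] [DecidableEq N] (R : RTree N)

/-- Parent closed sets of nodes. -/
def Closed (S : Finset N) : Prop := ∀ i ∈ S, i ≠ R.root → R.par i ∈ S

/-- `C` is represented inside `S` at cost at most `c`, with no flow at nodes of depth at most
one. -/
def Cheap (e : ℝ) (S : Finset N) (C : N → ℝ) (c : ℝ) : Prop :=
  ∃ z : N → ℝ × ℝ, R.target z = C ∧ (∀ i, R.dep i ≤ 1 → (z i).1 = 0) ∧
    (∀ i, i ∉ S → z i = 0) ∧ ip e z z ≤ c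

/-- The critical parameters. -/
structure Crit (s e : ℝ) : Prop where
  lo : 0.868836 < s
  hi : s < 0.868837
  eq : s ^ 6 + s ^ 4 = 1
  he : e * s = (1 - s) ^ 2

namespace Crit
variable {s e : ℝ} (h : Crit s e)
include h

lemma pos : 0 < s := by linarith [h.lo]
lemma lt_one : s < 1 := by linarith [h.hi]
lemma e_nonneg : 0 ≤ e := by
  have := h.pos
  have h2 := h.he
  by_contra hc
  push Not at hc
  nlinarith [sq_nonneg (1 - s), mul_pos_of_neg_of_neg hc (neg_lt_zero.mpr this)]

lemma e_le : e ≤ 0.019802 := by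
  have h1 := h.lo
  have h2 := h.hi
  have h3 := h.he
  nlinarith

end Crit

/-- The chains at depth at least `D` cost at most `k`. -/
structure Deep (R : RTree N) (s e k : ℝ) (D : ℕ) : Prop extends Crit s e where
  lb : 1 - s ≤ k
  ub : k ≤ 0.1312
  one_lt : 2 ≤ D
  self_le : ∀ u, D ≤ R.dep u → ip e (R.chain s u) (R.chain s u) ≤ k

variable {R} {s e k : ℝ} {D : ℕ}

section Deep
variable (h : Deep R s e k D)
include h

lemma Deep.k_nonneg : 0 ≤ k := by linarith [h.lb, h.lt_one]

lemma Deep.ip_nonneg (u v : N) : 0 ≤ ip e (R.chain s u) (R.chain s v) :=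
  RTree.ip_nonneg h.e_nonneg (R.chain_nonneg h.pos.le h.lt_one.le u)
    (R.chain_nonneg h.pos.le h.lt_one.le v)

lemma Deep.ip_le {u v : N} (hu : D ≤ R.dep u) (hv : D ≤ R.dep v) :
    ip e (R.chain s u) (R.chain s v) ≤ k := by
  have := two_ip_le h.e_nonneg (R.chain s u) (R.chain s v)
  linarith [h.self_le u hu, h.self_le v hv]

lemma Deep.ip_le_of_ne_aux {u v : N} (hne : u ≠ v) (hu : D + 1 ≤ R.dep u) (hv : D + 1 ≤ R.dep v)
    (hd : R.dep v ≤ R.dep u) : ip e (R.chain s u) (R.chain s v) ≤ s * k := by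
  have h2 := h.one_lt
  have := R.dep_par_of (u := u) (by omega)
  rw [R.ip_chain_step e s hne hd (by omega)]
  exact mul_le_mul_of_nonneg_left (h.ip_le (by omega) (by omega)) h.pos.le

lemma Deep.ip_le_of_ne {u v : N} (hne : u ≠ v) (hu : D + 1 ≤ R.dep u) (hv : D + 1 ≤ R.dep v) :
    ip e (R.chain s u) (R.chain s v) ≤ s * k := by
  rcases le_total (R.dep v) (R.dep u) with hd | hd
  · exact h.ip_le_of_ne_aux hne hu hv hd
  · rw [ip_comm]; exact h.ip_le_of_ne_aux hne.symm hv hu hd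

lemma Deep.ip_le_far {u v : N} (hne : u ≠ v) (hp : R.par u ≠ v) (hu : D + 2 ≤ R.dep u)
    (hv : D + 2 ≤ R.dep v) (hd : R.dep v ≤ R.dep u) :
    ip e (R.chain s u) (R.chain s v) ≤ s ^ 2 * k := by
  have h2 := h.one_lt
  have := R.dep_par_of (u := u) (by omega)
  rw [R.ip_chain_step e s hne hd (by omega), pow_two, mul_assoc]
  exact mul_le_mul_of_nonneg_left (h.ip_le_of_ne hp (by omega) (by omega)) h.pos.le

lemma Deep.ip_le_farther {u v : N} (hne : u ≠ v) (hp : R.par u ≠ v) (hu : D + 3 ≤ R.dep u)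
    (hv : D + 3 ≤ R.dep v) (hd : R.dep v ≤ R.dep u) :
    ip e (R.chain s u) (R.chain s v) ≤ s ^ 3 * k ∨ R.par (R.par u) = v ∨
      (R.dep u = R.dep v ∧ R.par u = R.par v) := by
  have h2 := h.one_lt
  have hu' := R.dep_par_of (u := u) (by omega)
  have hu'' := R.dep_par_of (u := R.par u) (by omega)
  have hv' := R.dep_par_of (u := v) (by omega)
  rw [R.ip_chain_step e s hne hd (by omega), pow_succ', mul_assoc]
  rcases le_or_gt (R.dep v) (R.dep (R.par u)) with hd' | hd'
  · by_cases hc : R.par (R.par u) = v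
    · exact Or.inr (Or.inl hc)
    · exact Or.inl (mul_le_mul_of_nonneg_left
        (h.ip_le_far hp hc (by omega) (by omega) (by omega)) h.pos.le)
  · by_cases hc : R.par u = R.par v
    · exact Or.inr (Or.inr ⟨by omega, hc⟩)
    · refine Or.inl (mul_le_mul_of_nonneg_left ?_ h.pos.le)
      rw [ip_comm]
      exact h.ip_le_far hp.symm (fun h => hc h.symm) (by omega) (by omega) (by omega)

end Deep

lemma Cheap.mono {S : Finset N} {C : N → ℝ} {c c' : ℝ} (hC : R.Cheap e S C c) (hc : c ≤ c') :
    R.Cheap e S C c' := by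
  obtain ⟨z, h1, h2, h3, h4⟩ := hC
  exact ⟨z, h1, h2, h3, h4.trans hc⟩

lemma Cheap.smul {S : Finset N} {C : N → ℝ} {c : ℝ} (hC : R.Cheap e S C c) (a : ℝ) :
    R.Cheap e S (a • C) (a ^ 2 * c) := by
  obtain ⟨z, h1, h2, h3, h4⟩ := hC
  refine ⟨a • z, by rw [target_smul, h1], fun i hi => by simp [h2 i hi],
    fun i hi => by simp [h3 i hi], ?_⟩
  rw [ip_smul_left, ip_smul_right, ← mul_assoc, ← pow_two]
  exact mul_le_mul_of_nonneg_left h4 (sq_nonneg a)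

/-- Vectors with flow supported at depth at least two and inside `S`. -/
def Adm (R : RTree N) (S : Finset N) : Submodule ℝ (N → ℝ × ℝ) where
  carrier := {z | (∀ i, R.dep i ≤ 1 → (z i).1 = 0) ∧ ∀ i, i ∉ S → z i = 0}
  add_mem' := by
    rintro a b ⟨h1, h2⟩ ⟨h3, h4⟩
    exact ⟨fun i hi => by simp [h1 i hi, h3 i hi], fun i hi => by simp [h2 i hi, h4 i hi]⟩
  zero_mem' := ⟨fun i _ => rfl, fun i _ => rfl⟩
  smul_mem' := by
    rintro c a ⟨h1, h2⟩
    exact ⟨fun i hi => by simp [h1 i hi], fun i hi => by simp [h2 i hi]⟩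

lemma single_mem_Adm {S : Finset N} {u : N} (hu : u ∈ S) (h2 : 2 ≤ R.dep u) (p : ℝ × ℝ) :
    Pi.single u p ∈ R.Adm S := by
  refine ⟨fun i hi => ?_, fun i hi => ?_⟩
  · rw [Pi.single_eq_of_ne (by rintro rfl; omega)]; rfl
  · rw [Pi.single_eq_of_ne (by rintro rfl; exact hi hu)]

lemma chain_mem_Adm {S : Finset N} (hS : R.Closed S) {u : N} (hu : u ∈ S) (s : ℝ) :
    R.chain s u ∈ R.Adm S :=
  ⟨fun _ hi => R.chain_fst_eq_zero s hi u, fun _ hi => R.chain_support s hS hu hi⟩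

lemma cheap_of_mem {S : Finset N} {z : N → ℝ × ℝ} (hz : z ∈ R.Adm S) {C : N → ℝ} {c : ℝ}
    (ht : R.target z = C) (hc : ip e z z ≤ c) : R.Cheap e S C c := ⟨z, ht, hz.1, hz.2, hc⟩

lemma target_sum {ι : Type*} (t : Finset ι) (f : ι → N → ℝ × ℝ) :
    R.target (∑ i ∈ t, f i) = ∑ i ∈ t, R.target (f i) := by
  classical
  induction t using Finset.induction_on with
  | empty => simp [target_zero]
  | insert a t ha ih => rw [Finset.sum_insert ha, Finset.sum_insert ha, target_add, ih]

lemma ip_zero_left (e : ℝ) (w : N → ℝ × ℝ) : ip e 0 w = 0 := by simp [ip]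

lemma ip_sum_left (e : ℝ) {ι : Type*} (t : Finset ι) (f : ι → N → ℝ × ℝ) (w : N → ℝ × ℝ) :
    ip e (∑ i ∈ t, f i) w = ∑ i ∈ t, ip e (f i) w := by
  classical
  induction t using Finset.induction_on with
  | empty => simp [ip_zero_left]
  | insert a t ha ih => rw [Finset.sum_insert ha, Finset.sum_insert ha, ip_add_left, ih]

lemma ip_sum_right (e : ℝ) {ι : Type*} (t : Finset ι) (f : ι → N → ℝ × ℝ) (w : N → ℝ × ℝ) :
    ip e w (∑ i ∈ t, f i) = ∑ i ∈ t, ip e w (f i) := by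
  rw [ip_comm, ip_sum_left]; exact Finset.sum_congr rfl fun i _ => ip_comm _ _ _

lemma Deep.cheap_general (h : Deep R s e k D) {S : Finset N} (hS : R.Closed S) {C : N → ℝ}
    (hsupp : ∀ u, C u ≠ 0 → u ∈ S ∧ D + 1 ≤ R.dep u) :
    R.Cheap e S C (k * ((1 - s) * ∑ u, C u ^ 2 + s * (∑ u, |C u|) ^ 2)) := by
  refine cheap_of_mem (z := ∑ u, C u • R.chain s u) ?_ ?_ ?_
  · refine Submodule.sum_mem _ fun u _ => ?_
    by_cases hu : C u = 0
    · rw [hu, zero_smul]; exact Submodule.zero_mem _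
    · exact Submodule.smul_mem _ _ (chain_mem_Adm hS (hsupp u hu).1 s)
  · rw [target_sum]
    funext v
    simp [target_smul, target_chain, Finset.sum_apply, Pi.single_apply]
  · rw [ip_sum_left]
    have key : ∀ u v, ip e (C u • R.chain s u) (C v • R.chain s v) ≤
        k * ((1 - s) * (if u = v then C u ^ 2 else 0) + s * (|C u| * |C v|)) := by
      intro u v
      rw [ip_smul_left, ip_smul_right, ← mul_assoc]
      by_cases hu : C u = 0
      · simp [hu]
      by_cases hv : C v = 0
      · simp only [hv]
        by_cases huv : u = v
        · subst huv; exact absurd hv hu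
        · simp [huv]
      have hI := h.ip_nonneg u v
      have hb : C u * C v ≤ |C u| * |C v| := by rw [← abs_mul]; exact le_abs_self _
      have hb' : 0 ≤ |C u| * |C v| := by positivity
      have hp : C u * C v * ip e (R.chain s u) (R.chain s v) ≤
          |C u| * |C v| * ip e (R.chain s u) (R.chain s v) := mul_le_mul_of_nonneg_right hb hI
      by_cases huv : u = v
      · subst huv
        have := h.self_le u (by have := (hsupp u hu).2; omega)
        rw [if_pos rfl]
        have h3 : |C u| * |C u| = C u ^ 2 := by rw [← pow_two, sq_abs]
        rw [h3] at hp ⊢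
        nlinarith [sq_nonneg (C u), mul_le_mul_of_nonneg_left this (sq_nonneg (C u))]
      · rw [if_neg huv]
        have := h.ip_le_of_ne huv (hsupp u hu).2 (hsupp v hv).2
        nlinarith [mul_le_mul_of_nonneg_left this hb']
    calc ∑ u, ip e (C u • R.chain s u) (∑ v, C v • R.chain s v)
        = ∑ u, ∑ v, ip e (C u • R.chain s u) (C v • R.chain s v) :=
          Finset.sum_congr rfl fun u _ => ip_sum_right _ _ _ _
      _ ≤ ∑ u, ∑ v, k * ((1 - s) * (if u = v then C u ^ 2 else 0) + s * (|C u| * |C v|)) :=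
          Finset.sum_le_sum fun u _ => Finset.sum_le_sum fun v _ => key u v
      _ = _ := by
          simp only [← Finset.mul_sum, Finset.sum_add_distrib, Finset.sum_ite_eq,
            Finset.mem_univ, if_true]
          rw [← Finset.sum_mul, pow_two (∑ u, |C u|)]

end RTree

namespace RTree
variable {N : Type*} [Fintype N] [DecidableEq N] {R : RTree N} {s e k : ℝ} {D : ℕ}

/-- A representation of `e_u + e_{par u}`. -/
noncomputable def edgeVec (R : RTree N) (s x : ℝ) (u : N) : N → ℝ × ℝ :=
  Pi.single u (x, 1 - x) + (1 + x) • R.chain s (R.par u)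

lemma target_edgeVec (x : ℝ) (u : N) :
    R.target (edgeVec R s x u) = Pi.single u 1 + Pi.single (R.par u) 1 := by
  rw [edgeVec, target_add, target_smul, target_chain, target_single]
  funext k; simp; ring

lemma edgeVec_mem {S : Finset N} (hS : R.Closed S) {u : N} (hu : u ∈ S) (h2 : 2 ≤ R.dep u)
    (x : ℝ) : edgeVec R s x u ∈ R.Adm S :=
  Submodule.add_mem _ (single_mem_Adm hu h2 _) (Submodule.smul_mem _ _
    (chain_mem_Adm hS (hS u hu (R.ne_root_of_dep (by omega))) s))

lemma ip_edgeVec_self (x : ℝ) {u : N} (h2 : 2 ≤ R.dep u) :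
    ip e (edgeVec R s x u) (edgeVec R s x u) = (1 - x) ^ 2 + e * x ^ 2 +
      (1 + x) ^ 2 * ip e (R.chain s (R.par u)) (R.chain s (R.par u)) := by
  have := R.dep_par_of (u := u) (by omega)
  have h0 := R.ip_single_chain_zero e s (u := u) (v := R.par u) (R.par_ne (by omega)).symm
    (by omega) (x, 1 - x)
  rw [edgeVec]
  simp only [ip_add_left, ip_add_right, ip_smul_left, ip_smul_right]
  rw [h0, ip_comm e (R.chain s (R.par u)) (Pi.single u _), h0, ip_single_left]
  simp; ring

lemma ip_edgeVec_of_le (x : ℝ) {u v : N} (hne : u ≠ v) (hd : R.dep v ≤ R.dep u) :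
    ip e (edgeVec R s x u) (R.chain s v) =
      (1 + x) * ip e (R.chain s (R.par u)) (R.chain s v) := by
  rw [edgeVec, ip_add_left, ip_smul_left, R.ip_single_chain_zero e s hne hd, zero_add]

lemma ip_edgeVec_step (x : ℝ) {u v : N} (hne : v ≠ u) (hne' : v ≠ R.par u) (h2 : 2 ≤ R.dep v)
    (hd : R.dep (R.par u) ≤ R.dep v) :
    ip e (edgeVec R s x u) (R.chain s v) = s * ip e (edgeVec R s x u) (R.chain s (R.par v)) := by
  have h0 : edgeVec R s x u v = 0 := by
    simp [edgeVec, hne, R.chain_apply_of_le s hne' hd]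
  rw [R.chain_step s h2, ip_add_right, ip_smul_right, ip_single_right, h0]
  simp

section Deep
variable (h : Deep R s e k D)
include h

lemma Deep.ip_edgeVec_le {u v : N} (hu : D + 2 ≤ R.dep u) (hv : D + 1 ≤ R.dep v) :
    ip e (edgeVec R s (3 / 4) u) (R.chain s v) ≤ 0.2455 := by
  have hD := h.one_lt
  have hlo := h.lo
  have hhi := h.hi
  have hub := h.ub
  have hk := h.k_nonneg
  have hel := h.e_le
  have he0 := h.e_nonneg
  have hpu := R.dep_par_of (u := u) (by omega)
  induction v using R.par_induction with
  | h0 v hv' => omega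
  | h1 v hv2 ih =>
    have hpv := R.dep_par_of (u := v) (by omega)
    by_cases huv : v = u
    · subst huv
      rw [edgeVec, ip_add_left, ip_smul_left, R.ip_single_chain_self e s (by omega),
        ip_comm e (R.chain s (R.par v)), R.ip_chain_step e s (R.par_ne (by omega)).symm (by omega)
          (by omega)]
      have := h.self_le (R.par v) (by omega)
      have h0 := h.ip_nonneg (R.par v) (R.par v)
      simp only
      nlinarith
    by_cases hd : R.dep v ≤ R.dep u
    · rw [ip_edgeVec_of_le _ (Ne.symm huv) hd]
      linarith [h.ip_le (u := R.par u) (v := v) (by omega) (by omega)]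
    · have hne' : v ≠ R.par u := by rintro rfl; omega
      rw [ip_edgeVec_step _ huv hne' hv2 (by omega)]
      have := ih (by omega)
      nlinarith

lemma Deep.edge_cost_crit : (1 - s ^ 2) ^ 2 + e * (s ^ 2) ^ 2 + (1 + s ^ 2) ^ 2 * k ≤
    2 - s - s ^ 3 + 4 * (k - (1 - s)) := by
  have hlb := h.lb
  have h1 : e * (s ^ 2) ^ 2 = (1 - s) ^ 2 * s ^ 3 := by rw [← h.he]; ring
  have h2 : (1 - s ^ 2) ^ 2 + (1 - s) ^ 2 * s ^ 3 + (1 + s ^ 2) ^ 2 * (1 - s) =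
      2 - s - s ^ 3 := by ring
  have h3 : (1 + s ^ 2) ^ 2 ≤ 4 := by
    have := h.pos; have := h.lt_one
    have : s ^ 2 ≤ 1 := by nlinarith
    nlinarith [sq_nonneg s]
  nlinarith

lemma Deep.cheap_pair {S : Finset N} (hS : R.Closed S) {u v : N} (hne : u ≠ v) (hu : u ∈ S)
    (hv : v ∈ S) (hdu : D + 2 ≤ R.dep u) (hdv : D + 2 ≤ R.dep v) :
    R.Cheap e S (Pi.single u 1 + Pi.single v 1) (2 - s - s ^ 3 + 4 * (k - (1 - s))) := by
  have hD := h.one_lt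
  wlog hd : R.dep v ≤ R.dep u generalizing u v
  · rw [add_comm]; exact this hne.symm hv hu hdv hdu (by omega)
  have hpu := R.dep_par_of (u := u) (by omega)
  by_cases hp : R.par u = v
  · subst hp
    refine cheap_of_mem (z := edgeVec R s (s ^ 2) u) (edgeVec_mem hS hu (by omega) _)
      (target_edgeVec _ _) ?_
    rw [ip_edgeVec_self _ (by omega)]
    have := h.self_le (R.par u) (by omega)
    have h2 : (1 + s ^ 2) ^ 2 * ip e (R.chain s (R.par u)) (R.chain s (R.par u)) ≤
      (1 + s ^ 2) ^ 2 * k := mul_le_mul_of_nonneg_left this (by positivity)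
    linarith [h.edge_cost_crit]
  · refine cheap_of_mem (z := R.chain s u + R.chain s v)
      (Submodule.add_mem _ (chain_mem_Adm hS hu s) (chain_mem_Adm hS hv s))
      (by rw [target_add, target_chain, target_chain]) ?_
    simp only [ip_add_left, ip_add_right]
    rw [ip_comm e (R.chain s v) (R.chain s u)]
    have h1 := h.self_le u (by omega)
    have h2 := h.self_le v (by omega)
    have h3 := h.ip_le_far hne hp hdu hdv hd
    have hlo := h.lo
    have hhi := h.hi
    have hub := h.ub
    have hlb := h.lb
    have hs2 : s ^ 2 ≤ 0.755 := by nlinarith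
    have hs3 : s ^ 3 ≤ 0.656 := by nlinarith
    nlinarith [h.k_nonneg]

lemma Deep.cheap_diff {S : Finset N} (hS : R.Closed S) {u v : N} (hu : u ∈ S)
    (hv : v ∈ S) (hdu : D ≤ R.dep u) (hdv : D ≤ R.dep v) :
    R.Cheap e S (Pi.single u 1 - Pi.single v 1) (2 * k) := by
  refine cheap_of_mem (z := R.chain s u + (-1 : ℝ) • R.chain s v)
      (Submodule.add_mem _ (chain_mem_Adm hS hu s)
        (Submodule.smul_mem _ _ (chain_mem_Adm hS hv s)))
      (by rw [target_add, target_smul, target_chain, target_chain]; simp [sub_eq_add_neg]) ?_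
  simp only [ip_add_left, ip_add_right, ip_smul_left, ip_smul_right]
  rw [ip_comm e (R.chain s v) (R.chain s u)]
  linarith [h.self_le u hdu, h.self_le v hdv, h.ip_nonneg u v]

lemma Deep.cheap_mixed {S : Finset N} (hS : R.Closed S) {a b c : N} (hab : a ≠ b)
    (ha : a ∈ S) (hb : b ∈ S) (hc : c ∈ S) (hda : D + 1 ≤ R.dep a) (hdb : D + 1 ≤ R.dep b)
    (hdc : D + 1 ≤ R.dep c) :
    R.Cheap e S (Pi.single a 1 + Pi.single b 1 - Pi.single c 1) 0.98 := by
  refine cheap_of_mem (z := R.chain s a + R.chain s b + (-1 : ℝ) • R.chain s c)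
      (Submodule.add_mem _ (Submodule.add_mem _ (chain_mem_Adm hS ha s) (chain_mem_Adm hS hb s))
        (Submodule.smul_mem _ _ (chain_mem_Adm hS hc s)))
      (by
        rw [target_add, target_add, target_smul, target_chain, target_chain, target_chain]
        simp [sub_eq_add_neg]) ?_
  simp only [ip_add_left, ip_add_right, ip_smul_left, ip_smul_right]
  rw [ip_comm e (R.chain s c) (R.chain s a), ip_comm e (R.chain s c) (R.chain s b),
    ip_comm e (R.chain s b) (R.chain s a)]
  have h1 := h.ip_le_of_ne hab hda hdb
  have hhi := h.hi
  have hub := h.ub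
  have : s * k ≤ 0.13 := by nlinarith [h.k_nonneg, h.lo]
  linarith [h.self_le a (by omega), h.self_le b (by omega), h.self_le c (by omega),
    h.ip_nonneg a c, h.ip_nonneg b c]

/-- An edge pair together with a far third token. -/
lemma Deep.cheap_edge_add {S : Finset N} (hS : R.Closed S) {u v : N} (hu : u ∈ S) (hv : v ∈ S)
    (hdu : D + 2 ≤ R.dep u) (hdv : D ≤ R.dep v)
    (hI : 2 * ip e (edgeVec R s (3 / 4) u) (R.chain s v) ≤ 0.373) :
    R.Cheap e S (Pi.single u 1 + Pi.single (R.par u) 1 + Pi.single v 1) 0.98 := by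
  have hD := h.one_lt
  have hpu := R.dep_par_of (u := u) (by omega)
  refine cheap_of_mem (z := edgeVec R s (3 / 4) u + R.chain s v)
      (Submodule.add_mem _ (edgeVec_mem hS hu (by omega) _) (chain_mem_Adm hS hv s))
      (by rw [target_add, target_edgeVec, target_chain]) ?_
  rw [ip_add_left, ip_add_right, ip_add_right, ip_comm e (R.chain s v) (edgeVec _ _ _ _),
    ip_edgeVec_self _ (by omega)]
  have h1 := h.self_le (R.par u) (by omega)
  have h2 := h.self_le v (by omega)
  linarith [h.ub, h.e_le]

lemma Deep.cheap_tri_sorted {S : Finset N} (hS : R.Closed S) {a b c : N} (hab : a ≠ b)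
    (hac : a ≠ c) (hbc : b ≠ c)
    (ha : a ∈ S) (hb : b ∈ S) (hc : c ∈ S) (hda : D + 3 ≤ R.dep a) (hdb : D + 3 ≤ R.dep b)
    (hdc : D + 3 ≤ R.dep c) (hd1 : R.dep b ≤ R.dep a) (hd2 : R.dep c ≤ R.dep b) :
    R.Cheap e S (Pi.single a 1 + Pi.single b 1 + Pi.single c 1)
      (1 - e + 6 * (k - (1 - s))) := by
  have hD := h.one_lt
  have hlo := h.lo
  have hhi := h.hi
  have hub := h.ub
  have hlb := h.lb
  have hk := h.k_nonneg
  have hel := h.e_le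
  have he0 := h.e_nonneg
  have hpa := R.dep_par_of (u := a) (by omega)
  have hpb := R.dep_par_of (u := b) (by omega)
  have hpc := R.dep_par_of (u := c) (by omega)
  have hs2 : s ^ 2 ≤ 0.755 := by nlinarith
  have hs3 : s ^ 3 ≤ 0.656 := by nlinarith
  have hcut : (0.98 : ℝ) ≤ 1 - e + 6 * (k - (1 - s)) := by linarith
  by_cases hpab : R.par a = b
  · by_cases hpbc : R.par b = c
    · set T : ℝ := s ^ 2 + s ^ 4 with hT
      have heq : e = (1 - s) ^ 2 * (s ^ 3 + s ^ 5) := by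
        linear_combination (s ^ 5 + s ^ 3) * h.he - e * h.eq
      have hT2 : (1 + T) ^ 2 ≤ 6 := by
        have : s ^ 4 ≤ 0.5701 := by
          have : s ^ 4 = s ^ 2 * s ^ 2 := by ring
          rw [this]; nlinarith [sq_nonneg s]
        have h0 : 0 ≤ s ^ 2 + s ^ 4 := by positivity
        rw [← hT] at h0
        have h1 : T ≤ 1.3251 := by rw [hT]; linarith
        nlinarith
      refine cheap_of_mem (z := Pi.single a (s ^ 3, 1 - s ^ 3) + Pi.single b (T, 1 + s ^ 3 - T) +
        (1 + T) • R.chain s c) (Submodule.add_mem _ (Submodule.add_mem _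
          (single_mem_Adm ha (by omega) _) (single_mem_Adm hb (by omega) _))
          (Submodule.smul_mem _ _ (chain_mem_Adm hS hc s))) ?_ ?_
      · rw [target_add, target_add, target_smul, target_chain, target_single, target_single,
          hpab, hpbc]
        funext k; simp; ring
      · simp only [ip_add_left, ip_add_right, ip_smul_left, ip_smul_right]
        rw [ip_comm e (R.chain s c) (Pi.single a _), ip_comm e (R.chain s c) (Pi.single b _),
          R.ip_single_chain_zero e s hac (by omega), R.ip_single_chain_zero e s hbc (by omega)]
        have := h.self_le c (by omega)
        simp only [ip_single_left, Pi.single_eq_same, Pi.single_eq_of_ne hab,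
          Pi.single_eq_of_ne hab.symm, Prod.fst_zero, Prod.snd_zero]
        have key : (1 - s ^ 3) ^ 2 + e * s ^ 6 + (1 + s ^ 3 - T) ^ 2 + e * T ^ 2 +
            (1 + T) ^ 2 * (1 - s) = 1 - e := by
          rw [heq, hT]
          linear_combination (-2 + s + s ^ 3 - 2 * s ^ 4 + 4 * s ^ 5 - 6 * s ^ 6 + 4 * s ^ 7 -
            2 * s ^ 8 + s ^ 9) * h.eq
        have h5 : (1 + T) ^ 2 * ip e (R.chain s c) (R.chain s c) ≤ (1 + T) ^ 2 * k :=
          mul_le_mul_of_nonneg_left this (sq_nonneg _)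
        have h6 : (1 + T) ^ 2 * (k - (1 - s)) ≤ 6 * (k - (1 - s)) :=
          mul_le_mul_of_nonneg_right hT2 (by linarith)
        linarith
    · refine Cheap.mono ?_ hcut
      have := h.cheap_edge_add hS (u := a) (v := c) ha hc (by omega) (by omega) ?_
      · rwa [hpab] at this
      · rw [ip_edgeVec_of_le _ hac (by omega), hpab]
        have := h.ip_le_far hbc hpbc (by omega) (by omega) hd2
        nlinarith
  by_cases hpac : R.par a = c
  · by_cases hpbc : R.par b = c
    · refine Cheap.mono ?_ hcut
      refine cheap_of_mem (z := Pi.single a (17 / 25, 8 / 25) + Pi.single b (17 / 25, 8 / 25) +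
        (59 / 25 : ℝ) • R.chain s c) (Submodule.add_mem _ (Submodule.add_mem _
          (single_mem_Adm ha (by omega) _) (single_mem_Adm hb (by omega) _))
          (Submodule.smul_mem _ _ (chain_mem_Adm hS hc s))) ?_ ?_
      · rw [target_add, target_add, target_smul, target_chain, target_single, target_single,
          hpac, hpbc]
        funext k; simp; ring
      · simp only [ip_add_left, ip_add_right, ip_smul_left, ip_smul_right]
        rw [ip_comm e (R.chain s c) (Pi.single a _), ip_comm e (R.chain s c) (Pi.single b _),
          R.ip_single_chain_zero e s hac (by omega), R.ip_single_chain_zero e s hbc (by omega)]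
        have := h.self_le c (by omega)
        simp only [ip_single_left, Pi.single_eq_same, Pi.single_eq_of_ne hab,
          Pi.single_eq_of_ne hab.symm, Prod.fst_zero, Prod.snd_zero]
        linarith
    · refine Cheap.mono ?_ hcut
      have := h.cheap_edge_add hS (u := a) (v := b) ha hb (by omega) (by omega) ?_
      · rw [hpac] at this
        rwa [add_right_comm] at this
      · rw [ip_edgeVec_of_le _ hab (by omega), hpac, ip_comm]
        have := h.ip_le_far hbc hpbc (by omega) (by omega) hd2
        nlinarith
  by_cases hpbc : R.par b = c
  · refine Cheap.mono ?_ hcut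
    have := h.cheap_edge_add hS (u := b) (v := a) hb ha (by omega) (by omega) ?_
    · rw [hpbc] at this
      rwa [add_comm, ← add_assoc] at this
    · subst hpbc
      have hppa := R.dep_par_of (u := R.par a) (by omega)
      rw [ip_edgeVec_step _ hab hac (by omega) (by omega),
        ip_edgeVec_step _ hpab hpac (by omega) (by omega)]
      have := h.ip_edgeVec_le (u := b) (v := R.par (R.par a)) (by omega) (by omega)
      nlinarith
  have hsum : ∀ x y w, ip e (R.chain s a) (R.chain s b) ≤ x → ip e (R.chain s a) (R.chain s c) ≤ y →
      ip e (R.chain s b) (R.chain s c) ≤ w → 2 * (x + y + w) ≤ 0.58 →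
      R.Cheap e S (Pi.single a 1 + Pi.single b 1 + Pi.single c 1)
        (1 - e + 6 * (k - (1 - s))) := by
    intro x y w hx hy hw hxyw
    refine Cheap.mono ?_ hcut
    refine cheap_of_mem (z := R.chain s a + R.chain s b + R.chain s c)
      (Submodule.add_mem _ (Submodule.add_mem _ (chain_mem_Adm hS ha s) (chain_mem_Adm hS hb s))
        (chain_mem_Adm hS hc s))
      (by simp only [target_add, target_chain]) ?_
    simp only [ip_add_left, ip_add_right]
    rw [ip_comm e (R.chain s c) (R.chain s a), ip_comm e (R.chain s c) (R.chain s b),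
      ip_comm e (R.chain s b) (R.chain s a)]
    linarith [h.self_le a (by omega), h.self_le b (by omega), h.self_le c (by omega)]
  have fab := h.ip_le_far hab hpab (by omega) (by omega) hd1
  have fac := h.ip_le_far hac hpac (by omega) (by omega) (hd2.trans hd1)
  have fbc := h.ip_le_far hbc hpbc (by omega) (by omega) hd2
  have n2 : s ^ 2 * k ≤ 0.0991 := by nlinarith
  have n3 : s ^ 3 * k ≤ 0.0861 := by nlinarith
  rcases h.ip_le_farther hab hpab hda hdb hd1 with h1 | h1 | ⟨h1, h1'⟩
  · exact hsum _ _ _ h1 fac fbc (by linarith)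
  · rcases h.ip_le_farther hac hpac hda hdc (hd2.trans hd1) with h2 | h2 | ⟨h2, h2'⟩
    · exact hsum _ _ _ fab h2 fbc (by linarith)
    · exact absurd (h1.symm.trans h2) hbc
    · have := R.dep_par_of (u := R.par a) (by omega)
      rw [h1] at this; omega
  rcases h.ip_le_farther hac hpac hda hdc (hd2.trans hd1) with h2 | h2 | ⟨h2, h2'⟩
  · exact hsum _ _ _ fab h2 fbc (by linarith)
  · refine Cheap.mono ?_ hcut
    have hz : R.par a ∈ S := hS a ha (R.ne_root_of_dep (by omega))
    have hpz := R.dep_par_of (u := R.par a) (by omega)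
    rw [h2] at hpz
    refine cheap_of_mem (z := Pi.single a (7 / 10, 3 / 10) + Pi.single b (7 / 10, 3 / 10) +
        Pi.single (R.par a) (11 / 10, 3 / 10) + (21 / 10 : ℝ) • R.chain s c)
        (Submodule.add_mem _ (Submodule.add_mem _ (Submodule.add_mem _
          (single_mem_Adm ha (by omega) _) (single_mem_Adm hb (by omega) _))
          (single_mem_Adm hz (by omega) _))
          (Submodule.smul_mem _ _ (chain_mem_Adm hS hc s))) ?_ ?_
    · simp only [target_add, target_smul, target_chain, target_single, ← h1', h2]
      funext k; simp; ring
    · have haz : a ≠ R.par a := (R.par_ne (by omega)).symm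
      have hbz : b ≠ R.par a := Ne.symm hpab
      simp only [ip_add_left, ip_add_right, ip_smul_left, ip_smul_right]
      rw [ip_comm e (R.chain s c) (Pi.single a _), ip_comm e (R.chain s c) (Pi.single b _),
        ip_comm e (R.chain s c) (Pi.single (R.par a) _),
        R.ip_single_chain_zero e s hac (by omega), R.ip_single_chain_zero e s hbc (by omega),
        R.ip_single_chain_zero e s hpac (by omega)]
      have := h.self_le c (by omega)
      simp only [ip_single_left, Pi.single_eq_same, Pi.single_eq_of_ne hab,
        Pi.single_eq_of_ne hab.symm, Pi.single_eq_of_ne haz, Pi.single_eq_of_ne haz.symm,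
        Pi.single_eq_of_ne hbz, Pi.single_eq_of_ne hbz.symm, Prod.fst_zero, Prod.snd_zero]
      linarith
  · refine Cheap.mono ?_ hcut
    have hz : R.par a ∈ S := hS a ha (R.ne_root_of_dep (by omega))
    refine cheap_of_mem (z := Pi.single a (7 / 10, 3 / 10) + Pi.single b (7 / 10, 3 / 10) +
        Pi.single c (7 / 10, 3 / 10) + (21 / 10 : ℝ) • R.chain s (R.par a))
        (Submodule.add_mem _ (Submodule.add_mem _ (Submodule.add_mem _
          (single_mem_Adm ha (by omega) _) (single_mem_Adm hb (by omega) _))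
          (single_mem_Adm hc (by omega) _))
          (Submodule.smul_mem _ _ (chain_mem_Adm hS hz s))) ?_ ?_
    · simp only [target_add, target_smul, target_chain, target_single, ← h1', ← h2']
      funext k; simp; ring
    · have haz : a ≠ R.par a := (R.par_ne (by omega)).symm
      have hbz : b ≠ R.par a := Ne.symm hpab
      have hcz : c ≠ R.par a := Ne.symm hpac
      simp only [ip_add_left, ip_add_right, ip_smul_left, ip_smul_right]
      rw [ip_comm e (R.chain s (R.par a)) (Pi.single a _),
        ip_comm e (R.chain s (R.par a)) (Pi.single b _),
        ip_comm e (R.chain s (R.par a)) (Pi.single c _),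
        R.ip_single_chain_zero e s haz (by omega), R.ip_single_chain_zero e s hbz (by omega),
        R.ip_single_chain_zero e s hcz (by omega)]
      have := h.self_le (R.par a) (by omega)
      simp only [ip_single_left, Pi.single_eq_same, Pi.single_eq_of_ne hab,
        Pi.single_eq_of_ne hab.symm, Pi.single_eq_of_ne hac, Pi.single_eq_of_ne hac.symm,
        Pi.single_eq_of_ne hbc, Pi.single_eq_of_ne hbc.symm, Prod.fst_zero, Prod.snd_zero]
      linarith

lemma Deep.cheap_tri {S : Finset N} (hS : R.Closed S) {a b c : N} (hab : a ≠ b)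
    (hac : a ≠ c) (hbc : b ≠ c)
    (ha : a ∈ S) (hb : b ∈ S) (hc : c ∈ S) (hda : D + 3 ≤ R.dep a) (hdb : D + 3 ≤ R.dep b)
    (hdc : D + 3 ≤ R.dep c) :
    R.Cheap e S (Pi.single a 1 + Pi.single b 1 + Pi.single c 1)
      (1 - e + 6 * (k - (1 - s))) := by
  wlog h1 : R.dep b ≤ R.dep a generalizing a b
  · rw [add_comm (Pi.single a 1)]
    exact this hab.symm hbc hac hb ha hdb hda (by omega)
  by_cases h2 : R.dep c ≤ R.dep b
  · exact h.cheap_tri_sorted hS hab hac hbc ha hb hc hda hdb hdc h1 h2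
  by_cases h3 : R.dep c ≤ R.dep a
  · rw [add_right_comm]
    exact h.cheap_tri_sorted hS hac hab hbc.symm ha hc hb hda hdc hdb h3 (by omega)
  · rw [add_comm, ← add_assoc]
    exact h.cheap_tri_sorted hS hac.symm hbc.symm hab hc ha hb hdc hda hdb (by omega) h1

end Deep
end RTree

/-- The quadratic form of a matrix. -/
def qf {V : Type*} [Fintype V] (A : Matrix V V ℝ) (x : V → ℝ) : ℝ := x ⬝ᵥ A.mulVec x

lemma qf_sub {V : Type*} [Fintype V] {A : Matrix V V ℝ} (hA : A.IsSymm) (x y : V → ℝ) :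
    qf A (x - y) = qf A x - 2 * (y ⬝ᵥ A.mulVec x) + qf A y := by
  have h : x ⬝ᵥ A.mulVec y = y ⬝ᵥ A.mulVec x := by
    rw [Matrix.dotProduct_mulVec, ← Matrix.mulVec_transpose, hA.eq, dotProduct_comm]
  simp only [qf, Matrix.mulVec_sub, dotProduct_sub, sub_dotProduct]
  rw [h]; ring

namespace RTree
variable {N : Type*} [Fintype N] [DecidableEq N] {R : RTree N}
  {V : Type*} [Fintype V] [DecidableEq V]

/-- A realisation of the edges of a tree by vertices of a signed graph. -/
structure Emb (R : RTree N) (A : Matrix V V ℝ) where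
  vtx : N → V
  sg : N → ℝ
  inj : ∀ i j, i ≠ R.root → j ≠ R.root → vtx i = vtx j → i = j
  sq : ∀ i, sg i * sg i = 1
  gram : ∀ i j, i ≠ R.root → j ≠ R.root →
    A (vtx i) (vtx j) + (if i = j then 2 else 0) = sg i * sg j * ∑ k, R.row i k * R.row j k

variable {A : Matrix V V ℝ} (E : R.Emb A)

/-- The vector with flow `φ` on the realised edges. -/
def Emb.vec (φ : N → ℝ) : V → ℝ := ∑ i, (E.sg i * φ i) • Pi.single (E.vtx i) 1

lemma Emb.vec_dot (φ : N → ℝ) (w : V → ℝ) :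
    E.vec φ ⬝ᵥ w = ∑ i, E.sg i * φ i * w (E.vtx i) := by
  unfold vec
  rw [sum_dotProduct]
  exact Finset.sum_congr rfl fun i _ => by simp

lemma Emb.vec_self (φ : N → ℝ) (h0 : φ R.root = 0) : E.vec φ ⬝ᵥ E.vec φ = ∑ i, φ i ^ 2 := by
  rw [E.vec_dot]
  refine Finset.sum_congr rfl fun i _ => ?_
  by_cases hi : i = R.root
  · subst hi; rw [h0]; simp
  have : E.vec φ (E.vtx i) = E.sg i * φ i := by
    unfold vec
    rw [Finset.sum_apply, Finset.sum_eq_single i]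
    · simp
    · intro j _ hj
      by_cases hjr : j = R.root
      · subst hjr; rw [h0]; simp
      · have : E.vtx i ≠ E.vtx j := fun h => hj (E.inj i j hi hjr h).symm
        simp [this]
    · simp
  rw [this]
  linear_combination φ i ^ 2 * E.sq i

lemma Emb.qf_vec (φ : N → ℝ) (h0 : φ R.root = 0) :
    qf A (E.vec φ) + 2 * (E.vec φ ⬝ᵥ E.vec φ) = ∑ k, (∑ i, φ i * R.row i k) ^ 2 := by
  have h1 : ∀ i, A.mulVec (E.vec φ) (E.vtx i) = ∑ j, E.sg j * φ j * A (E.vtx i) (E.vtx j) := by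
    intro i
    rw [Matrix.mulVec, dotProduct_comm, E.vec_dot]
  rw [qf, E.vec_dot, E.vec_self φ h0]
  simp only [h1]
  have h2 : ∀ k, (∑ i, φ i * R.row i k) ^ 2 =
      ∑ i, ∑ j, φ i * φ j * (R.row i k * R.row j k) := by
    intro k
    rw [pow_two, Finset.sum_mul_sum]
    exact Finset.sum_congr rfl fun i _ => Finset.sum_congr rfl fun j _ => by ring
  simp only [h2]
  rw [Finset.sum_comm, Finset.mul_sum, ← Finset.sum_add_distrib]
  refine Finset.sum_congr rfl fun i _ => ?_
  rw [Finset.sum_comm]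
  have h3 : 2 * φ i ^ 2 = ∑ j, (if i = j then 2 * φ i ^ 2 else 0) := by simp
  rw [h3, Finset.mul_sum, ← Finset.sum_add_distrib]
  refine Finset.sum_congr rfl fun j _ => ?_
  rw [← Finset.mul_sum]
  by_cases hi : i = R.root
  · subst hi; simp [h0]
  by_cases hj : j = R.root
  · subst hj; simp [h0, hi]
  have hg := E.gram i j hi hj
  have hsi := E.sq i
  have hsj := E.sq j
  by_cases hij : i = j
  · subst hij
    rw [if_pos rfl] at hg ⊢
    linear_combination (φ i ^ 2) * (E.sg i * E.sg i) * hg +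
      φ i ^ 2 * ((E.sg i * E.sg i + 1) * ∑ k, R.row i k * R.row i k) * hsi
      - 2 * φ i ^ 2 * hsi
  · rw [if_neg hij] at hg ⊢
    linear_combination (φ i * φ j * E.sg i * E.sg j) * hg +
      φ i * φ j * (∑ k, R.row i k * R.row j k) * (E.sg j * E.sg j * hsi + hsj)

lemma Emb.eval (hA : A.IsSymm) {e : ℝ} {X : V → ℝ} {C : N → ℝ} {z : N → ℝ × ℝ}
    (hX : ∀ i, i ≠ R.root → X (E.vtx i) = 0) (hz : R.target z = C)
    (h0 : (z R.root).1 = 0)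
    (hC : ∀ i, (z i).1 ≠ 0 → C i - C (R.par i) = E.sg i * A.mulVec X (E.vtx i)) :
    let Y := X - E.vec fun i => (z i).1
    qf A Y + (2 + e) * (Y ⬝ᵥ Y) =
      qf A X + (2 + e) * (X ⬝ᵥ X) - ∑ i, C i ^ 2 + ip e z z ∧
    Y ⬝ᵥ Y = X ⬝ᵥ X + ∑ i, (z i).1 ^ 2 := by
  intro Y
  set φ : N → ℝ := fun i => (z i).1 with hφ
  have hcross : E.vec φ ⬝ᵥ X = 0 := by
    rw [E.vec_dot]
    refine Finset.sum_eq_zero fun i _ => ?_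
    by_cases hi : i = R.root
    · subst hi; simp [hφ, h0]
    · rw [hX i hi]; simp
  have hYY : Y ⬝ᵥ Y = X ⬝ᵥ X + ∑ i, (z i).1 ^ 2 := by
    have := E.vec_self φ h0
    have hYφ : Y = X - E.vec φ := rfl
    simp only [hYφ, sub_dotProduct, dotProduct_sub]
    rw [dotProduct_comm X (E.vec φ), hcross, this]; ring
  refine ⟨?_, hYY⟩
  have hlin : E.vec φ ⬝ᵥ A.mulVec X = ∑ k, C k * ∑ i, φ i * R.row i k := by
    rw [E.vec_dot]
    simp only [Finset.mul_sum]
    rw [Finset.sum_comm]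
    refine Finset.sum_congr rfl fun i _ => ?_
    have h1 : ∑ k, C k * (φ i * R.row i k) = φ i * (C i - C (R.par i)) := by
      simp only [row, mul_sub, Finset.sum_sub_distrib, mul_ite, mul_one, mul_zero,
        Finset.sum_ite_eq, Finset.mem_univ, if_true]
      ring
    rw [h1]
    by_cases hi : φ i = 0
    · simp [hi]
    · rw [hC i hi]; ring
  have hq := E.qf_vec φ h0
  have hqs := qf_sub hA X (E.vec φ)
  have hrow : ∀ k, ∑ i, φ i * R.row i k = C k - (z k).2 := by
    intro k; rw [← hz]; simp [target, hφ]
  have hip : ip e z z = ∑ k, ((z k).2 ^ 2 + e * (z k).1 ^ 2) :=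
    Finset.sum_congr rfl fun i _ => by ring
  rw [E.vec_self φ h0] at hq
  rw [hYY, hqs, hlin, hip, Finset.sum_add_distrib, ← Finset.mul_sum]
  simp only [hrow] at hq ⊢
  have h3 : ∑ k, (C k - (z k).2) ^ 2 = ∑ k, (z k).2 ^ 2 - ∑ k, C k ^ 2 +
      2 * ∑ k, C k * (C k - (z k).2) := by
    rw [Finset.mul_sum, ← Finset.sum_sub_distrib, ← Finset.sum_add_distrib]
    exact Finset.sum_congr rfl fun k _ => by ring
  linarith

/-- In a graph all of whose proper restrictions are good, cheap representations are
impossible. -/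
lemma Emb.no_cheap (hA : A.IsSymm) {lam e : ℝ}
    (hmin : ∀ x v, x v = 0 → 0 ≤ qf A x + lam * (x ⬝ᵥ x)) (hlam : lam ≤ 2 + e)
    {X : V → ℝ} {C : N → ℝ} {S : Finset N} {c : ℝ}
    (hX : ∀ i, i ≠ R.root → X (E.vtx i) = 0) (hX1 : 1 ≤ X ⬝ᵥ X)
    (hcheap : R.Cheap e S C c) (hdep : ∃ i, R.dep i = 1)
    (hC : ∀ i ∈ S, 2 ≤ R.dep i → C i - C (R.par i) = E.sg i * A.mulVec X (E.vtx i)) :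
    2 + e - lam ≤ qf A X + (2 + e) * (X ⬝ᵥ X) - ∑ i, C i ^ 2 + c := by
  obtain ⟨z, hz, hz1, hzS, hzc⟩ := hcheap
  obtain ⟨i₀, hi₀⟩ := hdep
  have hr : (z R.root).1 = 0 := hz1 _ (by rw [R.dep_root]; omega)
  obtain ⟨h1, h2⟩ := E.eval hA (e := e) hX hz hr (fun i hi => hC i
    (by by_contra hS; exact hi (by rw [hzS i hS]; rfl)) (by
      by_contra hd; exact hi (hz1 i (by omega))))
  set Y := X - E.vec fun i => (z i).1 with hY
  have hi₀r : i₀ ≠ R.root := R.ne_root_of_dep (by omega)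
  have hYz : Y (E.vtx i₀) = 0 := by
    rw [hY, Pi.sub_apply, hX i₀ hi₀r, zero_sub, neg_eq_zero]
    unfold vec
    rw [Finset.sum_apply]
    refine Finset.sum_eq_zero fun j _ => ?_
    by_cases hj : R.dep j ≤ 1
    · simp [hz1 j hj]
    · have hjr : j ≠ R.root := R.ne_root_of_dep (by omega)
      have : E.vtx i₀ ≠ E.vtx j := fun h => by
        have := E.inj _ _ hi₀r hjr h
        subst this; omega
      simp [this]
  have h3 := hmin Y _ hYz
  have h4 : 0 ≤ ∑ i, (z i).1 ^ 2 := Finset.sum_nonneg fun i _ => sq_nonneg _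
  have h5 : 1 ≤ Y ⬝ᵥ Y := by linarith
  nlinarith

end RTree

lemma exists_of_sum_sq_eq_one {N : Type*} [DecidableEq N] {c : N → ℤ} {S : Finset N}
    (h : ∑ i ∈ S, c i ^ 2 = 1) : ∃ i ∈ S, c i ^ 2 = 1 ∧ ∀ k ∈ S, k ≠ i → c k = 0 := by
  obtain ⟨i, hi, hci⟩ : ∃ i ∈ S, c i ≠ 0 := by
    by_contra hc
    push Not at hc
    rw [Finset.sum_eq_zero fun i hi => by rw [hc i hi]; rfl] at h
    omega
  have h1 := Finset.add_sum_erase S (fun i => c i ^ 2) hi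
  have h2 : 0 ≤ ∑ x ∈ S.erase i, c x ^ 2 := Finset.sum_nonneg fun _ _ => sq_nonneg _
  have h3 : 0 < c i ^ 2 := by positivity
  have h4 : ∑ x ∈ S.erase i, c x ^ 2 = 0 := by omega
  rw [Finset.sum_eq_zero_iff_of_nonneg fun _ _ => sq_nonneg _] at h4
  exact ⟨i, hi, by omega, fun k hk hki => by
    simpa using h4 k (Finset.mem_erase.2 ⟨hki, hk⟩)⟩

lemma exists_of_sum_sq_eq_two {N : Type*} [DecidableEq N] {c : N → ℤ} {S : Finset N}
    (h : ∑ i ∈ S, c i ^ 2 = 2) : ∃ i ∈ S, ∃ j ∈ S, i ≠ j ∧ c i ^ 2 = 1 ∧ c j ^ 2 = 1 ∧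
      ∀ k ∈ S, k ≠ i → k ≠ j → c k = 0 := by
  obtain ⟨i, hi, hci⟩ : ∃ i ∈ S, c i ≠ 0 := by
    by_contra hc
    push Not at hc
    rw [Finset.sum_eq_zero fun i hi => by rw [hc i hi]; rfl] at h
    omega
  have h1 := Finset.add_sum_erase S (fun i => c i ^ 2) hi
  have h2 : 0 ≤ ∑ x ∈ S.erase i, c x ^ 2 := Finset.sum_nonneg fun _ _ => sq_nonneg _
  have h3 : 0 < c i ^ 2 := by positivity
  have h5 : c i ^ 2 = 1 := by
    have : c i ^ 2 ≤ 2 := by omega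
    have h6 : c i ≤ 1 := by nlinarith
    have h7 : -1 ≤ c i := by nlinarith
    interval_cases hh : c i <;> simp_all
  obtain ⟨j, hj, hcj, hrest⟩ := exists_of_sum_sq_eq_one (c := c) (S := S.erase i) (by omega)
  exact ⟨i, hi, j, Finset.mem_of_mem_erase hj, (Finset.ne_of_mem_erase hj).symm, h5, hcj,
    fun k hk hki hkj => hrest k (Finset.mem_erase.2 ⟨hki, hk⟩) hkj⟩

lemma sum_abs_le_sum_sq {N : Type*} (c : N → ℤ) (S : Finset N) :
    ∑ i ∈ S, |c i| ≤ ∑ i ∈ S, c i ^ 2 := by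
  refine Finset.sum_le_sum fun i _ => ?_
  rw [← sq_abs]
  have := abs_nonneg (c i)
  rcases eq_or_lt_of_le this with h | h
  · rw [← h]; norm_num
  · nlinarith

namespace RTree
variable {N : Type*} [Fintype N] [DecidableEq N] {R : RTree N}
  {V : Type*} [Fintype V] [DecidableEq V] {A : Matrix V V ℝ} {s e k : ℝ} {D : ℕ}

lemma Deep.cheap_two (h : Deep R s e k D) {S : Finset N} (hS : R.Closed S) {u v : N}
    (hne : u ≠ v) (hu : u ∈ S) (hv : v ∈ S) (hdu : D + 2 ≤ R.dep u) (hdv : D + 2 ≤ R.dep v)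
    {a b : ℝ} (ha : a = 1 ∨ a = -1) (hb : b = 1 ∨ b = -1) :
    R.Cheap e S (a • Pi.single u 1 + b • Pi.single v 1) (2 - s - s ^ 3 + 4 * (k - (1 - s))) := by
  have hlo := h.lo
  have hhi := h.hi
  have hub := h.ub
  have hlb := h.lb
  have h2 : 2 * k ≤ 2 - s - s ^ 3 + 4 * (k - (1 - s)) := by
    have hs2 : s ^ 2 ≤ 0.755 := by nlinarith
    have hs3 : s ^ 3 ≤ 0.656 := by nlinarith
    nlinarith
  have hp := h.cheap_pair hS hne hu hv hdu hdv
  have hd := (h.cheap_diff hS hu hv (by omega) (by omega)).mono h2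
  rcases ha with rfl | rfl <;> rcases hb with rfl | rfl
  · simpa using hp
  · simpa [sub_eq_add_neg] using hd
  · simpa [sub_eq_add_neg] using hd.smul (-1)
  · simpa [add_comm] using hp.smul (-1)

lemma Deep.cheap_three (h : Deep R s e k D) {S : Finset N} (hS : R.Closed S) {u v w : N}
    (huv : u ≠ v) (huw : u ≠ w) (hvw : v ≠ w) (hu : u ∈ S) (hv : v ∈ S) (hw : w ∈ S)
    (hdu : D + 3 ≤ R.dep u) (hdv : D + 3 ≤ R.dep v) (hdw : D + 3 ≤ R.dep w)
    {a b c : ℝ} (ha : a = 1 ∨ a = -1) (hb : b = 1 ∨ b = -1) (hc : c = 1 ∨ c = -1) :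
    R.Cheap e S (a • Pi.single u 1 + b • Pi.single v 1 + c • Pi.single w 1)
      (1 - e + 6 * (k - (1 - s))) := by
  have hcut : (0.98 : ℝ) ≤ 1 - e + 6 * (k - (1 - s)) := by linarith [h.e_le, h.lb]
  have ht := h.cheap_tri hS huv huw hvw hu hv hw hdu hdv hdw
  have h1 := (h.cheap_mixed hS huv hu hv hw (by omega) (by omega) (by omega)).mono hcut
  have h2 := (h.cheap_mixed hS huw hu hw hv (by omega) (by omega) (by omega)).mono hcut
  have h3 := (h.cheap_mixed hS hvw hv hw hu (by omega) (by omega) (by omega)).mono hcut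
  rcases ha with rfl | rfl <;> rcases hb with rfl | rfl <;> rcases hc with rfl | rfl
  · simpa using ht
  · simpa [sub_eq_add_neg] using h1
  · convert h2 using 1; module
  · convert h3.smul (-1) using 1
    · module
    · ring
  · convert h3 using 1; module
  · convert h2.smul (-1) using 1
    · module
    · ring
  · convert h1.smul (-1) using 1
    · module
    · ring
  · convert ht.smul (-1) using 1
    · module
    · ring

/-- The integer potential `c` describes the adjacencies of `w` to the tree. -/
def Emb.Rep (E : R.Emb A) (w : V) (c : N → ℤ) : Prop :=
  ∀ i, i ≠ R.root → (c i : ℝ) - c (R.par i) = E.sg i * A (E.vtx i) w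

/-- A tree inside a minimal bad graph close to the critical value. -/
structure Ctx (E : R.Emb A) (lam s e k : ℝ) (D : ℕ) : Prop extends Deep R s e k D where
  symm : A.IsSymm
  diag : ∀ v, A v v = 0
  entry : ∀ u v, A u v = -1 ∨ A u v = 0 ∨ A u v = 1
  min : ∀ x v, x v = 0 → 0 ≤ qf A x + lam * (x ⬝ᵥ x)
  gap : 17 * (k - (1 - s)) < 2 + e - lam
  dep_one : ∃ i, R.dep i = 1

variable {E : R.Emb A} {lam : ℝ}

lemma int_sq_one {m : ℤ} (h : m ^ 2 = 1) : (m : ℝ) = 1 ∨ (m : ℝ) = -1 := by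
  rcases mul_self_eq_one_iff.1 ((pow_two m).symm.trans h) with h | h
  · left; simp [h]
  · right; simp [h]

lemma Ctx.rep_sum_sq_le (h : Ctx E lam s e k D) {w : V} (hw : ∀ i, i ≠ R.root → w ≠ E.vtx i)
    {c : N → ℤ} (hc : E.Rep w c) (hdeep : ∀ i, R.dep i ≤ D + 2 → c i = 0) :
    ∑ i, c i ^ 2 ≤ 2 := by
  classical
  by_contra hcon
  have hDp := h.one_lt
  have hlo := h.lo
  have hhi := h.hi
  have hub := h.ub
  have hlb := h.lb
  have hk := h.toDeep.k_nonneg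
  have hel := h.e_le
  have he0 := h.e_nonneg
  -- a minimal closed set carrying norm at least three
  obtain ⟨S, ⟨hS, hS3⟩, hSmin⟩ : ∃ S : Finset N, (R.Closed S ∧ 3 ≤ ∑ i ∈ S, c i ^ 2) ∧
      ∀ S' : Finset N, (R.Closed S' ∧ 3 ≤ ∑ i ∈ S', c i ^ 2) → S.card ≤ S'.card := by
    have hne : ((Finset.univ : Finset (Finset N)).filter
        fun S => R.Closed S ∧ 3 ≤ ∑ i ∈ S, c i ^ 2).Nonempty :=
      ⟨Finset.univ, by
        rw [Finset.mem_filter]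
        exact ⟨Finset.mem_univ _, fun i _ _ => Finset.mem_univ _, by omega⟩⟩
    obtain ⟨S, hS, hSm⟩ := Finset.exists_min_image _ Finset.card hne
    rw [Finset.mem_filter] at hS
    simp only [Finset.mem_filter, Finset.mem_univ, true_and] at hSm
    exact ⟨S, hS.2, hSm⟩
  have hSne : S.Nonempty := by
    by_contra hh
    rw [Finset.not_nonempty_iff_eq_empty] at hh
    subst hh; simp at hS3
  obtain ⟨l, hl, hlmax⟩ := Finset.exists_max_image S R.dep hSne
  have hS' : R.Closed (S.erase l) := by
    intro i hi hir
    rw [Finset.mem_erase] at hi ⊢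
    refine ⟨?_, hS i hi.2 hir⟩
    rintro rfl
    have := hlmax i hi.2
    have := R.dep_par i hir
    omega
  have hsplit := Finset.add_sum_erase S (fun i => c i ^ 2) hl
  have hrest : ∑ i ∈ S.erase l, c i ^ 2 ≤ 2 := by
    by_contra hh
    have h1 := hSmin _ ⟨hS', by omega⟩
    have h2 := Finset.card_erase_lt_of_mem hl
    omega
  have hn0 : 0 ≤ ∑ i ∈ S.erase l, c i ^ 2 := Finset.sum_nonneg fun _ _ => sq_nonneg _
  have hcl : c l ≠ 0 := by intro hh; rw [hh] at hsplit; omega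
  have hdl : D + 3 ≤ R.dep l := by
    by_contra hh; exact hcl (hdeep l (by omega))
  have hlr : l ≠ R.root := R.ne_root_of_dep (by omega)
  have hparmem : R.par l ∈ S.erase l :=
    Finset.mem_erase.2 ⟨R.par_ne (by omega), hS l hl hlr⟩
  -- the truncated potential
  set C : N → ℝ := fun i => if i ∈ S then (c i : ℝ) else 0 with hC
  have hCS : ∀ i ∈ S, C i = c i := fun i hi => by simp [hC, hi]
  have hsq : ∑ i, C i ^ 2 = ((∑ i ∈ S, c i ^ 2 : ℤ) : ℝ) := by
    push_cast
    simp only [hC, ite_pow, ne_eq, OfNat.ofNat_ne_zero, not_false_eq_true, zero_pow]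
    rw [Finset.sum_ite_mem, Finset.univ_inter]
  have hab : ∑ i, |C i| = ((∑ i ∈ S, |c i| : ℤ) : ℝ) := by
    push_cast
    simp only [hC, apply_ite abs, abs_zero]
    rw [Finset.sum_ite_mem, Finset.univ_inter]
  have hno : ∀ cost, R.Cheap e S C cost →
      2 + e - lam ≤ 2 + e - ∑ i, C i ^ 2 + cost := by
    intro cost hcost
    have := E.no_cheap h.symm h.min (e := e) (by linarith [h.gap]) (X := Pi.single w 1)
      (fun i hi => by simp [Ne.symm (hw i hi)]) (by simp) hcost h.dep_one
      (fun i hi hd => by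
        have hir : i ≠ R.root := R.ne_root_of_dep (by omega)
        rw [hCS i hi, hCS _ (hS i hi hir), hc i hir]
        simp)
    simpa [qf, h.diag] using this
  have hsupp : ∀ u, C u ≠ 0 → u ∈ S ∧ D + 1 ≤ R.dep u := by
    intro u hu
    have huS : u ∈ S := by by_contra hh; exact hu (by simp [hC, hh])
    refine ⟨huS, ?_⟩
    by_contra hh
    exact hu (by rw [hCS u huS, hdeep u (by omega)]; simp)
  have hgen := hno _ (h.toDeep.cheap_general hS hsupp)
  have hgap := h.gap
  have hparle : c (R.par l) ^ 2 ≤ ∑ i ∈ S.erase l, c i ^ 2 :=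
    Finset.single_le_sum (f := fun i => c i ^ 2) (fun i _ => sq_nonneg _) hparmem
  have habs := sum_abs_le_sum_sq c (S.erase l)
  have habsplit := Finset.add_sum_erase S (fun i => |c i|) hl
  have hstep : |c l - c (R.par l)| ≤ 1 := by
    have h1 := hc l hlr
    have h2 : |(c l : ℝ) - c (R.par l)| ≤ 1 := by
      rw [h1]
      rw [abs_mul]
      have h3 : |E.sg l| = 1 := by
        have := E.sq l
        have h4 : |E.sg l| * |E.sg l| = 1 := by rw [← abs_mul, this, abs_one]
        nlinarith [abs_nonneg (E.sg l)]
      rw [h3]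
      rcases h.entry (E.vtx l) w with h5 | h5 | h5 <;> rw [h5] <;> norm_num
    exact_mod_cast h2
  have hcut : (0.98 : ℝ) ≤ 1 - e := by linarith
  have hab0 : 0 ≤ ∑ i, |C i| := Finset.sum_nonneg fun _ _ => abs_nonneg _
  have hpar2 : |c (R.par l)| ≤ 1 := by
    have h1 : c (R.par l) ^ 2 ≤ 2 := by omega
    rw [abs_le]
    constructor <;> nlinarith
  have hcl2 : |c l| ≤ 2 := by
    have := abs_sub_abs_le_abs_sub (c l) (c (R.par l))
    omega
  have hcl1 : 1 ≤ |c l| := Int.one_le_abs hcl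
  obtain hl2 | hl1 : |c l| = 2 ∨ |c l| = 1 := by omega
  · have hsql : c l ^ 2 = 4 := by rw [← sq_abs, hl2]; norm_num
    have hpar0 : c (R.par l) ≠ 0 := by
      intro hh; rw [hh, sub_zero, hl2] at hstep; omega
    have : 0 < c (R.par l) ^ 2 := by positivity
    obtain hm | hm : ∑ i ∈ S.erase l, c i ^ 2 = 1 ∨ ∑ i ∈ S.erase l, c i ^ 2 = 2 := by omega
    · have h1 : ∑ i, C i ^ 2 = 5 := by
        rw [hsq, ← hsplit, hsql, hm]; norm_num
      have h2 : ∑ i, |C i| ≤ 3 := by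
        rw [hab]; exact_mod_cast (by omega : ∑ i ∈ S, |c i| ≤ 3)
      rw [h1] at hgen
      have h3 : (∑ i, |C i|) ^ 2 ≤ 9 := by nlinarith
      have h4 : (1 - s) * 5 + s * (∑ i, |C i|) ^ 2 ≤ 9 := by nlinarith
      nlinarith
    · have h1 : ∑ i, C i ^ 2 = 6 := by
        rw [hsq, ← hsplit, hsql, hm]; norm_num
      have h2 : ∑ i, |C i| ≤ 4 := by
        rw [hab]; exact_mod_cast (by omega : ∑ i ∈ S, |c i| ≤ 4)
      rw [h1] at hgen
      have h3 : (∑ i, |C i|) ^ 2 ≤ 16 := by nlinarith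
      have h4 : (1 - s) * 6 + s * (∑ i, |C i|) ^ 2 ≤ 16 := by nlinarith
      nlinarith
  · have hsql : c l ^ 2 = 1 := by rw [← sq_abs, hl1]; norm_num
    have hm : ∑ i ∈ S.erase l, c i ^ 2 = 2 := by omega
    obtain ⟨i, hi, j, hj, hij, hci, hcj, h0⟩ := exists_of_sum_sq_eq_two hm
    have hiS := Finset.mem_of_mem_erase hi
    have hjS := Finset.mem_of_mem_erase hj
    have hil := Finset.ne_of_mem_erase hi
    have hjl := Finset.ne_of_mem_erase hj
    have hdi : D + 3 ≤ R.dep i := by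
      by_contra hh; rw [hdeep i (by omega)] at hci; norm_num at hci
    have hdj : D + 3 ≤ R.dep j := by
      by_contra hh; rw [hdeep j (by omega)] at hcj; norm_num at hcj
    have hCeq : C = (c l : ℝ) • Pi.single l 1 + (c i : ℝ) • Pi.single i 1 +
        (c j : ℝ) • Pi.single j 1 := by
      funext x
      simp only [Pi.add_apply, Pi.smul_apply, smul_eq_mul]
      by_cases hxl : x = l
      · subst hxl; simp [hCS x hl, hil.symm, hjl.symm]
      by_cases hxi : x = i
      · subst hxi; simp [hCS x hiS, hil, hij]
      by_cases hxj : x = j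
      · subst hxj; simp [hCS x hjS, hjl, hij.symm]
      by_cases hxS : x ∈ S
      · rw [hCS x hxS, h0 x (Finset.mem_erase.2 ⟨hxl, hxS⟩) hxi hxj]
        simp [hxl, hxi, hxj]
      · simp [hC, hxS, hxl, hxi, hxj]
    have hch := h.toDeep.cheap_three hS hil.symm hjl.symm hij hl hiS hjS hdl hdi hdj
      (int_sq_one hsql) (int_sq_one hci) (int_sq_one hcj)
    rw [← hCeq] at hch
    have := hno _ hch
    have h1 : ∑ i, C i ^ 2 = 3 := by
      rw [hsq, ← hsplit, hsql, hm]; norm_num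
    rw [h1] at this
    linarith

lemma closed_univ : R.Closed Finset.univ := fun _ _ _ => Finset.mem_univ _

lemma Ctx.cheap_of_norm_two (h : Ctx E lam s e k D) {c : N → ℤ} (hc : ∑ i, c i ^ 2 = 2)
    (hdeep : ∀ i, R.dep i ≤ D + 2 → c i = 0) :
    R.Cheap e Finset.univ (fun i => (c i : ℝ)) (2 - s - s ^ 3 + 4 * (k - (1 - s))) := by
  obtain ⟨i, -, j, -, hij, hci, hcj, h0⟩ := exists_of_sum_sq_eq_two hc
  have hdi : D + 2 ≤ R.dep i := by
    by_contra hh; rw [hdeep i (by omega)] at hci; norm_num at hci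
  have hdj : D + 2 ≤ R.dep j := by
    by_contra hh; rw [hdeep j (by omega)] at hcj; norm_num at hcj
  have hCeq : (fun i => (c i : ℝ)) = (c i : ℝ) • Pi.single i 1 + (c j : ℝ) • Pi.single j 1 := by
    funext x
    simp only [Pi.add_apply, Pi.smul_apply, smul_eq_mul]
    by_cases hxi : x = i
    · subst hxi; simp [hij]
    by_cases hxj : x = j
    · subst hxj; simp [hij.symm]
    rw [h0 x (Finset.mem_univ _) hxi hxj]
    simp [hxi, hxj]
  rw [hCeq]
  exact h.toDeep.cheap_two closed_univ hij (Finset.mem_univ _) (Finset.mem_univ _) hdi hdj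
    (int_sq_one hci) (int_sq_one hcj)

lemma Ctx.no_second_layer (h : Ctx E lam s e k D) {w w' : V}
    (hw : ∀ i, i ≠ R.root → w ≠ E.vtx i) (hw' : ∀ i, i ≠ R.root → w' ≠ E.vtx i)
    {c : N → ℤ} (hc : E.Rep w c) (hdeep : ∀ i, R.dep i ≤ D + 2 → c i = 0)
    (hc2 : ∑ i, c i ^ 2 = 2) (hfar : ∀ i, i ≠ R.root → A (E.vtx i) w' = 0) : A w w' = 0 := by
  by_contra hadj
  have hlo := h.lo
  have hhi := h.hi
  have he0 := h.e_nonneg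
  have hel := h.e_le
  have hlb := h.lb
  have hne : w ≠ w' := by rintro rfl; exact hadj (h.diag w)
  obtain ⟨b, hb, hb2⟩ : ∃ b, A w w' = b ∧ b ^ 2 = 1 :=
    ⟨_, rfl, by rcases h.entry w w' with h1 | h1 | h1 <;> rw [h1] <;>
      [norm_num; exact absurd h1 hadj; norm_num]⟩
  have hb' : A w' w = b := by rw [← hb, h.symm.apply]
  have hch := (h.cheap_of_norm_two hc2 hdeep).smul (2 + e)
  have := E.no_cheap h.symm h.min (e := e) (by linarith [h.gap])
    (X := (2 + e) • Pi.single w 1 - b • Pi.single w' 1)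
    (fun i hi => by simp [Ne.symm (hw i hi), Ne.symm (hw' i hi)]) (by
      simp [dotProduct_sub, hne, hne.symm]
      nlinarith) hch h.dep_one
    (fun i _ hd => by
      have hir : i ≠ R.root := R.ne_root_of_dep (by omega)
      simp only [Pi.smul_apply, smul_eq_mul, Matrix.mulVec_sub, Matrix.mulVec_smul, Pi.sub_apply]
      rw [← mul_sub, hc i hir]
      simp [hfar i hir]; ring)
  have hsum : ∑ i, ((2 + e) • fun i => (c i : ℝ)) i ^ 2 = (2 + e) ^ 2 * 2 := by
    simp only [Pi.smul_apply, smul_eq_mul, mul_pow, ← Finset.mul_sum]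
    congr 1; exact_mod_cast hc2
  rw [hsum] at this
  have hq : qf A ((2 + e) • Pi.single w 1 - b • Pi.single w' 1) = -2 * (2 + e) := by
    simp [qf, Matrix.mulVec_sub, Matrix.mulVec_smul, sub_dotProduct, dotProduct_sub, h.diag, hb,
      hb']
    linear_combination -2 * (2 + e) * hb2
  have hn : ((2 + e) • Pi.single w 1 - b • Pi.single w' 1) ⬝ᵥ
      ((2 + e) • Pi.single w 1 - b • Pi.single w' 1 : V → ℝ) = (2 + e) ^ 2 + 1 := by
    simp [dotProduct_sub, hne, hne.symm]
    linear_combination hb2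
  rw [hq, hn] at this
  have hid : (2 + e) ^ 2 - 2 * (2 + e) - 1 + (2 + e) * (2 - s - s ^ 3) = 0 := by
    have hs := h.pos
    have h1 : (2 + e) * s = 1 + s ^ 2 := by linear_combination h.he
    have h2 : ((2 + e) ^ 2 - 2 * (2 + e) - 1 + (2 + e) * (2 - s - s ^ 3)) * s ^ 2 = 0 := by
      have h3 : (2 + e) ^ 2 * s ^ 2 = (1 + s ^ 2) ^ 2 := by rw [← mul_pow, h1]
      linear_combination h3 + (- s - s ^ 3) * s * h1 - h.eq
    rcases mul_eq_zero.1 h2 with h4 | h4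
    · exact h4
    · exact absurd h4 (by positivity)
  have hid2 := congrArg (fun x => (2 + e) * x) hid
  simp only [mul_zero] at hid2
  have hgap := h.gap
  have h7 : (2 + e) ^ 2 * 4 ≤ 17 := by nlinarith
  have h8 : (2 + e) ^ 2 * 4 * (k - (1 - s)) ≤ 17 * (k - (1 - s)) :=
    mul_le_mul_of_nonneg_right h7 (by linarith)
  linarith

lemma Ctx.cross_consistent (h : Ctx E lam s e k D) {w g : V} (hwg : w ≠ g)
    (hw : ∀ i, i ≠ R.root → w ≠ E.vtx i) (hg : ∀ i, i ≠ R.root → g ≠ E.vtx i)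
    {c d : N → ℤ} (hc : E.Rep w c) (hd : E.Rep g d)
    (hcd : ∀ i, R.dep i ≤ D + 2 → c i = 0) (hdd : ∀ i, R.dep i ≤ D + 2 → d i = 0)
    (hc2 : ∑ i, c i ^ 2 = 2) (hd2 : ∑ i, d i ^ 2 = 2) :
    A w g = ((∑ i, c i * d i : ℤ) : ℝ) := by
  by_contra hne
  have hlo := h.lo
  have hhi := h.hi
  have he0 := h.e_nonneg
  have hel := h.e_le
  have hlb := h.lb
  have hub := h.ub
  have hk := h.toDeep.k_nonneg
  obtain ⟨m, hm⟩ : ∃ m : ℤ, A w g = m := by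
    rcases h.entry w g with h1 | h1 | h1
    · exact ⟨-1, by simp [h1]⟩
    · exact ⟨0, by simp [h1]⟩
    · exact ⟨1, by simp [h1]⟩
  set p : ℤ := ∑ i, c i * d i with hp
  rw [hm] at hne
  have hmp : m - p ≠ 0 := fun hh => hne (by rw [sub_eq_zero.1 hh])
  -- the sign making the defect count
  obtain ⟨t, ht, hδ⟩ : ∃ t : ℤ, t ^ 2 = 1 ∧ t * (m - p) = -|m - p| := by
    rcases le_total 0 (m - p) with h1 | h1
    · exact ⟨-1, by norm_num, by rw [abs_of_nonneg h1]; ring⟩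
    · exact ⟨1, by norm_num, by rw [abs_of_nonpos h1]; ring⟩
  have htr : (t : ℝ) ^ 2 = 1 := by exact_mod_cast ht
  set C : N → ℤ := fun i => c i + t * d i with hC
  have hno : ∀ cost, R.Cheap e Finset.univ (fun i => (C i : ℝ)) cost →
      2 * (|m - p| : ℝ) < cost + 2 * e := by
    intro cost hcost
    have := E.no_cheap h.symm h.min (e := e) (by linarith [h.gap])
      (X := Pi.single w 1 + (t : ℝ) • Pi.single g 1)
      (fun i hi => by simp [Ne.symm (hw i hi), Ne.symm (hg i hi)]) (by
        simp [dotProduct_add, hwg, hwg.symm]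
        nlinarith) hcost h.dep_one
      (fun i _ hi => by
        have hir : i ≠ R.root := R.ne_root_of_dep (by omega)
        have h1 := hc i hir
        have h2 := hd i hir
        simp [hC, Matrix.mulVec_add, Matrix.mulVec_smul]
        linear_combination h1 + t * h2)
    have hg' : A g w = m := by rw [← hm, h.symm.apply]
    have hq : qf A (Pi.single w 1 + (t : ℝ) • Pi.single g 1) = 2 * t * m := by
      simp [qf, Matrix.mulVec_add, Matrix.mulVec_smul, dotProduct_add, h.diag, hm, hg']
      ring
    have hn : (Pi.single w 1 + (t : ℝ) • Pi.single g 1) ⬝ᵥ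
        (Pi.single w 1 + (t : ℝ) • Pi.single g 1 : V → ℝ) = 2 := by
      simp [dotProduct_add, hwg, hwg.symm]
      linear_combination htr
    have hs : ∑ i, (C i : ℝ) ^ 2 = 4 + 2 * t * p := by
      have hz : ∑ i, C i ^ 2 = 4 + 2 * t * p := by
        have : ∀ i, C i ^ 2 = c i ^ 2 + 2 * t * (c i * d i) + d i ^ 2 := fun i => by
          rw [hC]; linear_combination d i ^ 2 * ht
        rw [Finset.sum_congr rfl fun i _ => this i, Finset.sum_add_distrib,
          Finset.sum_add_distrib, ← Finset.mul_sum, hc2, hd2]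
        ring
      exact_mod_cast hz
    rw [hq, hn, hs] at this
    have hδr : (t : ℝ) * (m - p) = -|(m : ℝ) - p| := by exact_mod_cast hδ
    linarith [h.gap]
  have hδ1 : 1 ≤ |m - p| := Int.one_le_abs hmp
  have hsupp : ∀ u, (C u : ℝ) ≠ 0 → u ∈ Finset.univ ∧ D + 1 ≤ R.dep u := by
    intro u hu
    refine ⟨Finset.mem_univ _, ?_⟩
    by_contra hh
    exact hu (by simp [hC, hcd u (by omega), hdd u (by omega)])
  have hgen := hno _ (h.toDeep.cheap_general closed_univ hsupp)
  have hl1 : ∑ i, |(C i : ℝ)| ≤ 4 := by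
    have h1 := sum_abs_le_sum_sq c Finset.univ
    have h2 := sum_abs_le_sum_sq d Finset.univ
    have h3 : ∑ i, |C i| ≤ ∑ i, |c i| + ∑ i, |d i| := by
      rw [← Finset.sum_add_distrib]
      refine Finset.sum_le_sum fun i _ => (abs_add_le _ _).trans ?_
      have : |t| = 1 := by
        rcases mul_self_eq_one_iff.1 ((pow_two t).symm.trans ht) with h | h <;> simp [h]
      rw [abs_mul, this, one_mul]
    exact_mod_cast (by omega : ∑ i, |C i| ≤ 4)
  have hl0 : 0 ≤ ∑ i, |(C i : ℝ)| := Finset.sum_nonneg fun _ _ => abs_nonneg _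
  have hl2 : (∑ i, |(C i : ℝ)|) ^ 2 ≤ 16 := by nlinarith
  have hsum : ∑ i, C i ^ 2 + ∑ i, (c i - t * d i) ^ 2 = 8 := by
    rw [← Finset.sum_add_distrib]
    have : ∀ i, C i ^ 2 + (c i - t * d i) ^ 2 = 2 * c i ^ 2 + 2 * d i ^ 2 := fun i => by
      rw [hC]; linear_combination 2 * d i ^ 2 * ht
    rw [Finset.sum_congr rfl fun i _ => this i, Finset.sum_add_distrib, ← Finset.mul_sum,
      ← Finset.mul_sum, hc2, hd2]
    norm_num
  have hdiff : 0 ≤ ∑ i, (c i - t * d i) ^ 2 := Finset.sum_nonneg fun _ _ => sq_nonneg _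
  by_cases htwin : ∑ i, (c i - t * d i) ^ 2 = 0
  · rw [Finset.sum_eq_zero_iff_of_nonneg fun _ _ => sq_nonneg _] at htwin
    have heq : (fun i => (C i : ℝ)) = (2 : ℝ) • fun i => (c i : ℝ) := by
      funext i
      have h1 : c i - t * d i = 0 := by simpa using htwin i (Finset.mem_univ _)
      have h2 : C i = 2 * c i := by rw [hC]; linarith
      simp [h2]
    have hch := (h.cheap_of_norm_two hc2 hcd).smul 2
    rw [← heq] at hch
    have h3 := hno _ hch
    have h4 : (1 : ℝ) ≤ |(m : ℝ) - p| := by exact_mod_cast hδ1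
    have hs2 : 0.7548 ≤ s ^ 2 := by nlinarith
    have hs3 : 0.6558 ≤ s ^ 3 := by nlinarith
    nlinarith
  · have h6 : ∑ i, C i ^ 2 ≤ 6 := by
      have hpar : ∑ i, C i ^ 2 = 4 + 2 * (t * p) := by
        have : ∀ i, C i ^ 2 = c i ^ 2 + 2 * t * (c i * d i) + d i ^ 2 := fun i => by
          rw [hC]; linear_combination d i ^ 2 * ht
        rw [Finset.sum_congr rfl fun i _ => this i, Finset.sum_add_distrib,
          Finset.sum_add_distrib, ← Finset.mul_sum, hc2, hd2]
        ring
      omega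
    have h6r : ∑ i, (C i : ℝ) ^ 2 ≤ 6 := by exact_mod_cast h6
    have h4 : (1 : ℝ) ≤ |(m : ℝ) - p| := by exact_mod_cast hδ1
    have h7 : (1 - s) * ∑ i, (C i : ℝ) ^ 2 + s * (∑ i, |(C i : ℝ)|) ^ 2 ≤ 14.6885 := by
      nlinarith
    nlinarith

end RTree

/-- The real matrix of an integer valued one. -/
def realMat {V : Type*} (Z : V → V → ℤ) : Matrix V V ℝ := Matrix.of fun u v => (Z u v : ℝ)

/-- The inner product of `e_a - e_b` and `e_c - e_d`. -/
def edgeIp (a b c d : ℕ) : ℤ :=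
  (if a = c then 1 else 0) - (if a = d then 1 else 0) - (if b = c then 1 else 0) +
    (if b = d then 1 else 0)

/-- A tree with nodes `0, …, m`, containing the path `0, …, L`, whose edges `1, …, m` (the
edge `i` joins `i` to its parent) are realised by vertices of the signed graph `Z`. -/
structure TR {V : Type*} (Z : V → V → ℤ) (L m : ℕ) where
  vtx : ℕ → V
  par : ℕ → ℕ
  sg : ℕ → ℤ
  pos : ℕ → ℕ
  ht : ℕ → ℕ
  le : L ≤ m
  inj : ∀ i j, 1 ≤ i → i ≤ m → 1 ≤ j → j ≤ m → vtx i = vtx j → i = j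
  par_lt : ∀ i, 1 ≤ i → i ≤ m → par i < i
  par_main : ∀ i, 1 ≤ i → i ≤ L → par i = i - 1
  pos_main : ∀ i, i ≤ L → pos i = i
  ht_main : ∀ i, i ≤ L → ht i = 0
  pos_branch : ∀ i, L < i → i ≤ m → pos i = pos (par i)
  ht_branch : ∀ i, L < i → i ≤ m → ht i = ht (par i) + 1
  sg_sq : ∀ i, sg i * sg i = 1
  gram : ∀ i j, 1 ≤ i → i ≤ m → 1 ≤ j → j ≤ m →
    Z (vtx i) (vtx j) + (if i = j then 2 else 0) = sg i * sg j * edgeIp i (par i) j (par j)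

namespace TR
variable {V : Type*} {Z : V → V → ℤ} {L m : ℕ} (T : TR Z L m)

/-- The rerooted parent map. -/
def rpar (r : ℕ) (i : ℕ) : ℕ := if i < r then i + 1 else T.par i

/-- The edge joining a node to its rerooted parent. -/
def redge (r : ℕ) (i : ℕ) : ℕ := if i < r then i + 1 else i

/-- The tree rerooted at the node `r` of its main path. -/
def rooted {r : ℕ} (hr0 : 0 < r) (hr : r < L) : RTree (Fin (m + 1)) where
  root := ⟨r, by have := T.le; omega⟩
  par := fun i => ⟨T.rpar r i, by
    have := T.le
    have := i.2
    unfold rpar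
    split_ifs with h
    · omega
    · have := T.par_lt i (by omega) (by omega); omega⟩
  dep := fun i => T.ht i + (T.pos i - r) + (r - T.pos i)
  dep_root := by
    simp [T.ht_main r hr.le, T.pos_main r hr.le]
  dep_par := by
    intro i hi
    have hir : (i : ℕ) ≠ r := fun h => hi (Fin.ext h)
    have hle := T.le
    have hi2 := i.2
    unfold rpar
    simp only
    split_ifs with h
    · rw [T.ht_main i (by omega), T.ht_main (i + 1) (by omega), T.pos_main i (by omega),
        T.pos_main (i + 1) (by omega)]
      omega
    · by_cases hL : (i : ℕ) ≤ L
      · rw [T.par_main i (by omega) hL, T.ht_main i hL, T.ht_main (i - 1) (by omega),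
          T.pos_main i hL, T.pos_main (i - 1) (by omega)]
        omega
      · rw [T.pos_branch i (by omega) (by omega), T.ht_branch i (by omega) (by omega)]
        omega

lemma redge_mem (T : TR Z L m) {r : ℕ} (hr0 : 0 < r) (hr : r < L) (i : Fin (m + 1)) :
    1 ≤ redge r i ∧ redge r i ≤ m := by
  have := T.le
  have := i.2
  unfold redge
  split_ifs <;> omega

lemma edgeIp_eq_sum {n : ℕ} (a b c d : Fin n) :
    (edgeIp a b c d : ℝ) = ∑ k : Fin n, ((if a = k then 1 else 0) - (if b = k then 1 else 0)) *
      ((if c = k then 1 else 0) - (if d = k then (1 : ℝ) else 0)) := by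
  simp only [sub_mul, mul_sub, Finset.sum_sub_distrib, ite_mul, one_mul, zero_mul,
    Finset.sum_ite_eq, Finset.mem_univ, if_true]
  unfold edgeIp
  push_cast
  simp only [Fin.val_inj, eq_comm (a := c), eq_comm (a := d)]
  ring

variable [Fintype V] [DecidableEq V]

/-- The realisation of the rerooted tree. -/
def emb {r : ℕ} (hr0 : 0 < r) (hr : r < L) : (T.rooted hr0 hr).Emb (realMat Z) where
  vtx := fun i => T.vtx (redge r i)
  sg := fun i => if (i : ℕ) < r then -(T.sg (i + 1) : ℝ) else T.sg i
  inj := by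
    intro i j hi hj h
    have hi' : (i : ℕ) ≠ r := fun h => hi (Fin.ext h)
    have hj' : (j : ℕ) ≠ r := fun h => hj (Fin.ext h)
    have h1 := T.redge_mem hr0 hr i
    have h2 := T.redge_mem hr0 hr j
    have := T.inj _ _ h1.1 h1.2 h2.1 h2.2 h
    apply Fin.ext
    unfold redge at this
    split_ifs at this <;> omega
  sq := by
    intro i
    have h1 : ∀ i, (T.sg i : ℝ) * T.sg i = 1 := fun i => by exact_mod_cast T.sg_sq i
    split_ifs
    · rw [neg_mul_neg, h1]
    · exact h1 _
  gram := by
    intro i j hi hj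
    have hi' : (i : ℕ) ≠ r := fun h => hi (Fin.ext h)
    have hj' : (j : ℕ) ≠ r := fun h => hj (Fin.ext h)
    have h1 := T.redge_mem hr0 hr i
    have h2 := T.redge_mem hr0 hr j
    have hg := T.gram _ _ h1.1 h1.2 h2.1 h2.2
    have hij : redge r i = redge r j ↔ i = j := by
      constructor
      · intro h
        apply Fin.ext
        unfold redge at h
        split_ifs at h <;> omega
      · rintro rfl; rfl
    simp only [hij] at hg
    have hs : ∑ k, (T.rooted hr0 hr).row i k * (T.rooted hr0 hr).row j k =
        (edgeIp i (T.rpar r i) j (T.rpar r j) : ℝ) := by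
      rw [show T.rpar r i = ((T.rooted hr0 hr).par i : ℕ) from rfl,
        show T.rpar r j = ((T.rooted hr0 hr).par j : ℕ) from rfl, edgeIp_eq_sum]
      rfl
    rw [hs]
    have hg' : (Z (T.vtx (redge r i)) (T.vtx (redge r j)) : ℝ) + (if i = j then 2 else 0) =
        T.sg (redge r i) * T.sg (redge r j) *
          edgeIp (redge r i) (T.par (redge r i)) (redge r j) (T.par (redge r j)) := by
      exact_mod_cast hg
    change (Z (T.vtx (redge r i)) (T.vtx (redge r j)) : ℝ) + (if i = j then 2 else 0) = _
    rw [hg']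
    have hm := T.le
    unfold redge rpar
    by_cases hir : (i : ℕ) < r <;> by_cases hjr : (j : ℕ) < r <;>
      simp only [hir, hjr, if_true, if_false]
    · rw [T.par_main (i + 1) (by omega) (by omega), T.par_main (j + 1) (by omega) (by omega)]
      simp only [Nat.add_sub_cancel, edgeIp]
      push_cast
      ring
    · rw [T.par_main (i + 1) (by omega) (by omega)]
      simp only [Nat.add_sub_cancel, edgeIp]
      push_cast
      ring
    · rw [T.par_main (j + 1) (by omega) (by omega)]
      simp only [Nat.add_sub_cancel, edgeIp]
      push_cast
      ring

/-- An integer potential on the nodes describing the adjacencies of `w` to the tree. -/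
def Rep (w : V) (c : ℕ → ℤ) : Prop :=
  ∀ j, 1 ≤ j → j ≤ m → c j - c (T.par j) = T.sg j * Z (T.vtx j) w

lemma Rep.emb_rep {T : TR Z L m} {w : V} {c : ℕ → ℤ} (hc : T.Rep w c) {r : ℕ} (hr0 : 0 < r)
    (hr : r < L) : (T.emb hr0 hr).Rep w fun i => c i := by
  intro i hi
  have hi' : (i : ℕ) ≠ r := fun h => hi (Fin.ext h)
  have h1 := T.redge_mem hr0 hr i
  have hm := T.le
  change (c i : ℝ) - c (T.rpar r i) = (if (i : ℕ) < r then -(T.sg (i + 1) : ℝ) else T.sg i) *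
    (Z (T.vtx (redge r i)) w : ℝ)
  unfold redge at h1
  unfold redge rpar
  split_ifs with h
  · have := hc (i + 1) (by omega) (by omega)
    rw [T.par_main (i + 1) (by omega) (by omega), Nat.add_sub_cancel] at this
    have h2 : (c (i + 1) : ℝ) - c i = T.sg (i + 1) * Z (T.vtx (i + 1)) w := by exact_mod_cast this
    linarith
  · rw [if_neg h] at h1
    exact_mod_cast hc i h1.1 h1.2

lemma exists_rep (w : V) : ∃ c, T.Rep w c := by
  have key : ∀ n ≤ m, ∃ c : ℕ → ℤ, ∀ j, 1 ≤ j → j ≤ n →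
      c j - c (T.par j) = T.sg j * Z (T.vtx j) w := by
    intro n hn
    induction n with
    | zero => exact ⟨0, fun j h1 h2 => by omega⟩
    | succ n ih =>
      obtain ⟨c, hc⟩ := ih (by omega)
      refine ⟨Function.update c (n + 1) (c (T.par (n + 1)) +
        T.sg (n + 1) * Z (T.vtx (n + 1)) w), fun j h1 h2 => ?_⟩
      have hp := T.par_lt j h1 (by omega)
      rw [Function.update_of_ne (a := T.par j) (by omega)]
      by_cases hj : j = n + 1
      · subst hj; simp
      · rw [Function.update_of_ne hj]; exact hc j h1 (by omega)
  exact key m le_rfl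

lemma Rep.add_const {T : TR Z L m} {w : V} {c : ℕ → ℤ} (hc : T.Rep w c) (a : ℤ) :
    T.Rep w fun i => c i + a := fun j h1 h2 => by
  have := hc j h1 h2
  simp only
  linarith

/-- The potential vanishes around the root if no neighbouring edge is close. -/
lemma Rep.eq_zero_of_near {T : TR Z L m} {w : V} {c : ℕ → ℤ} (hc : T.Rep w c) {r D : ℕ}
    (hr0 : 0 < r) (hr : r < L) (h0 : c r = 0)
    (hfar : ∀ j, 1 ≤ j → j ≤ m → Z (T.vtx j) w ≠ 0 → T.pos j + D < r ∨ r + D < T.pos j)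
    (i : Fin (m + 1)) (hi : (T.rooted hr0 hr).dep i ≤ D) : c i = 0 := by
  have hm := T.le
  induction hn : (T.rooted hr0 hr).dep i generalizing i with
  | zero =>
    by_cases hir : i = (T.rooted hr0 hr).root
    · rw [hir]; exact h0
    · have := (T.rooted hr0 hr).dep_par i hir
      omega
  | succ n ih =>
    have hir : i ≠ (T.rooted hr0 hr).root := by
      rintro rfl; rw [RTree.dep_root] at hn; omega
    have hdp := (T.rooted hr0 hr).dep_par i hir
    have h1 := ih ((T.rooted hr0 hr).par i) (by omega) (by omega)
    have h2 := hc.emb_rep hr0 hr i hir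
    have hi' : (i : ℕ) ≠ r := fun h => hir (Fin.ext h)
    have h3 := T.redge_mem hr0 hr i
    have hz : Z (T.vtx (redge r i)) w = 0 := by
      by_contra hne
      have h4 := hfar _ h3.1 h3.2 hne
      have hdep : (T.rooted hr0 hr).dep i = T.ht i + (T.pos i - r) + (r - T.pos i) := rfl
      unfold redge at h4
      split_ifs at h4 with h5
      · rw [T.pos_main (i + 1) (by omega)] at h4
        rw [T.pos_main i (by omega)] at hdep
        omega
      · omega
    have h5 : ((c i : ℝ)) - c ((T.rooted hr0 hr).par i) = 0 := by
      have : (realMat Z) ((T.emb hr0 hr).vtx i) w = ((Z (T.vtx (redge r i)) w : ℤ) : ℝ) := rfl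
      rw [h2, this, hz]; simp
    have h6 : c i - c ((T.rooted hr0 hr).par i) = 0 := by exact_mod_cast h5
    linarith

end TR

/-- A signed graph of bounded degree all of whose proper restrictions are good, close to the
critical value. -/
structure Near {V : Type*} [Fintype V] [DecidableEq V] (Z : V → V → ℤ) (lam s e k : ℝ)
    (D d : ℕ) : Prop extends RTree.Crit s e where
  lb : 1 - s ≤ k
  ub : k ≤ 0.1312
  one_lt : 2 ≤ D
  chain_le : ∀ t, D ≤ t → (1 - s) + s * (s ^ 2) ^ (t - 1) ≤ k
  symm : ∀ u v, Z u v = Z v u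
  diag : ∀ v, Z v v = 0
  entry : ∀ u v, Z u v = -1 ∨ Z u v = 0 ∨ Z u v = 1
  min : ∀ x v, x v = 0 → 0 ≤ qf (realMat Z) x + lam * (x ⬝ᵥ x)
  gap : 17 * (k - (1 - s)) < 2 + e - lam
  deg : ∀ v, (Finset.univ.filter fun u => Z u v ≠ 0).card ≤ d

namespace TR
variable {V : Type*} [Fintype V] [DecidableEq V] {Z : V → V → ℤ} {L m D d : ℕ}
  {lam s e k : ℝ} (T : TR Z L m)

lemma ctx (h : Near Z lam s e k D d) {r : ℕ} (hr0 : 0 < r) (hr : r < L) :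
    RTree.Ctx (T.emb hr0 hr) lam s e k D where
  toCrit := h.toCrit
  lb := h.lb
  ub := h.ub
  one_lt := h.one_lt
  self_le := fun u hu => by
    rw [RTree.ip_chain_self_eq _ h.he]; exact h.chain_le _ hu
  symm := by ext u v; simp [realMat, h.symm u v]
  diag := fun v => by simp [realMat, h.diag v]
  entry := fun u v => by
    rcases h.entry u v with h | h | h <;> simp [realMat, h]
  min := h.min
  gap := h.gap
  dep_one := by
    have := T.le
    refine ⟨⟨r + 1, by omega⟩, ?_⟩
    change T.ht (r + 1) + (T.pos (r + 1) - r) + (r - T.pos (r + 1)) = 1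
    rw [T.ht_main _ (by omega), T.pos_main _ (by omega)]
    omega

/-- `w` is not one of the vertices realising the edges of the tree. -/
def Off (w : V) : Prop := ∀ j, 1 ≤ j → j ≤ m → w ≠ T.vtx j

lemma Off.emb {T : TR Z L m} {w : V} (hw : T.Off w) {r : ℕ} (hr0 : 0 < r) (hr : r < L) :
    ∀ i, i ≠ (T.rooted hr0 hr).root → w ≠ (T.emb hr0 hr).vtx i := fun i _ =>
  hw _ (T.redge_mem hr0 hr i).1 (T.redge_mem hr0 hr i).2

/-- The vertex `w` has no neighbour among the tree edges close to the node `r`. -/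
def Far (D r : ℕ) (w : V) : Prop :=
  ∀ j, 1 ≤ j → j ≤ m → Z (T.vtx j) w ≠ 0 → T.pos j + D < r ∨ r + D < T.pos j

lemma exists_far (hd : ∀ v, (Finset.univ.filter fun u => Z u v ≠ 0).card ≤ d) (D : ℕ)
    (hL : (2 * d + 1) * (2 * D + 1) < L) (w g : V) :
    ∃ r, 0 < r ∧ r < L ∧ T.Far D r w ∧ T.Far D r g := by
  classical
  by_contra hcon
  push Not at hcon
  set J := (Finset.Icc 1 m).filter fun j => Z (T.vtx j) w ≠ 0 ∨ Z (T.vtx j) g ≠ 0 with hJ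
  have hJc : J.card ≤ 2 * d := by
    have h1 : J.card ≤ ((Finset.univ.filter fun u => Z u w ≠ 0) ∪
        (Finset.univ.filter fun u => Z u g ≠ 0)).card := by
      refine Finset.card_le_card_of_injOn T.vtx (fun j hj => ?_) (fun i hi j hj hij => ?_)
      · simpa [hJ] using (Finset.mem_filter.1 hj).2
      · have hi' := Finset.mem_Icc.1 (Finset.mem_filter.1 hi).1
        have hj' := Finset.mem_Icc.1 (Finset.mem_filter.1 hj).1
        exact T.inj i j hi'.1 hi'.2 hj'.1 hj'.2 hij
    have h2 := Finset.card_union_le (Finset.univ.filter fun u => Z u w ≠ 0)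
        (Finset.univ.filter fun u => Z u g ≠ 0)
    have := hd w
    have := hd g
    omega
  have key : ∀ t, t ∈ Finset.range (2 * d + 1) → ∃ j ∈ J,
      (t + 1) * (2 * D + 1) ≤ T.pos j + D ∧ T.pos j ≤ (t + 1) * (2 * D + 1) + D := by
    intro t ht
    rw [Finset.mem_range] at ht
    have h1 : (t + 1) * (2 * D + 1) ≤ (2 * d + 1) * (2 * D + 1) :=
      Nat.mul_le_mul_right _ (by omega)
    have h3 := hcon ((t + 1) * (2 * D + 1)) (by positivity) (by omega)
    by_cases hw : T.Far D ((t + 1) * (2 * D + 1)) w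
    · have h4 := h3 hw
      unfold Far at h4
      push Not at h4
      obtain ⟨j, hj1, hj2, hj3, hj4, hj5⟩ := h4
      exact ⟨j, by simp [hJ, hj1, hj2, hj3], hj4, hj5⟩
    · unfold Far at hw
      push Not at hw
      obtain ⟨j, hj1, hj2, hj3, hj4, hj5⟩ := hw
      exact ⟨j, by simp [hJ, hj1, hj2, hj3], hj4, hj5⟩
  choose! f hfJ hf1 hf2 using key
  have h5 : (Finset.range (2 * d + 1)).card ≤ J.card := by
    refine Finset.card_le_card_of_injOn f (fun t ht => hfJ t ht) (fun t ht u hu htu => ?_)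
    have a1 := hf1 t ht
    have a2 := hf2 t ht
    have b1 := hf1 u hu
    have b2 := hf2 u hu
    rw [htu] at a1 a2
    rcases lt_trichotomy t u with h | h | h
    · have : (t + 1 + 1) * (2 * D + 1) ≤ (u + 1) * (2 * D + 1) :=
        Nat.mul_le_mul_right _ (by omega)
      rw [add_mul (t + 1)] at this
      omega
    · exact h
    · have : (u + 1 + 1) * (2 * D + 1) ≤ (t + 1) * (2 * D + 1) :=
        Nat.mul_le_mul_right _ (by omega)
      rw [add_mul (u + 1)] at this
      omega
  rw [Finset.card_range] at h5
  omega

/-- A potential of small norm vanishes around the nodes far from the neighbours. -/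
lemma Rep.eq_zero_of_far {T : TR Z L m} {w : V} {c : ℕ → ℤ} (hc : T.Rep w c)
    (hs : ∑ i : Fin (m + 1), c i ^ 2 ≤ 2) {r D : ℕ} (hD : 1 ≤ D) (hr0 : 0 < r) (hr : r < L)
    (hfar : T.Far D r w) (i : Fin (m + 1)) (hi : (T.rooted hr0 hr).dep i ≤ D) : c i = 0 := by
  have hm := T.le
  have h1 := (hc.add_const (-c r)).eq_zero_of_near hr0 hr (by ring) hfar
  have hdep : ∀ i : Fin (m + 1), (T.rooted hr0 hr).dep i =
    T.ht i + (T.pos i - r) + (r - T.pos i) := fun _ => rfl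
  have h2 := h1 ⟨r - 1, by omega⟩ (by
    rw [hdep]; simp only; rw [T.ht_main _ (by omega), T.pos_main _ (by omega)]; omega)
  have h3 := h1 ⟨r + 1, by omega⟩ (by
    rw [hdep]; simp only; rw [T.ht_main _ (by omega), T.pos_main _ (by omega)]; omega)
  simp only at h2 h3
  have h4 : c r = 0 := by
    by_contra hne
    have h5 : ∑ j ∈ {⟨r - 1, by omega⟩, ⟨r, by omega⟩, (⟨r + 1, by omega⟩ : Fin (m + 1))},
        c j ^ 2 ≤ ∑ i : Fin (m + 1), c i ^ 2 :=
      Finset.sum_le_sum_of_subset_of_nonneg (Finset.subset_univ _) fun _ _ _ => sq_nonneg _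
    rw [Finset.sum_insert (by simp; omega), Finset.sum_insert (by simp),
      Finset.sum_singleton] at h5
    simp only at h5
    have h6 : c (r - 1) = c r := by linarith
    have h7 : c (r + 1) = c r := by linarith
    rw [h6, h7] at h5
    have : 0 < c r ^ 2 := by positivity
    omega
  have := h1 i hi
  simp only [h4] at this
  simpa using this

lemma exists_rep_le (h : Near Z lam s e k D d) (hL : (2 * d + 1) * (2 * (D + 2) + 1) < L)
    {w : V} (hw : T.Off w) : ∃ c, T.Rep w c ∧ ∑ i : Fin (m + 1), c i ^ 2 ≤ 2 := by
  obtain ⟨r, hr0, hr, hfar, -⟩ := T.exists_far h.deg (D + 2) hL w w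
  obtain ⟨c, hc⟩ := T.exists_rep w
  have hc' := hc.add_const (-c r)
  refine ⟨_, hc', ?_⟩
  exact (T.ctx h hr0 hr).rep_sum_sq_le (hw.emb hr0 hr) (hc'.emb_rep hr0 hr)
    (hc'.eq_zero_of_near hr0 hr (by ring) hfar)

lemma extend {w : V} (hw : T.Off w) (hsymm : ∀ u v, Z u v = Z v u) (hdiag : Z w w = 0)
    {c : ℕ → ℤ} (hc : T.Rep w c) {σ : ℤ} (hσ : σ * σ = 1) {k : ℕ} (hk : k ≤ m)
    (hck : ∀ i ≤ m, c i = if i = k then σ else 0) : Nonempty (TR Z L (m + 1)) := by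
  have hL := T.le
  have hnew : ∀ i, 1 ≤ i → i ≤ m →
      Z (T.vtx i) w = T.sg i * -σ * edgeIp i (T.par i) (m + 1) k := by
    intro i h1 h2
    have h3 := hc i h1 h2
    have h4 := T.par_lt i h1 h2
    rw [hck i h2, hck _ (by omega)] at h3
    have h5 := T.sg_sq i
    have h6 : Z (T.vtx i) w = T.sg i * ((if i = k then σ else 0) -
        if T.par i = k then σ else 0) := by
      rw [h3]; linear_combination (-Z (T.vtx i) w) * h5
    rw [h6]
    unfold edgeIp
    rw [if_neg (show i ≠ m + 1 by omega), if_neg (show T.par i ≠ m + 1 by omega)]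
    split_ifs <;> ring
  refine ⟨⟨Function.update T.vtx (m + 1) w, Function.update T.par (m + 1) k,
    Function.update T.sg (m + 1) (-σ), Function.update T.pos (m + 1) (T.pos k),
    Function.update T.ht (m + 1) (T.ht k + 1), by omega, ?_, ?_, ?_, ?_, ?_, ?_, ?_, ?_, ?_⟩⟩
  · intro i j hi1 hi2 hj1 hj2 hij
    by_cases hi : i = m + 1 <;> by_cases hj : j = m + 1
    · omega
    · subst hi
      rw [Function.update_self, Function.update_of_ne hj] at hij
      exact absurd hij (hw j hj1 (by omega))
    · subst hj
      rw [Function.update_self, Function.update_of_ne hi] at hij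
      exact absurd hij.symm (hw i hi1 (by omega))
    · rw [Function.update_of_ne hi, Function.update_of_ne hj] at hij
      exact T.inj i j hi1 (by omega) hj1 (by omega) hij
  · intro i hi1 hi2
    by_cases hi : i = m + 1
    · subst hi; rw [Function.update_self]; omega
    · rw [Function.update_of_ne hi]; exact T.par_lt i hi1 (by omega)
  · intro i hi1 hi2
    rw [Function.update_of_ne (by omega)]; exact T.par_main i hi1 hi2
  · intro i hi2
    rw [Function.update_of_ne (by omega)]; exact T.pos_main i hi2
  · intro i hi2
    rw [Function.update_of_ne (by omega)]; exact T.ht_main i hi2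
  · intro i hi1 hi2
    by_cases hi : i = m + 1
    · subst hi; simp only [Function.update_self]
      rw [Function.update_of_ne (by omega)]
    · have := T.par_lt i (by omega) (by omega)
      simp only [Function.update_of_ne hi]
      rw [Function.update_of_ne (by omega)]
      exact T.pos_branch i hi1 (by omega)
  · intro i hi1 hi2
    by_cases hi : i = m + 1
    · subst hi; simp only [Function.update_self]
      rw [Function.update_of_ne (by omega)]
    · have := T.par_lt i (by omega) (by omega)
      simp only [Function.update_of_ne hi]
      rw [Function.update_of_ne (by omega)]
      exact T.ht_branch i hi1 (by omega)
  · intro i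
    by_cases hi : i = m + 1
    · subst hi; rw [Function.update_self, neg_mul_neg, hσ]
    · rw [Function.update_of_ne hi]; exact T.sg_sq i
  · intro i j hi1 hi2 hj1 hj2
    by_cases hi : i = m + 1 <;> by_cases hj : j = m + 1
    · subst hi; subst hj
      simp only [Function.update_self, hdiag, neg_mul_neg, hσ, if_true, edgeIp]
      rw [if_neg (show m + 1 ≠ k by omega), if_neg (show k ≠ m + 1 by omega)]
      norm_num
    · subst hi
      simp only [Function.update_self, Function.update_of_ne hj]
      rw [if_neg (by omega), hsymm, hnew j hj1 (by omega)]
      unfold edgeIp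
      simp only [eq_comm (a := j), eq_comm (a := T.par j)]
      ring
    · subst hj
      simp only [Function.update_self, Function.update_of_ne hi]
      rw [if_neg (by omega), hnew i hi1 (by omega)]
      ring
    · simp only [Function.update_of_ne hi, Function.update_of_ne hj]
      exact T.gram i j hi1 (by omega) hj1 (by omega)

/-- The vertex `w` extends the lattice of the tree by a vector of norm two. -/
def Two (w : V) : Prop := T.Off w ∧ ∃ c, T.Rep w c ∧ ∑ i : Fin (m + 1), c i ^ 2 = 2

lemma two_of_adj (h : Near Z lam s e k D d) (hmax : IsEmpty (TR Z L (m + 1)))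
    (hL : (2 * d + 1) * (2 * (D + 2) + 1) < L) {u v : V} (hu : ¬ T.Off u ∨ T.Two u)
    (huv : Z u v ≠ 0) (hv : T.Off v) : T.Two v := by
  obtain ⟨c, hc, hc2⟩ := T.exists_rep_le h hL hv
  refine ⟨hv, c, hc, ?_⟩
  have h0 : 0 ≤ ∑ i : Fin (m + 1), c i ^ 2 := Finset.sum_nonneg fun _ _ => sq_nonneg _
  obtain h1 | h1 | h1 : ∑ i : Fin (m + 1), c i ^ 2 = 0 ∨ ∑ i : Fin (m + 1), c i ^ 2 = 1 ∨
    ∑ i : Fin (m + 1), c i ^ 2 = 2 := by omega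
  · exfalso
    rw [Finset.sum_eq_zero_iff_of_nonneg fun _ _ => sq_nonneg _] at h1
    have h2 : ∀ i ≤ m, c i = 0 := fun i hi => by
      simpa using h1 ⟨i, by omega⟩ (Finset.mem_univ _)
    have h3 : ∀ j, 1 ≤ j → j ≤ m → Z (T.vtx j) v = 0 := by
      intro j hj1 hj2
      have h4 := hc j hj1 hj2
      have h5 := T.par_lt j hj1 hj2
      rw [h2 j hj2, h2 _ (by omega)] at h4
      have h6 := T.sg_sq j
      calc Z (T.vtx j) v = T.sg j * (T.sg j * Z (T.vtx j) v) := by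
            linear_combination (-Z (T.vtx j) v) * h6
        _ = 0 := by rw [← h4]; ring
    rcases hu with hu | ⟨hu, c', hc', hcs⟩
    · unfold Off at hu
      push Not at hu
      obtain ⟨j, hj1, hj2, rfl⟩ := hu
      exact huv (h3 j hj1 hj2)
    · obtain ⟨r, hr0, hr, hfar, -⟩ := T.exists_far h.deg (D + 2) hL u u
      have h7 := (T.ctx h hr0 hr).no_second_layer (hu.emb hr0 hr) (hv.emb hr0 hr)
        (hc'.emb_rep hr0 hr) (hc'.eq_zero_of_far hcs.le (by omega) hr0 hr hfar) hcs
        (fun i _ => by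
          have := h3 _ (T.redge_mem hr0 hr i).1 (T.redge_mem hr0 hr i).2
          change ((Z (T.vtx (redge r i)) v : ℤ) : ℝ) = 0
          rw [this]; simp)
      exact huv (by simpa [realMat] using h7)
  · exfalso
    obtain ⟨i, -, hi1, hi0⟩ := exists_of_sum_sq_eq_one h1
    refine hmax.false (T.extend hv h.symm (h.diag v) hc (σ := c i) (by rw [← hi1]; ring)
      (k := i) (by omega) fun j hj => ?_).some
    split_ifs with hji
    · rw [hji]
    · exact hi0 ⟨j, by omega⟩ (Finset.mem_univ _) fun hh => hji (by rw [← hh])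
  · exact h1

lemma edgeIp_eq_sum_int {n : ℕ} (a b c d : Fin n) :
    edgeIp a b c d = ∑ k : Fin n, ((if a = k then 1 else 0) - (if b = k then 1 else 0)) *
      ((if c = k then 1 else 0) - (if d = k then (1 : ℤ) else 0)) := by
  have := edgeIp_eq_sum a b c d
  exact_mod_cast this

/-- A maximal tree over a long path shows that the whole graph is good. -/
theorem qf_nonneg (T : TR Z L m) (h : Near Z lam s e k D d) (hmax : IsEmpty (TR Z L (m + 1)))
    (hL : (2 * d + 1) * (2 * (D + 2) + 1) < L) (hlam : 2 ≤ lam)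
    (hconn : ∀ S : Set V, S.Nonempty → (∀ u ∈ S, ∀ v, Z u v ≠ 0 → v ∈ S) → S = Set.univ)
    (x : V → ℝ) : 0 ≤ qf (realMat Z) x + lam * (x ⬝ᵥ x) := by
  have hLm := T.le
  have hall : ∀ w, ¬ T.Off w ∨ T.Two w := by
    have := hconn {w | ¬ T.Off w ∨ T.Two w} ⟨T.vtx 1, Or.inl fun hh =>
      hh 1 le_rfl (by omega) rfl⟩ (fun u hu v huv => by
        by_cases hv : T.Off v
        · exact Or.inr (T.two_of_adj h hmax hL hu huv hv)
        · exact Or.inl hv)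
    intro w
    have hw : w ∈ {w | ¬ T.Off w ∨ T.Two w} := by rw [this]; trivial
    exact hw
  have hvec : ∀ w, ∃ b : Fin (m + 1) → ℤ,
      (∃ j : Fin (m + 1), ∃ hj : 1 ≤ (j : ℕ), w = T.vtx j ∧ b = fun i => T.sg j *
        ((if j = i then 1 else 0) - (if (⟨T.par j, by
          have := T.par_lt j hj (by omega); omega⟩ : Fin (m + 1)) = i then 1 else 0))) ∨
      (T.Off w ∧ ∃ c : ℕ → ℤ, T.Rep w c ∧ ∑ i : Fin (m + 1), c i ^ 2 = 2 ∧
        b = fun i : Fin (m + 1) => c i) := by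
    intro w
    rcases hall w with hw | ⟨hw, c, hc, hc2⟩
    · unfold Off at hw
      push Not at hw
      obtain ⟨j, hj1, hj2, hj⟩ := hw
      exact ⟨_, Or.inl ⟨⟨j, by omega⟩, hj1, hj, rfl⟩⟩
    · exact ⟨_, Or.inr ⟨hw, c, hc, hc2, rfl⟩⟩
  choose b hb using hvec
  have hmix : ∀ w g, (∃ j : Fin (m + 1), ∃ hj : 1 ≤ (j : ℕ), w = T.vtx j ∧ b w = fun i =>
        T.sg j * ((if j = i then 1 else 0) - (if (⟨T.par j, by
          have := T.par_lt j hj (by omega); omega⟩ : Fin (m + 1)) = i then 1 else 0))) →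
      (T.Off g ∧ ∃ c : ℕ → ℤ, T.Rep g c ∧ ∑ i : Fin (m + 1), c i ^ 2 = 2 ∧
        b g = fun i : Fin (m + 1) => c i) → Z w g = ∑ i, b w i * b g i := by
    rintro w g ⟨j, hj, rfl, hbw⟩ ⟨hg, c, hc, hc2, hbg⟩
    rw [hbw, hbg]
    simp only [mul_assoc, sub_mul, ite_mul, one_mul, zero_mul]
    rw [← Finset.mul_sum, Finset.sum_sub_distrib]
    simp only [Finset.sum_ite_eq, Finset.mem_univ, if_true]
    rw [hc j hj (by omega)]
    linear_combination (-Z (T.vtx j) g) * T.sg_sq j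
  have hgram : ∀ w g, Z w g + (if w = g then 2 else 0) = ∑ i, b w i * b g i := by
    intro w g
    rcases hb w with hw | hw <;> rcases hb g with hg | hg
    · obtain ⟨j, hj, rfl, hbw⟩ := hw
      obtain ⟨l, hl, rfl, hbg⟩ := hg
      have hjl : T.vtx j = T.vtx l ↔ (j : ℕ) = l :=
        ⟨T.inj j l hj (by omega) hl (by omega), fun hh => by rw [hh]⟩
      simp only [hjl]
      rw [T.gram j l hj (by omega) hl (by omega), hbw, hbg]
      have hpj := T.par_lt j hj (by omega)
      have hpl := T.par_lt l hl (by omega)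
      have := edgeIp_eq_sum_int j ⟨T.par j, by omega⟩ l ⟨T.par l, by omega⟩
      simp only at this
      rw [this, Finset.mul_sum]
      exact Finset.sum_congr rfl fun i _ => by ring
    · have hne : w ≠ g := by
        obtain ⟨j, hj, rfl, -⟩ := hw
        exact (hg.1 j hj (by omega)).symm
      rw [if_neg hne, add_zero, hmix w g hw hg]
    · have hne : w ≠ g := by
        obtain ⟨j, hj, rfl, -⟩ := hg
        exact hw.1 j hj (by omega)
      rw [if_neg hne, add_zero, h.symm, hmix g w hg hw]
      exact Finset.sum_congr rfl fun i _ => by ring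
    · obtain ⟨hwo, c, hc, hc2, hbw⟩ := hw
      obtain ⟨hgo, c', hc', hc2', hbg⟩ := hg
      by_cases hwg : w = g
      · subst hwg
        rw [if_pos rfl, h.diag, hbw, zero_add, ← hc2]
        exact Finset.sum_congr rfl fun i _ => by ring
      · obtain ⟨r, hr0, hr, hf, hf'⟩ := T.exists_far h.deg (D + 2) hL w g
        have := (T.ctx h hr0 hr).cross_consistent hwg (hwo.emb hr0 hr) (hgo.emb hr0 hr)
          (hc.emb_rep hr0 hr) (hc'.emb_rep hr0 hr)
          (hc.eq_zero_of_far hc2.le (by omega) hr0 hr hf)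
          (hc'.eq_zero_of_far hc2'.le (by omega) hr0 hr hf') hc2 hc2'
        rw [if_neg hwg, add_zero, hbw, hbg]
        have h2 : ((Z w g : ℤ) : ℝ) = ((∑ i : Fin (m + 1), c i * c' i : ℤ) : ℝ) := this
        exact_mod_cast h2
  have hxx : 0 ≤ x ⬝ᵥ x := Finset.sum_nonneg fun i _ => mul_self_nonneg _
  have hq : qf (realMat Z) x + 2 * (x ⬝ᵥ x) = ∑ i, (∑ w, x w * b w i) ^ 2 := by
    have h1 : ∀ i, (∑ w, x w * (b w i : ℝ)) ^ 2 =
        ∑ w, ∑ g, x w * x g * ((b w i : ℝ) * b g i) := by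
      intro i
      rw [pow_two, Finset.sum_mul_sum]
      exact Finset.sum_congr rfl fun _ _ => Finset.sum_congr rfl fun _ _ => by ring
    simp only [h1]
    rw [Finset.sum_comm, qf, dotProduct, dotProduct, Finset.mul_sum, ← Finset.sum_add_distrib]
    refine Finset.sum_congr rfl fun w _ => ?_
    rw [Finset.sum_comm, Matrix.mulVec, dotProduct, Finset.mul_sum]
    have h3 : 2 * (x w * x w) = ∑ g, x w * x g * (if w = g then 2 else 0) := by
      simp; ring
    rw [h3, ← Finset.sum_add_distrib]
    refine Finset.sum_congr rfl fun g _ => ?_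
    rw [← Finset.mul_sum]
    have h4 : ((Z w g : ℤ) : ℝ) + (if w = g then 2 else 0) =
        ∑ i, (b w i : ℝ) * b g i := by exact_mod_cast hgram w g
    rw [← h4]
    simp only [realMat, Matrix.of_apply]
    ring
  have : 0 ≤ ∑ i, (∑ w, x w * (b w i : ℝ)) ^ 2 := Finset.sum_nonneg fun _ _ => sq_nonneg _
  nlinarith

end TR

section lift
variable {ι V : Type*} [Fintype ι] [Fintype V] [DecidableEq V]

/-- The push forward of a vector along a map. -/
def pushVec (f : ι → V) (y : ι → ℝ) : V → ℝ := ∑ i, y i • Pi.single (f i) 1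

lemma pushVec_dot (f : ι → V) (y : ι → ℝ) (w : V → ℝ) :
    pushVec f y ⬝ᵥ w = y ⬝ᵥ (w ∘ f) := by
  unfold pushVec
  rw [sum_dotProduct]
  exact Finset.sum_congr rfl fun i _ => by simp

lemma pushVec_apply {f : ι → V} (hf : f.Injective) (y : ι → ℝ) (i : ι) :
    pushVec f y (f i) = y i := by
  classical
  unfold pushVec
  rw [Finset.sum_apply, Finset.sum_eq_single i]
  · simp
  · intro j _ hj
    simp [hf.ne hj.symm]
  · simp

lemma pushVec_of_notMem {f : ι → V} (y : ι → ℝ) {v : V} (hv : ∀ i, f i ≠ v) :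
    pushVec f y v = 0 := by
  unfold pushVec
  rw [Finset.sum_apply]
  exact Finset.sum_eq_zero fun i _ => by simp [(hv i).symm]

lemma pushVec_self {f : ι → V} (hf : f.Injective) (y : ι → ℝ) :
    pushVec f y ⬝ᵥ pushVec f y = y ⬝ᵥ y := by
  rw [pushVec_dot]
  congr 1
  ext i
  exact pushVec_apply hf y i

lemma qf_pushVec (A : Matrix V V ℝ) (f : ι → V) (y : ι → ℝ) :
    qf A (pushVec f y) = qf (A.submatrix f f) y := by
  rw [qf, pushVec_dot, qf]
  congr 1
  ext i
  rw [Function.comp, Matrix.mulVec, dotProduct_comm, pushVec_dot, Matrix.mulVec, dotProduct_comm]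
  rfl

lemma qf_eq_sum (A : Matrix V V ℝ) (x : V → ℝ) :
    qf A x = ∑ u, ∑ v, x u * x v * A u v := by
  rw [qf, dotProduct]
  refine Finset.sum_congr rfl fun u _ => ?_
  rw [Matrix.mulVec, dotProduct, Finset.mul_sum]
  exact Finset.sum_congr rfl fun v _ => by ring

end lift

/-- An integer valued colorable signed graph, all of whose proper restrictions are good but
which is bad itself. -/
structure MinBad {V : Type*} [Fintype V] [DecidableEq V] (Z : V → V → ℤ) (p : ℕ)
    (col : V → Fin p) (lam : ℝ) : Prop where
  symm : ∀ u v, Z u v = Z v u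
  diag : ∀ v, Z v v = 0
  entry : ∀ u v, Z u v = -1 ∨ Z u v = 0 ∨ Z u v = 1
  neg : ∀ u v, Z u v = -1 → col u = col v
  pos : ∀ u v, Z u v = 1 → col u ≠ col v
  min : ∀ x v, x v = 0 → 0 ≤ qf (realMat Z) x + lam * (x ⬝ᵥ x)
  bad : ∃ x, qf (realMat Z) x + lam * (x ⬝ᵥ x) < 0

namespace MinBad
variable {V : Type*} [Fintype V] [DecidableEq V] {Z : V → V → ℤ} {p : ℕ}
    {col : V → Fin p} {lam : ℝ} (h : MinBad Z p col lam)
include h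

lemma min_push {ι : Type*} [Fintype ι] {f : ι → V} (hf : f.Injective) (y : ι → ℝ)
    (hcard : Fintype.card ι < Fintype.card V) :
    0 ≤ qf ((realMat Z).submatrix f f) y + lam * (y ⬝ᵥ y) := by
  obtain ⟨v, hv⟩ : ∃ v, ∀ i, f i ≠ v := by
    by_contra hcon
    push Not at hcon
    have := Fintype.card_le_of_surjective f hcon
    omega
  have := h.min _ v (pushVec_of_notMem y hv)
  rwa [qf_pushVec, pushVec_self hf] at this

lemma deg_le (hlam : lam < 2.1) (hcard : 7 ≤ Fintype.card V) (v : V) :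
    (Finset.univ.filter fun u => Z u v ≠ 0).card ≤ 4 * p := by
  by_contra hcon
  push Not at hcon
  obtain ⟨a, -, ha⟩ := Finset.exists_lt_card_fiber_of_mul_lt_card_of_maps_to
    (s := Finset.univ.filter fun u => Z u v ≠ 0) (t := (Finset.univ : Finset (Fin p)))
    (f := col) (n := 4) (fun _ _ => Finset.mem_univ _) (by
      rw [Finset.card_univ, Fintype.card_fin]; omega)
  obtain ⟨S, hS, hS5⟩ := Finset.exists_subset_card_eq (Nat.succ_le_of_lt ha)
  have hmem : ∀ u ∈ S, Z u v ≠ 0 ∧ col u = a := fun u hu => by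
    simpa using hS hu
  obtain ⟨ε, hε, hεS⟩ : ∃ ε : ℤ, ε * ε = 1 ∧ ∀ u ∈ S, Z u v = ε := by
    by_cases hav : a = col v
    · refine ⟨-1, by norm_num, fun u hu => ?_⟩
      have h1 := hmem u hu
      rcases h.entry u v with h2 | h2 | h2
      · exact h2
      · exact absurd h2 h1.1
      · exact absurd (h1.2.trans hav) (h.pos u v h2)
    · refine ⟨1, by norm_num, fun u hu => ?_⟩
      have h1 := hmem u hu
      rcases h.entry u v with h2 | h2 | h2
      · exact absurd (h1.2.symm.trans (h.neg u v h2)) hav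
      · exact absurd h2 h1.1
      · exact h2
  have hvS : v ∉ S := fun hv => (hmem v hv).1 (h.diag v)
  have hZS : ∀ u ∈ S, ∀ w ∈ S, Z u w ≤ 0 := fun u hu w hw => by
    rcases h.entry u w with h2 | h2 | h2
    · omega
    · omega
    · exact absurd ((hmem u hu).2.trans (hmem w hw).2.symm) (h.pos u w h2)
  let f : Option S → V := fun o => o.elim v (fun u => u)
  have hf : f.Injective := by
    rintro (_ | ⟨u, hu⟩) (_ | ⟨w, hw⟩) huw
    · rfl
    · exact absurd (show w ∈ S from hw) (by rw [← show v = w from huw]; exact hvS)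
    · exact absurd (show u ∈ S from hu) (by rw [show u = v from huw]; exact hvS)
    · exact congrArg some (Subtype.ext huw)
  have h1 := h.min_push hf (fun o => o.elim (-2 * (ε : ℝ)) fun _ => 1) (by
    rw [Fintype.card_option, Fintype.card_coe, hS5]; omega)
  rw [qf_eq_sum, dotProduct] at h1
  simp only [Fintype.sum_option, Option.elim, Matrix.submatrix_apply, f, realMat, Matrix.of_apply,
    h.diag] at h1
  have h2 : ∑ x : S, (-2 * (ε : ℝ) * 1 * (Z v x : ℝ)) = -10 := by
    rw [Finset.sum_congr rfl (g := fun _ => (-2 : ℝ))]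
    · simp [hS5]; norm_num
    · intro x _
      rw [h.symm, hεS x x.2]
      have : (ε : ℝ) * ε = 1 := by exact_mod_cast hε
      linear_combination (-2) * this
  have h3 : ∑ x : S, (1 * (-2 * (ε : ℝ)) * (Z x v : ℝ) + ∑ y : S, 1 * 1 * (Z x y : ℝ)) ≤ -10 := by
    calc _ ≤ ∑ x : S, (-2 : ℝ) := by
          refine Finset.sum_le_sum fun x _ => ?_
          rw [hεS x x.2]
          have h4 : (ε : ℝ) * ε = 1 := by exact_mod_cast hε
          have h5 : ∑ y : S, 1 * 1 * (Z x y : ℝ) ≤ 0 := Finset.sum_nonpos fun y _ => by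
            have := hZS x x.2 y y.2
            have : (Z x y : ℝ) ≤ 0 := by exact_mod_cast this
            linarith
          linarith
      _ = -10 := by simp [hS5]; norm_num
  have h6 : ∑ x : S, (1 : ℝ) * 1 = 5 := by simp [hS5]
  have h7 : (ε : ℝ) * ε = 1 := by exact_mod_cast hε
  rw [h2, h6] at h1
  have h8 : (-2 * (ε : ℝ)) * (-2 * ε) = 4 := by linear_combination 4 * h7
  rw [h8] at h1
  push_cast at h1
  linarith

lemma eq_univ_of_closed (S : Set V) (hne : S.Nonempty)
    (hS : ∀ u ∈ S, ∀ v, Z u v ≠ 0 → v ∈ S) : S = Set.univ := by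
  classical
  by_contra hcon
  obtain ⟨v, hv⟩ := (Set.ne_univ_iff_exists_notMem S).1 hcon
  obtain ⟨u, hu⟩ := hne
  obtain ⟨x, hx⟩ := h.bad
  set y : V → ℝ := fun w => if w ∈ S then x w else 0 with hy
  set z : V → ℝ := fun w => if w ∈ S then 0 else x w with hz
  have h1 := h.min y v (by simp [hy, hv])
  have h2 := h.min z u (by simp [hz, hu])
  have h3 : qf (realMat Z) x = qf (realMat Z) y + qf (realMat Z) z := by
    simp only [qf_eq_sum, ← Finset.sum_add_distrib]
    refine Finset.sum_congr rfl fun a _ => Finset.sum_congr rfl fun b _ => ?_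
    by_cases ha : a ∈ S <;> by_cases hb : b ∈ S
    · simp [hy, hz, ha, hb]
    · have : Z a b = 0 := by
        by_contra hh; exact hb (hS a ha b hh)
      simp [realMat, this]
    · have : Z a b = 0 := by
        by_contra hh; exact ha (hS b hb a (by rwa [h.symm]))
      simp [realMat, this]
    · simp [hy, hz, ha, hb]
  have h4 : x ⬝ᵥ x = y ⬝ᵥ y + z ⬝ᵥ z := by
    simp only [dotProduct, ← Finset.sum_add_distrib]
    refine Finset.sum_congr rfl fun a _ => ?_
    by_cases ha : a ∈ S <;> simp [hy, hz, ha]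
  rw [h3, h4] at hx
  linarith

end MinBad

section geodesic
variable {V : Type*} (G : SimpleGraph V)

lemma exists_geodesic (hG : G.Preconnected) (v : V) (n : ℕ) (u : V) (hu : G.dist v u = n) :
    ∃ P : ℕ → V, P n = u ∧ (∀ i ≤ n, G.dist v (P i) = i) ∧ ∀ i < n, G.Adj (P i) (P (i + 1)) := by
  induction n generalizing u with
  | zero => exact ⟨fun _ => u, rfl, fun i hi => by rw [hu]; omega, fun i hi => by omega⟩
  | succ n ih =>
    obtain ⟨w, hwu, hw⟩ : ∃ w, G.Adj w u ∧ G.dist v w = n := by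
      obtain ⟨q, hq⟩ := (hG u v).exists_walk_length_eq_dist
      rw [SimpleGraph.dist_comm, hu] at hq
      cases q with
      | nil => simp at hq
      | cons hadj q =>
        rename_i w
        refine ⟨w, hadj.symm, ?_⟩
        have h1 : q.length = n := by simpa using hq
        have h2 := SimpleGraph.dist_le q
        have h3 := SimpleGraph.dist_le (SimpleGraph.Walk.cons hadj.symm SimpleGraph.Walk.nil)
        obtain ⟨q', hq'⟩ := (hG w v).exists_walk_length_eq_dist
        have h4 := SimpleGraph.dist_le (SimpleGraph.Walk.cons hadj q')
        rw [SimpleGraph.Walk.length_cons, SimpleGraph.dist_comm, hu, hq'] at h4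
        rw [SimpleGraph.dist_comm]
        omega
    obtain ⟨P, hPn, hP1, hP2⟩ := ih w hw
    refine ⟨Function.update P (n + 1) u, Function.update_self .., fun i hi => ?_,
      fun i hi => ?_⟩
    · by_cases hin : i = n + 1
      · subst hin; rw [Function.update_self, hu]
      · rw [Function.update_of_ne hin]; exact hP1 i (by omega)
    · rw [Function.update_of_ne (by omega)]
      by_cases hin : i = n
      · subst hin; rw [Function.update_self, hPn]; exact hwu
      · rw [Function.update_of_ne (by omega)]; exact hP2 i (by omega)

lemma dist_le_succ_of_adj (hG : G.Preconnected) {v a b : V} (hab : G.Adj a b) :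
    G.dist v b ≤ G.dist v a + 1 := by
  obtain ⟨q, hq⟩ := (hG v a).exists_walk_length_eq_dist
  have := SimpleGraph.dist_le (q.concat hab)
  rw [SimpleGraph.Walk.length_concat] at this
  omega

lemma exists_lt_dist [Fintype V] [DecidableEq V] [DecidableRel G.Adj] (hG : G.Preconnected)
    {d : ℕ} (hd : ∀ v, (Finset.univ.filter fun u => G.Adj u v).card ≤ d) (v : V) (n : ℕ)
    (hcard : (d + 1) ^ n < Fintype.card V) : ∃ u, n < G.dist v u := by
  classical
  have key : ∀ n, (Finset.univ.filter fun u => G.dist v u ≤ n).card ≤ (d + 1) ^ n := by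
    intro n
    induction n with
    | zero =>
      rw [pow_zero, Finset.card_le_one]
      intro a ha b hb
      simp only [Finset.mem_filter, Finset.mem_univ, true_and, Nat.le_zero] at ha hb
      rw [← (hG v a).dist_eq_zero_iff.1 ha, ← (hG v b).dist_eq_zero_iff.1 hb]
    | succ n ih =>
      have hsub : (Finset.univ.filter fun u => G.dist v u ≤ n + 1) ⊆
          (Finset.univ.filter fun u => G.dist v u ≤ n).biUnion fun w =>
            insert w (Finset.univ.filter fun u => G.Adj u w) := by
        intro u hu
        simp only [Finset.mem_filter, Finset.mem_univ, true_and, Finset.mem_biUnion,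
          Finset.mem_insert] at hu ⊢
        by_cases hun : G.dist v u ≤ n
        · exact ⟨u, hun, Or.inl rfl⟩
        · obtain ⟨P, hP, hP1, hP2⟩ := exists_geodesic G hG v (n + 1) u (by omega)
          refine ⟨P n, (hP1 n (by omega)).le, Or.inr ?_⟩
          rw [← hP]
          exact (hP2 n (by omega)).symm
      calc _ ≤ _ := Finset.card_le_card hsub
        _ ≤ (Finset.univ.filter fun u => G.dist v u ≤ n).card * (d + 1) :=
          Finset.card_biUnion_le_card_mul _ _ _ fun w _ =>
            (Finset.card_insert_le _ _).trans (by have := hd w; omega)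
        _ ≤ (d + 1) ^ n * (d + 1) := Nat.mul_le_mul_right _ ih
        _ = _ := (pow_succ _ _).symm
  by_contra hcon
  push Not at hcon
  have h1 := key n
  rw [Finset.filter_true_of_mem fun u _ => hcon u, Finset.card_univ] at h1
  omega

end geodesic

namespace TR
variable {V : Type*} {Z : V → V → ℤ} {L : ℕ}

/-- The signs along a path. -/
def pathSign (Z : V → V → ℤ) (P : ℕ → V) : ℕ → ℤ
  | 0 => 1
  | i + 1 => if Z (P i) (P (i + 1)) = 1 then -pathSign Z P i else pathSign Z P i

lemma pathSign_sq (P : ℕ → V) (i : ℕ) : pathSign Z P i * pathSign Z P i = 1 := by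
  induction i with
  | zero => rfl
  | succ i ih => unfold pathSign; split_ifs <;> simp [ih]

/-- An induced path of the signed graph gives a tree. -/
def ofPath (P : ℕ → V) (hsymm : ∀ u v, Z u v = Z v u) (hdiag : ∀ v, Z v v = 0)
    (hentry : ∀ u v, Z u v = -1 ∨ Z u v = 0 ∨ Z u v = 1)
    (hinj : ∀ i j, i ≤ L → j ≤ L → P i = P j → i = j)
    (hadj : ∀ i, i < L → Z (P i) (P (i + 1)) ≠ 0)
    (hnadj : ∀ i j, i + 1 < j → j ≤ L → Z (P i) (P j) = 0) : TR Z L L where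
  vtx := P
  par := fun i => i - 1
  sg := pathSign Z P
  pos := fun i => i
  ht := fun _ => 0
  le := le_rfl
  inj := fun i j _ hi _ hj hij => hinj i j hi hj hij
  par_lt := fun i hi _ => by omega
  par_main := fun i _ _ => rfl
  pos_main := fun i _ => rfl
  ht_main := fun i _ => rfl
  pos_branch := fun i h1 h2 => by omega
  ht_branch := fun i h1 h2 => by omega
  sg_sq := pathSign_sq P
  gram := by
    have hlt : ∀ i j, 1 ≤ i → i < j → j ≤ L →
        Z (P i) (P j) = pathSign Z P i * pathSign Z P j * edgeIp i (i - 1) j (j - 1) := by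
      intro i j hi hij hj
      by_cases hij' : j = i + 1
      · subst hij'
        have h1 := pathSign_sq (Z := Z) P i
        have h2 : edgeIp i (i - 1) (i + 1) (i + 1 - 1) = -1 := by
          unfold edgeIp
          rw [if_neg (by omega), if_pos (by omega), if_neg (by omega), if_neg (by omega)]
          norm_num
        have h3 : pathSign Z P (i + 1) = if Z (P i) (P (i + 1)) = 1 then -pathSign Z P i
          else pathSign Z P i := rfl
        rw [h2, h3]
        rcases hentry (P i) (P (i + 1)) with h | h | h
        · rw [h]; norm_num [h1]
        · exact absurd h (hadj i (by omega))
        · rw [h]; norm_num [h1]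
      · rw [hnadj i j (by omega) hj]
        unfold edgeIp
        rw [if_neg (by omega), if_neg (by omega), if_neg (by omega), if_neg (by omega)]
        norm_num
    intro i j hi1 hi2 hj1 hj2
    rcases lt_trichotomy i j with h | h | h
    · rw [if_neg (by omega), add_zero, hlt i j hi1 h hj2]
    · subst h
      rw [if_pos rfl, hdiag, pathSign_sq]
      unfold edgeIp
      rw [if_pos rfl, if_neg (by omega), if_neg (by omega), if_pos rfl]
      norm_num
    · rw [if_neg (by omega), add_zero, hsymm, hlt j i hj1 h hi2]
      unfold edgeIp
      simp only [eq_comm (a := j), eq_comm (a := j - 1)]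
      ring

lemma sum_edgeIp (n : ℕ) (hn : 0 < n) :
    ∑ i ∈ Finset.range n, ∑ j ∈ Finset.range n, edgeIp (i + 1) i (j + 1) j = 2 := by
  have h1 : ∀ i, ∑ j ∈ Finset.range n, edgeIp (i + 1) i (j + 1) j =
      ((if i + 1 = n then 1 else 0) - (if i + 1 = 0 then 1 else 0)) -
      ((if i = n then 1 else 0) - (if i = 0 then (1 : ℤ) else 0)) := by
    intro i
    have := Finset.sum_range_sub
      (fun j => (if i + 1 = j then 1 else 0) - (if i = j then (1 : ℤ) else 0)) n
    rw [show ((if i + 1 = n then 1 else 0) - (if i + 1 = 0 then 1 else 0)) -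
      ((if i = n then 1 else 0) - (if i = 0 then (1 : ℤ) else 0)) =
      ((if i + 1 = n then 1 else 0) - (if i = n then (1 : ℤ) else 0)) -
      ((if i + 1 = 0 then 1 else 0) - (if i = 0 then 1 else 0)) by ring, ← this]
    exact Finset.sum_congr rfl fun j _ => by unfold edgeIp; ring
  simp only [h1]
  rw [Finset.sum_range_sub
    (fun i => (if i = n then 1 else 0) - (if i = 0 then (1 : ℤ) else 0)) n]
  rw [if_pos rfl, if_neg (by omega), if_neg (by omega), if_pos rfl]
  norm_num

end TR

theorem exists_card_bound_of_minBad (p : ℕ) {s e lam : ℝ} (hc : RTree.Crit s e)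
    (hlam : lam < 2 + e) : ∃ N : ℕ, ∀ (V : Type) [Fintype V] [DecidableEq V] (Z : V → V → ℤ)
      (col : V → Fin p), MinBad Z p col lam → Fintype.card V ≤ N := by
  have hs0 := hc.lo
  have hs1 := hc.hi
  have he := hc.e_le
  obtain ⟨n, hn⟩ : ∃ n : ℕ, (s ^ 2) ^ n < min 0.00003 ((2 + e - lam) / 17) :=
    exists_pow_lt_of_lt_one (lt_min (by norm_num) (by linarith)) (by nlinarith)
  obtain ⟨M, hM⟩ := exists_nat_gt (2 / (2 - lam))
  set d := 4 * p with hd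
  set D := n + 2 with hD
  set η := (s ^ 2) ^ n with hη
  have hη1 := hn.trans_le (min_le_left _ _)
  have hη2 := hn.trans_le (min_le_right _ _)
  have hη0 : 0 < η := by positivity
  set L := (2 * d + 1) * (2 * (D + 2) + 1) + M + 2 with hL
  refine ⟨(d + 1) ^ L + L + 7, fun V _ _ Z col h => ?_⟩
  by_contra hcon
  push Not at hcon
  have hdeg := h.deg_le (by linarith) (by omega)
  have hnear : Near Z lam s e (1 - s + η) D d :=
    { toCrit := hc
      lb := by linarith
      ub := by linarith
      one_lt := by omega
      chain_le := fun t ht => by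
        have h1 : (s ^ 2) ^ (t - 1) ≤ η := by
          rw [hη]
          exact pow_le_pow_of_le_one (by positivity) (by nlinarith) (by omega)
        have h2 : 0 ≤ (s ^ 2) ^ (t - 1) := by positivity
        nlinarith
      symm := h.symm
      diag := h.diag
      entry := h.entry
      min := h.min
      gap := by linarith
      deg := hdeg }
  let G : SimpleGraph V :=
    { Adj := fun u v => Z u v ≠ 0
      symm := ⟨fun u v huv => by rwa [h.symm]⟩
      loopless := ⟨fun u hu => hu (h.diag u)⟩ }
  have hG : G.Preconnected := by
    intro v u
    have := h.eq_univ_of_closed {u | G.Reachable v u} ⟨v, SimpleGraph.Reachable.refl _⟩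
      fun a ha b hab => SimpleGraph.Reachable.trans ha (SimpleGraph.Adj.reachable (G := G) hab)
    have hu : u ∈ {u | G.Reachable v u} := by rw [this]; trivial
    exact hu
  have hpos : 0 < Fintype.card V := by omega
  obtain ⟨v⟩ := Fintype.card_pos_iff.1 hpos
  classical
  obtain ⟨u, hu⟩ := exists_lt_dist G hG (d := d) (fun w => by convert hdeg w) v L (by omega)
  obtain ⟨P, -, hP1, hP2⟩ := exists_geodesic G hG v _ u rfl
  have hinj : ∀ i j, i ≤ L → j ≤ L → P i = P j → i = j := fun i j hi hj hij => by
    rw [← hP1 i (by omega), ← hP1 j (by omega), hij]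
  let T₀ : TR Z L L := TR.ofPath P h.symm h.diag h.entry hinj (fun i hi => hP2 i (by omega))
    (fun i j hij hj => by
      by_contra hne
      have h1 := dist_le_succ_of_adj G hG (v := v) (a := P i) (b := P j) hne
      rw [hP1 i (by omega), hP1 j (by omega)] at h1
      omega)
  rcases lt_or_ge lam 2 with hlam2 | hlam2
  · have hM0 : 0 < M := by
      have : (0 : ℝ) < M := lt_trans (by have : 0 < 2 - lam := by linarith
                                         positivity) hM
      exact_mod_cast this
    have h1 := h.min_push (f := fun i : Fin M => P (i + 1)) (fun i j hij => by
      have := hinj _ _ (by omega) (by omega) hij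
      exact Fin.ext (by omega)) (fun i => (T₀.sg (i + 1) : ℝ)) (by
        rw [Fintype.card_fin]; omega)
    have h2 : qf ((realMat Z).submatrix (fun i : Fin M => P (i + 1)) fun i => P (i + 1))
        (fun i => (T₀.sg (i + 1) : ℝ)) + 2 * M = 2 := by
      rw [qf_eq_sum]
      have h3 : (2 : ℝ) * M = ∑ i : Fin M, ∑ j : Fin M, (if i = j then 2 else 0) := by
        simp; ring
      rw [h3, ← Finset.sum_add_distrib]
      simp only [← Finset.sum_add_distrib]
      have h4 := TR.sum_edgeIp M hM0
      rw [← Fin.sum_univ_eq_sum_range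
        (fun i => ∑ j ∈ Finset.range M, edgeIp (i + 1) i (j + 1) j)] at h4
      simp only [← Fin.sum_univ_eq_sum_range (fun j => edgeIp (_ + 1) _ (j + 1) j)] at h4
      have h5 : ((∑ i : Fin M, ∑ j : Fin M, edgeIp (i + 1) i (j + 1) j : ℤ) : ℝ) = 2 := by
        rw [h4]; norm_num
      refine Eq.trans ?_ h5
      push_cast
      refine Finset.sum_congr rfl fun i _ => Finset.sum_congr rfl fun j _ => ?_
      have h6 := T₀.gram (i + 1) (j + 1) (by omega) (by omega) (by omega) (by omega)
      have h7 : T₀.sg (i + 1) * T₀.sg (j + 1) * Z (P (i + 1)) (P (j + 1)) +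
          (if i = j then 2 else 0) = edgeIp (i + 1) i (j + 1) j := by
        have a1 := T₀.sg_sq (i + 1)
        have a2 := T₀.sg_sq (j + 1)
        have h8 : T₀.sg (i + 1) * T₀.sg (j + 1) * (T₀.sg (i + 1) * T₀.sg (j + 1) *
          edgeIp (i + 1) i (j + 1) j) = edgeIp (i + 1) i (j + 1) j := by
          linear_combination (edgeIp (i + 1) i (j + 1) j) *
            (T₀.sg (j + 1) * T₀.sg (j + 1) * a1 + a2)
        rw [← h8]
        change Z (P (i + 1)) (P (j + 1)) + _ = T₀.sg (i + 1) * T₀.sg (j + 1) *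
          edgeIp (i + 1) i (j + 1) j at h6
        rw [← h6]
        by_cases hij : i = j
        · subst hij
          simp only [if_true]
          linear_combination (-2) * a1
        · rw [if_neg hij, if_neg (fun hh => hij (Fin.ext (by omega)))]
          ring
      simp only [Matrix.submatrix_apply, realMat, Matrix.of_apply]
      exact_mod_cast h7
    have h3 : (fun i : Fin M => (T₀.sg (i + 1) : ℝ)) ⬝ᵥ (fun i : Fin M => (T₀.sg (i + 1) : ℝ)) =
        M := by
      rw [dotProduct, Finset.sum_congr rfl (g := fun _ => (1 : ℝ))]
      · simp
      · intro i _
        exact_mod_cast T₀.sg_sq (i + 1)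
    rw [h3] at h1
    rw [div_lt_iff₀ (by linarith)] at hM
    linarith
  · -- a maximal tree over the path
    have hbound : ∀ m, Nonempty (TR Z L m) → m ≤ Fintype.card V := by
      rintro m ⟨T⟩
      have := Finset.card_le_card_of_injOn (s := Finset.Icc 1 m) (t := Finset.univ) T.vtx
        (fun _ _ => Finset.mem_univ _) (fun i hi j hj hij => by
          have hi' := Finset.mem_Icc.1 hi
          have hj' := Finset.mem_Icc.1 hj
          exact T.inj i j hi'.1 hi'.2 hj'.1 hj'.2 hij)
      simpa using this
    obtain ⟨m, ⟨T⟩, hmax⟩ : ∃ m, Nonempty (TR Z L m) ∧ IsEmpty (TR Z L (m + 1)) := by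
      by_contra hno
      push Not at hno
      have hall : ∀ i, Nonempty (TR Z L (L + i)) := fun i => by
        induction i with
        | zero => exact ⟨T₀⟩
        | succ i ih => exact hno _ ih
      have := hbound _ (hall (Fintype.card V + 1))
      omega
    obtain ⟨x, hx⟩ := h.bad
    have := T.qf_nonneg hnear hmax (by omega) hlam2 h.eq_univ_of_closed x
    linarith

lemma mem_eigen_iff {n : ℕ} (A : Matrix (Fin n) (Fin n) ℝ) (t : ℝ) :
    t ∈ {t : ℝ | ∃ x : Fin n → ℝ, x ≠ 0 ∧ A.mulVec x = t • x} ↔ t ∈ spectrum ℝ A := by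
  rw [← Matrix.spectrum_toLin', ← Module.End.hasEigenvalue_iff_mem_spectrum]
  constructor
  · rintro ⟨x, hx, hA⟩
    exact Module.End.hasEigenvalue_of_hasEigenvector (x := x)
      ⟨Module.End.mem_eigenspace_iff.2 (by rwa [Matrix.toLin'_apply]), hx⟩
  · intro h
    obtain ⟨x, hx⟩ := h.exists_hasEigenvector
    exact ⟨x, hx.2, by rw [← Matrix.toLin'_apply]; exact hx.apply_eq_smul⟩

lemma qf_add_nonneg_of_le_sgLam1 {G : SG} (hG : IsSignedGraph G) {lam : ℝ}
    (h : -lam ≤ sgLam1 G) (x : Fin G.1 → ℝ) : 0 ≤ qf G.2 x + lam * (x ⬝ᵥ x) := by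
  have hherm : G.2.IsHermitian := by
    rw [Matrix.IsHermitian, Matrix.conjTranspose_eq_transpose_of_trivial]; exact hG.1
  have hset : {t : ℝ | ∃ x : Fin G.1 → ℝ, x ≠ 0 ∧ G.2.mulVec x = t • x} =
      Set.range hherm.eigenvalues := by
    rw [← hherm.spectrum_real_eq_range_eigenvalues]
    ext t; exact mem_eigen_iff _ _
  have hbdd : BddBelow {t : ℝ | ∃ x : Fin G.1 → ℝ, x ≠ 0 ∧ G.2.mulVec x = t • x} := by
    rw [hset]; exact (Set.finite_range _).bddBelow
  have hall : ∀ t x, x ≠ 0 → G.2.mulVec x = t • x → -lam ≤ t := fun t x hx ht =>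
    h.trans (csInf_le hbdd ⟨x, hx, ht⟩)
  have hB : (G.2 + lam • (1 : Matrix (Fin G.1) (Fin G.1) ℝ)).IsHermitian := by
    rw [Matrix.IsHermitian, Matrix.conjTranspose_eq_transpose_of_trivial]
    simp [hG.1.eq]
  have hpsd : (G.2 + lam • (1 : Matrix (Fin G.1) (Fin G.1) ℝ)).PosSemidef := by
    rw [hB.posSemidef_iff_eigenvalues_nonneg]
    intro i
    have h1 := hB.eigenvalues_mem_spectrum_real i
    rw [← mem_eigen_iff] at h1
    obtain ⟨x, hx, h2⟩ := h1
    rw [Matrix.add_mulVec, Matrix.smul_mulVec, Matrix.one_mulVec] at h2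
    have h3 := hall (hB.eigenvalues i - lam) x hx (by rw [sub_smul, ← h2]; simp)
    simp only [Pi.zero_apply]
    linarith
  have := hpsd.dotProduct_mulVec_nonneg x
  rw [Matrix.add_mulVec, Matrix.smul_mulVec, Matrix.one_mulVec, dotProduct_add,
    dotProduct_smul] at this
  simpa [qf] using this

lemma le_sgLam1_of_qf_add_nonneg {G : SG} {lam : ℝ} (hlam : 0 ≤ lam)
    (h : ∀ x, 0 ≤ qf G.2 x + lam * (x ⬝ᵥ x)) : -lam ≤ sgLam1 G := by
  unfold sgLam1
  rcases Set.eq_empty_or_nonempty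
    {t : ℝ | ∃ x : Fin G.1 → ℝ, x ≠ 0 ∧ G.2.mulVec x = t • x} with he | hne
  · rw [he, Real.sInf_empty]; linarith
  · refine le_csInf hne ?_
    rintro t ⟨x, hx, hA⟩
    have h1 := h x
    rw [qf, hA, dotProduct_smul, smul_eq_mul] at h1
    have h2 : 0 < x ⬝ᵥ x := by
      have := Matrix.dotProduct_star_self_pos_iff.2 hx
      simpa using this
    nlinarith

lemma le_sgLam1_iff {G : SG} (hG : IsSignedGraph G) {lam : ℝ} (hlam : 0 ≤ lam) :
    -lam ≤ sgLam1 G ↔ ∀ x, 0 ≤ qf G.2 x + lam * (x ⬝ᵥ x) :=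
  ⟨fun h x => qf_add_nonneg_of_le_sgLam1 hG h x, le_sgLam1_of_qf_add_nonneg hlam⟩

lemma classGp_submatrix {p : ℕ} {G : SG} (hG : G ∈ classGp p) {k : ℕ} {f : Fin k → Fin G.1}
    (hf : f.Injective) : (⟨k, G.2.submatrix f f⟩ : SG) ∈ classGp p := by
  obtain ⟨⟨h1, h2, h3⟩, c, hc⟩ := hG
  exact ⟨⟨h1.submatrix f, fun i => h2 _, fun i j hij => h3 _ _ (hf.ne hij)⟩,
    c ∘ f, fun u v => hc _ _⟩

lemma finite_classGp_le (p N : ℕ) : {G : SG | G ∈ classGp p ∧ G.1 ≤ N}.Finite := by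
  have h1 : (⋃ n ∈ Set.Iic N, Sigma.mk n '' {M : Matrix (Fin n) (Fin n) ℝ |
      ∀ i, M i ∈ {r : Fin n → ℝ | ∀ j, r j ∈ ({-1, 0, 1} : Set ℝ)}}).Finite := by
    refine (Set.finite_Iic N).biUnion fun n _ => Set.Finite.image _ ?_
    exact Set.Finite.pi' fun i => Set.Finite.pi' fun j => by simp
  refine h1.subset ?_
  rintro ⟨n, M⟩ ⟨⟨⟨-, h2, h3⟩, -⟩, hn⟩
  refine Set.mem_biUnion (show n ∈ Set.Iic N from hn) ⟨M, fun i j => ?_, rfl⟩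
  by_cases hij : i = j
  · subst hij; have := h2 i; simp only at this; simp [this]
  · simpa using h3 i j hij

/-- The integer matrix of a signed graph. -/
noncomputable def intMat (G : SG) (i j : Fin G.1) : ℤ :=
  if G.2 i j = -1 then -1 else if G.2 i j = 1 then 1 else 0

lemma intMat_cases {G : SG} (hG : IsSignedGraph G) (i j : Fin G.1) :
    (G.2 i j = -1 ∧ intMat G i j = -1) ∨ (G.2 i j = 0 ∧ intMat G i j = 0) ∨
      (G.2 i j = 1 ∧ intMat G i j = 1) := by
  have : G.2 i j = -1 ∨ G.2 i j = 0 ∨ G.2 i j = 1 := by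
    by_cases hij : i = j
    · subst hij; exact Or.inr (Or.inl (hG.2.1 i))
    · exact hG.2.2 i j hij
  rcases this with h | h | h
  · exact Or.inl ⟨h, by unfold intMat; rw [if_pos h]⟩
  · exact Or.inr (Or.inl ⟨h, by unfold intMat; rw [h]; norm_num⟩)
  · exact Or.inr (Or.inr ⟨h, by unfold intMat; rw [h]; norm_num⟩)

lemma realMat_intMat {G : SG} (hG : IsSignedGraph G) : realMat (intMat G) = G.2 := by
  ext i j
  rcases intMat_cases hG i j with ⟨h1, h2⟩ | ⟨h1, h2⟩ | ⟨h1, h2⟩ <;>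
    simp [realMat, h1, h2]

lemma minBad_intMat {p : ℕ} {F : SG} (hF : F ∈ classGp p) {c : Fin F.1 → Fin p}
    (hcol : ∀ u v, (F.2 u v = -1 → c u = c v) ∧ (F.2 u v = 1 → c u ≠ c v)) {lam : ℝ}
    {y : Fin F.1 → ℝ} (hy : qf F.2 y + lam * (y ⬝ᵥ y) < 0)
    (hmin : ∀ l < F.1, ∀ g : Fin l → Fin F.1, g.Injective → ∀ z : Fin l → ℝ,
      0 ≤ qf (F.2.submatrix g g) z + lam * (z ⬝ᵥ z)) :
    MinBad (intMat F) p c lam := by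
  have hM := realMat_intMat hF.1
  exact
      { symm := fun u v => by
          unfold intMat; rw [hF.1.1.apply]
        diag := fun v => by
          unfold intMat; rw [hF.1.2.1]; norm_num
        entry := fun u v => by
          rcases intMat_cases hF.1 u v with ⟨h1, h2⟩ | ⟨h1, h2⟩ | ⟨h1, h2⟩ <;> simp [h2]
        neg := fun u v huv => by
          rcases intMat_cases hF.1 u v with ⟨h1, h2⟩ | ⟨h1, h2⟩ | ⟨h1, h2⟩
          · exact (hcol u v).1 h1
          · omega
          · omega
        pos := fun u v huv => by
          rcases intMat_cases hF.1 u v with ⟨h1, h2⟩ | ⟨h1, h2⟩ | ⟨h1, h2⟩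
          · omega
          · omega
          · exact (hcol u v).2 h1
        min := fun x v hxv => by
          rw [hM]
          have hkpos : 0 < F.1 := v.pos
          obtain ⟨l, hl⟩ : ∃ l, F.1 = l + 1 := ⟨F.1 - 1, by omega⟩
          let g : Fin l → Fin F.1 := fun i => Fin.cast hl.symm ((Fin.cast hl v).succAbove i)
          have hg : g.Injective := fun i j hij =>
            Fin.succAbove_right_injective (Fin.cast_injective _ hij)
          have hgs : ∀ u, u ≠ v → ∃ i, g i = u := by
            intro u hu
            obtain ⟨i, hi⟩ := Fin.exists_succAbove_eq (x := Fin.cast hl u) (y := Fin.cast hl v)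
              (fun hh => hu (Fin.cast_injective _ hh))
            exact ⟨i, by simp [g, hi]⟩
          have hgv : ∀ i, g i ≠ v := fun i hh => by
            have : Fin.cast hl (g i) = Fin.cast hl v := by rw [hh]
            simp [g] at this
          have hx : x = pushVec g (x ∘ g) := by
            ext u
            by_cases hu : u = v
            · subst hu; rw [pushVec_of_notMem _ hgv, hxv]
            · obtain ⟨i, rfl⟩ := hgs u hu
              rw [pushVec_apply hg]; rfl
          rw [hx, qf_pushVec, pushVec_self hg]
          exact hmin l (by omega) g hg (x ∘ g)
        bad := ⟨y, by rw [hM]; exact hy⟩ }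

/-- Below the critical value there is a finite forbidden subgraph characterization. -/
theorem hasFFSC_of_lt (p : ℕ) {s e lam : ℝ} (hc : RTree.Crit s e) (hlam : lam < 2 + e) :
    HasFFSC (classGp p) (classGpLam p lam) := by
  rcases lt_or_ge lam 0 with hneg | hnonneg
  · refine ⟨{⟨0, 0⟩}, Set.finite_singleton _, ?_, fun G hG => ?_⟩
    · rintro _ rfl
      exact ⟨⟨by ext i; exact i.elim0, fun i => i.elim0, fun i => i.elim0⟩, fun i => i.elim0,
        fun i => i.elim0⟩
    · refine iff_of_false ?_ ?_
      · rintro ⟨-, h⟩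
        have h1 := qf_add_nonneg_of_le_sgLam1 hG.1 h
        obtain ⟨n, M⟩ := G
        cases n with
        | zero =>
          have h2 : sgLam1 ⟨0, M⟩ = 0 := by
            have : {t : ℝ | ∃ x : Fin 0 → ℝ, x ≠ 0 ∧ M.mulVec x = t • x} = ∅ := by
              ext t
              simp only [Set.mem_ofPred_eq, Set.mem_empty_iff_false, iff_false]
              rintro ⟨x, hx, -⟩
              exact hx (Subsingleton.elim _ _)
            unfold sgLam1
            change sInf {t : ℝ | ∃ x : Fin 0 → ℝ, x ≠ 0 ∧ M.mulVec x = t • x} = 0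
            rw [this, Real.sInf_empty]
          rw [h2] at h
          linarith
        | succ n =>
          have h2 := h1 (Pi.single 0 1)
          have h3 : M 0 0 = 0 := hG.1.2.1 0
          simp [qf, h3] at h2
          linarith
      · push Not
        exact ⟨_, rfl, fun i => i.elim0, fun i => i.elim0, fun i => i.elim0⟩
  obtain ⟨N, hN⟩ := exists_card_bound_of_minBad p hc hlam
  refine ⟨{F | F ∈ classGp p ∧ F.1 ≤ N ∧ ¬ -lam ≤ sgLam1 F},
    (finite_classGp_le p N).subset fun F hF => ⟨hF.1, hF.2.1⟩, fun F hF => hF.1,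
    fun G hG => ⟨fun hGl F hF hFG => ?_, fun hno => ⟨hG, ?_⟩⟩⟩
  · obtain ⟨f, hf, hFf⟩ := hFG
    refine hF.2.2 ((le_sgLam1_iff hF.1.1 hnonneg).2 fun y => ?_)
    have h1 := (le_sgLam1_iff hG.1 hnonneg).1 hGl.2 (pushVec f y)
    rw [qf_pushVec, pushVec_self hf] at h1
    rwa [show F.2 = G.2.submatrix f f from by ext u v; exact hFf u v]
  · by_contra hbad
    rw [le_sgLam1_iff hG.1 hnonneg] at hbad
    push Not at hbad
    obtain ⟨x₀, hx₀⟩ := hbad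
    have hex : ∃ k : ℕ, ∃ f : Fin k → Fin G.1, f.Injective ∧
        ∃ y, qf (G.2.submatrix f f) y + lam * (y ⬝ᵥ y) < 0 :=
      ⟨G.1, id, Function.injective_id, x₀, hx₀⟩
    classical
    obtain ⟨k, ⟨f, hf, y, hy⟩, hkmin⟩ : ∃ k, (∃ f : Fin k → Fin G.1, f.Injective ∧
        ∃ y, qf (G.2.submatrix f f) y + lam * (y ⬝ᵥ y) < 0) ∧ ∀ l < k,
        ¬ ∃ f : Fin l → Fin G.1, f.Injective ∧
        ∃ y, qf (G.2.submatrix f f) y + lam * (y ⬝ᵥ y) < 0 :=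
      ⟨Nat.find hex, Nat.find_spec hex, fun l hl => Nat.find_min hex hl⟩
    have hF := classGp_submatrix hG hf
    obtain ⟨c, hcol⟩ := hF.2
    have hmb := minBad_intMat hF hcol hy fun l hl g hg z => by
      by_contra hlt
      push Not at hlt
      exact hkmin l hl ⟨f ∘ g, hf.comp hg, z, hlt⟩
    have hcard := hN _ _ _ hmb
    rw [Fintype.card_fin] at hcard
    refine hno _ ⟨hF, hcard, fun hFl => ?_⟩ ⟨f, hf, fun _ _ => rfl⟩
    have := qf_add_nonneg_of_le_sgLam1 hF.1 hFl y
    linarith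

/-- A family of pairs of pivots of rooted signed graphs, taken at two values `μ < ν`, that is
closed under joining two roots by a negative edge and under gluing along a positive triangle. -/
structure PivotSystem (P : ℝ → ℝ → Prop) (μ ν : ℝ) : Prop where
  lt : μ < ν
  single : P μ ν
  join : ∀ {d e d' e'}, P d e → P d' e' → 0 < d' → 0 < e' → P (d - 1 / d') (e - 1 / e')
  tri : ∀ {Q Q' d e}, P Q Q' → P d e → 0 < Q → 0 < Q' → 1 / Q < d → 1 / Q' < e →
    P (μ - 1 / Q - (1 - 1 / Q) ^ 2 / (d - 1 / Q)) (ν - 1 / Q' - (1 - 1 / Q') ^ 2 / (e - 1 / Q'))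
  rigid : ∀ {d e}, P d e → 0 < e → 0 < d
  gap : ∀ {d e}, P d e → ν - μ ≤ e - d

namespace PivotSystem
variable {P : ℝ → ℝ → Prop} {μ ν : ℝ} (S : PivotSystem P μ ν)
include S

lemma plain {d e : ℝ} (h : P d e) (hd : 0 < d) : P (μ - 1 / d) (ν - 1 / e) :=
  S.join S.single h hd (by have := S.gap h; have := S.lt; linarith)

lemma pendant {d e : ℝ} (h : P d e) (hμ : 0 < μ) (k : ℕ) :
    P (d - k * (1 / μ)) (e - k * (1 / ν)) := by
  induction k with
  | zero => simpa using h
  | succ k ih =>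
    have := S.join ih S.single hμ (hμ.trans S.lt)
    convert this using 1 <;> push_cast <;> ring

lemma le_one {d e : ℝ} (h : P d e) (hd : 0 < d) (hd1 : d ≤ 1) : e ≤ 1 := by
  by_contra hlt
  push Not at hlt
  have h1 := S.rigid (S.join h h hd (by linarith)) (by
    have : 1 / e < 1 := by rw [div_lt_one (by linarith)]; exact hlt
    linarith)
  have : 1 ≤ 1 / d := by rw [le_div_iff₀ hd]; linarith
  linarith

lemma false_of_trap {s β y y' d₀ e₀ : ℝ} (hs : 0 < s) (hμs : s ^ 2 + 1 = μ * s) (hβ : β < 1)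
    (hy : P y y') (h0 : P d₀ e₀) (hs0 : s ≤ d₀) (h0β : d₀ ≤ β) (hyβ : μ - β < y)
    (hup : y * (μ * β - β ^ 2 - 1) ≤ μ - 2)
    (hlo : μ - β + s - 2 * s * (μ - β) ≤ y * (1 - s * (μ - β))) : False := by
  have hμ2 : 2 ≤ μ := by
    have : 0 ≤ (s - 1) ^ 2 := sq_nonneg _
    nlinarith
  have hμβ : 0 < μ - β := by linarith
  have hy0 : 0 < y := by linarith
  have hyy' : y < y' := by have := S.gap hy; have := S.lt; linarith
  have hqq : 1 / y' < 1 / y := one_div_lt_one_div_of_lt hy0 hyy'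
  have key : ∀ n : ℕ, ∃ d e, P d e ∧ s ≤ d ∧ d ≤ β ∧ n * (ν - μ) ≤ e - d := by
    intro n
    induction n with
    | zero => exact ⟨d₀, e₀, h0, hs0, h0β, by have := S.gap h0; have := S.lt; push_cast; linarith⟩
    | succ n ih =>
      obtain ⟨d, e, hP, hsd, hdβ, hn⟩ := ih
      have hd : 0 < d := by linarith
      have hde : d < e := by have := S.gap hP; have := S.lt; linarith
      have he : 0 < e := by linarith
      have he1 := S.le_one hP hd (by linarith)
      by_cases hc : d * (μ - β) ≤ 1
      · refine ⟨_, _, S.plain hP hd, ?_, ?_, ?_⟩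
        · have : 1 / d ≤ 1 / s := one_div_le_one_div_of_le hs hsd
          have h2 : μ = s + 1 / s := by field_simp; linarith
          linarith
        · have : μ - β ≤ 1 / d := by rw [le_div_iff₀ hd]; linarith
          linarith
        · have h1 : 1 / d - 1 / e = (e - d) / (d * e) := by
            field_simp
          have h2 : e - d ≤ (e - d) / (d * e) := by
            rw [le_div_iff₀ (by positivity)]
            have : d * e ≤ 1 := by nlinarith
            nlinarith
          push_cast
          linarith
      · push Not at hc
        have hqd₀ : 1 / y < 1 / (μ - β) := one_div_lt_one_div_of_lt hμβ hyβ
        have hd₀ : 1 / (μ - β) < d := by rw [div_lt_iff₀ hμβ]; linarith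
        have hqd : 1 / y < d := hqd₀.trans hd₀
        have hform : ∀ m q x : ℝ, q < x →
            m - q - (1 - q) ^ 2 / (x - q) = m - 2 + x - (1 - x) ^ 2 / (x - q) := by
          intro m q x hx
          have : x - q ≠ 0 := by linarith
          field_simp
          ring
        have hmono : ∀ q x q' x' : ℝ, q < x → x ≤ x' → x' ≤ 1 → q' ≤ q →
            (1 - x') ^ 2 / (x' - q') ≤ (1 - x) ^ 2 / (x - q) := by
          intro q x q' x' h1 h2 h3 h4
          apply div_le_div₀ (sq_nonneg _) _ (by linarith) (by linarith)
          exact pow_le_pow_left₀ (by linarith) (by linarith) 2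
        have hP' := S.tri hy hP hy0 (hy0.trans hyy') hqd (by linarith)
        rw [hform _ _ _ hqd, hform _ _ _ (by linarith)] at hP'
        refine ⟨_, _, hP', ?_, ?_, ?_⟩
        · have h1 := hmono (1 / y) (1 / (μ - β)) (1 / y) d hqd₀ hd₀.le (by linarith) le_rfl
          have h2 : s ≤ μ - 2 + 1 / (μ - β) - (1 - 1 / (μ - β)) ^ 2 / (1 / (μ - β) - 1 / y) := by
            have h3 : (1 - 1 / (μ - β)) ^ 2 / (1 / (μ - β) - 1 / y) =
                y * (μ - β - 1) ^ 2 / ((μ - β) * (y - (μ - β))) := by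
              have : y - (μ - β) ≠ 0 := by linarith
              have : 1 / (μ - β) - 1 / y ≠ 0 := by linarith
              field_simp
            have h4 : y * (μ - β - 1) ^ 2 / ((μ - β) * (y - (μ - β))) ≤
                μ - 2 + 1 / (μ - β) - s := by
              rw [div_le_iff₀ (mul_pos hμβ (by linarith))]
              have h5 : (μ - 2 + 1 / (μ - β) - s) * ((μ - β) * (y - (μ - β))) =
                ((μ - 2 - s) * (μ - β) + 1) * (y - (μ - β)) := by field_simp; ring
              rw [h5]
              have h6 : s * (y * (μ - β - 1) ^ 2) ≤
                  s * (((μ - 2 - s) * (μ - β) + 1) * (y - (μ - β))) := by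
                have : s * (μ - 2 - s) = 1 - 2 * s := by linarith
                have h7 : s * (((μ - 2 - s) * (μ - β) + 1) * (y - (μ - β))) =
                  ((1 - 2 * s) * (μ - β) + s) * (y - (μ - β)) := by rw [← this]; ring
                rw [h7]
                nlinarith
              exact le_of_mul_le_mul_left h6 hs
            linarith
          linarith
        · have h1 := hmono (1 / y) d (1 / y) β hqd hdβ hβ.le le_rfl
          have h2 : μ - 2 ≤ (1 - β) ^ 2 / (β - 1 / y) := by
            rw [le_div_iff₀ (by linarith)]
            have h3 : (μ - 2) * (β - 1 / y) = (μ - 2) * (β * y - 1) / y := by field_simp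
            rw [h3, div_le_iff₀ hy0]
            linarith
          linarith
        · have h1 := hmono (1 / y) d (1 / y') e hqd hde.le he1 hqq.le
          push_cast
          linarith
  have hη := S.lt
  obtain ⟨n, hn⟩ := exists_nat_gt (1 / (ν - μ))
  rw [div_lt_iff₀ (by linarith)] at hn
  obtain ⟨d, e, hP, h1, h2, h3⟩ := key n
  have := S.le_one hP (by linarith) (by linarith)
  linarith

end PivotSystem

namespace PivotSystem
variable {P : ℝ → ℝ → Prop} {μ ν : ℝ} (S : PivotSystem P μ ν)
include S

/-- If the larger pivot survives all plain extensions, then so does the smaller one. -/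
lemma le_of_le {s s' a b : ℝ} (hs : 0 < s) (hs1 : s < 1) (hμs : s ^ 2 + 1 = μ * s) (hs' : 0 < s')
    (hνs : s' ^ 2 + 1 = ν * s') (h : P a b) (hb : s' ≤ b) : s ≤ a := by
  by_contra hlt
  push Not at hlt
  have hμ : μ = s + 1 / s := by field_simp; linarith
  have hν : ν = s' + 1 / s' := by field_simp; linarith
  have hs2 : 0 < 1 / s ^ 2 - 1 := by
    rw [sub_pos, lt_div_iff₀ (by positivity)]; nlinarith
  have key : ∀ n : ℕ, ∃ a' b', P a' b' ∧ s' ≤ b' ∧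
      a' ≤ a - n * ((s - a) * (1 / s ^ 2 - 1)) := by
    intro n
    induction n with
    | zero => exact ⟨a, b, h, hb, by simp⟩
    | succ n ih =>
      obtain ⟨a', b', hP, hb', ha'⟩ := ih
      have ha0 : 0 < a' := S.rigid hP (by linarith)
      refine ⟨_, _, S.plain hP ha0, ?_, ?_⟩
      · have := one_div_le_one_div_of_le hs' hb'
        linarith
      · have hle : a' ≤ a := by
          have : 0 ≤ n * ((s - a) * (1 / s ^ 2 - 1)) :=
            mul_nonneg (Nat.cast_nonneg _) (mul_nonneg (by linarith) hs2.le)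
          linarith
        have h1 : 1 / a' - 1 / s = (s - a') / (s * a') := by field_simp
        have h2 : (s - a') * (1 / s ^ 2) ≤ (s - a') / (s * a') := by
          rw [div_eq_mul_one_div (s - a')]
          apply mul_le_mul_of_nonneg_left _ (by linarith)
          apply one_div_le_one_div_of_le (by positivity)
          nlinarith
        have h3 : (s - a) * (1 / s ^ 2 - 1) ≤ (s - a') * (1 / s ^ 2 - 1) :=
          mul_le_mul_of_nonneg_right (by linarith) hs2.le
        push_cast
        nlinarith
  have hpos : 0 < (s - a) * (1 / s ^ 2 - 1) := mul_pos (by linarith) hs2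
  obtain ⟨n, hn⟩ := exists_nat_gt (s / ((s - a) * (1 / s ^ 2 - 1)))
  rw [div_lt_iff₀ hpos] at hn
  obtain ⟨a', b', hP, hb', ha'⟩ := key n
  have := S.rigid hP (by linarith)
  linarith

omit S in
lemma crossRatio_sub {s t h K d e : ℝ} (hh : 0 < h) (hds : s ≤ d - h) (hde : d ≤ e)
    (het : e < t) (hsum : d + e ≤ s + t + h)
    (hK : K * ((t - e) * (d - s)) ≤ (e - s) * (t - d)) :
    K * ((t - (e - h)) * (d - h - s)) ≤ (e - h - s) * (t - (d - h)) := by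
  have hpos : 0 < (t - e) * (d - s) := mul_pos (by linarith) (by linarith)
  have h1 : (d - h - s) * (t - e + h) * ((t - d) * (e - s)) ≤
      (e - h - s) * (t - d + h) * ((t - e) * (d - s)) := by
    have : (e - h - s) * (t - d + h) * ((t - e) * (d - s)) -
        (d - h - s) * (t - e + h) * ((t - d) * (e - s)) =
        h * (t - s) * ((e - d) * (s + t + h - (d + e))) := by ring
    have h3 : 0 ≤ h * (t - s) * ((e - d) * (s + t + h - (d + e))) :=
      mul_nonneg (mul_nonneg hh.le (by linarith)) (mul_nonneg (by linarith) (by linarith))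
    linarith
  have h2 : (d - h - s) * (t - e + h) * (K * ((t - e) * (d - s))) ≤
      (d - h - s) * (t - e + h) * ((t - d) * (e - s)) :=
    mul_le_mul_of_nonneg_left (by linarith) (mul_nonneg (by linarith) (by linarith))
  refine le_of_mul_le_mul_right ?_ hpos
  calc _ = (d - h - s) * (t - e + h) * (K * ((t - e) * (d - s))) := by ring
    _ ≤ _ := h2
    _ ≤ _ := h1
    _ = _ := by ring

omit S in
lemma crossRatio_sub_nat {s t h K d e : ℝ} (hh : 0 < h) (k : ℕ) (hds : s ≤ d - k * h)
    (hde : d ≤ e) (het : e < t) (hsum : d + e ≤ s + t + h)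
    (hK : K * ((t - e) * (d - s)) ≤ (e - s) * (t - d)) :
    K * ((t - (e - k * h)) * (d - k * h - s)) ≤ (e - k * h - s) * (t - (d - k * h)) := by
  induction k with
  | zero => simpa using hK
  | succ k ih =>
    push_cast at hds
    have hk : 0 ≤ k * h := by positivity
    have := crossRatio_sub hh (by linarith) (by linarith) (by linarith) (by linarith)
      (ih (by linarith))
    push_cast
    convert this using 2 <;> ring

lemma false_of_greedy {s s' : ℝ} (hs : 0 < s) (hs1 : s < 1) (hμs : s ^ 2 + 1 = μ * s)
    (hs' : 0 < s') (hss' : s' ≤ s) (hνs : s' ^ 2 + 1 = ν * s')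
    (hgold : s + 1 / μ < 1 / s) (hmid : (μ - 1 / μ) * (s + 1 / μ) ≤ 2) : False := by
  have hη := S.lt
  set t := 1 / s with ht
  set h := 1 / μ with hh
  set h' := 1 / ν with hh'
  set η := ν - μ with hηdef
  have hη0 : 0 < η := by rw [hηdef]; linarith
  have hst : s * t = 1 := by rw [ht]; field_simp
  have hμ : μ = s + t := by rw [ht]; field_simp; linarith
  have hν : ν = s' + 1 / s' := by field_simp; linarith
  have ht0 : 0 < t := by positivity
  have hμ0 : 0 < μ := by linarith
  have hh0 : 0 < h := by positivity
  have hh'0 : 0 < h' := one_div_pos.2 (by linarith)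
  have hhh' : h' < h := one_div_lt_one_div_of_lt hμ0 hη
  have ht1 : 1 < t := by rw [ht, lt_div_iff₀ hs]; linarith
  have hgreedy : ∀ D : ℝ, s ≤ D → ∃ k : ℕ, s ≤ D - k * h ∧ D - k * h < s + h := by
    intro D hD
    refine ⟨⌊(D - s) / h⌋₊, ?_, ?_⟩
    · have := Nat.floor_le (div_nonneg (sub_nonneg.2 hD) hh0.le)
      rw [le_div_iff₀ hh0] at this
      linarith
    · have := Nat.lt_floor_add_one ((D - s) / h)
      rw [div_lt_iff₀ hh0] at this
      linarith
  have hupper : ∀ d e, P d e → d < s + h → e < s + h := by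
    intro d e hP hd
    by_contra hlt
    push Not at hlt
    have h1 := S.pendant hP hμ0 1
    have := S.le_of_le hs hs1 hμs hs' hνs h1 (by
      simp only [Nat.cast_one, one_mul, ← hh']; linarith)
    simp only [Nat.cast_one, one_mul, ← hh] at this
    linarith
  set C := 1 + η / (t - s) with hC
  have hC1 : 1 < C := by
    rw [hC]; have : 0 < η / (t - s) := div_pos hη0 (by linarith)
    linarith
  have hstep : ∀ d e K, P d e → s ≤ d → d < s + h → 0 ≤ K →
      K * ((t - e) * (d - s)) ≤ (e - s) * (t - d) →
      ∃ d' e', P d' e' ∧ s ≤ d' ∧ d' < s + h ∧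
        (K * C) * ((t - e') * (d' - s)) ≤ (e' - s) * (t - d') ∧
        (e - d) / (d * e) + η ≤ e' - d' := by
    intro d e K hP hsd hdh hK0 hK
    have hd0 : 0 < d := by linarith
    have hde : d < e := by have := S.gap hP; linarith
    have he0 : 0 < e := by linarith
    have heh := hupper d e hP hdh
    have hsD : s ≤ μ - 1 / d := by
      have := one_div_le_one_div_of_le hs hsd
      linarith
    obtain ⟨k, hk1, hk2⟩ := hgreedy _ hsD
    have hbound : ∀ x, 0 < x → x < s + h → μ - 1 / x ≤ (μ + h) / 2 := by
      intro x hx0 hx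
      have h1 : 1 / (s + h) ≤ 1 / x := one_div_le_one_div_of_le hx0 hx.le
      have h2 : (μ - h) / 2 ≤ 1 / (s + h) := by
        rw [le_div_iff₀ (by linarith)]; linarith
      linarith
    have hdiv : 1 / e < 1 / d := one_div_lt_one_div_of_lt hd0 hde
    have hdiff : 1 / d - 1 / e = (e - d) / (d * e) := by field_simp
    have hK' : K * ((t - (μ - 1 / e)) * (μ - 1 / d - s)) ≤
        (μ - 1 / e - s) * (t - (μ - 1 / d)) := by
      have e1 : t - (μ - 1 / e) = s * (t - e) / e := by
        field_simp; rw [hμ]; linarith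
      have e2 : μ - 1 / d - s = t * (d - s) / d := by
        field_simp; rw [hμ]; linarith
      have e3 : μ - 1 / e - s = t * (e - s) / e := by
        field_simp; rw [hμ]; linarith
      have e4 : t - (μ - 1 / d) = s * (t - d) / d := by
        field_simp; rw [hμ]; linarith
      rw [e1, e2, e3, e4, div_mul_div_comm, div_mul_div_comm, ← mul_div_assoc]
      apply div_le_div_of_nonneg_right _ (by positivity)
      have e5 : K * (s * (t - e) * (t * (d - s))) = s * t * (K * ((t - e) * (d - s))) := by ring
      have e6 : t * (e - s) * (s * (t - d)) = s * t * ((e - s) * (t - d)) := by ring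
      rw [e5, e6, hst, one_mul, one_mul]
      exact hK
    have het : μ - 1 / e < t := by
      have : s < 1 / e := by
        rw [lt_div_iff₀ he0, ← hst]
        exact mul_lt_mul_of_pos_left (by linarith) hs
      linarith
    have hK'' := crossRatio_sub_nat hh0 k hk1 (by linarith) het
      (by have := hbound d hd0 hdh; have := hbound e he0 heh; linarith) hK'
    have hPn := S.pendant (S.plain hP hd0) hμ0 k
    have hkh : (k : ℝ) * h' ≤ k * h := mul_le_mul_of_nonneg_left hhh'.le (Nat.cast_nonneg _)
    refine ⟨_, _, hPn, hk1, hk2, ?_, ?_⟩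
    · change K * C * ((t - (ν - 1 / e - k * h')) * (μ - 1 / d - k * h - s)) ≤
        (ν - 1 / e - k * h' - s) * (t - (μ - 1 / d - k * h))
      set d₁ := μ - 1 / d - k * h with hd₁
      set e₁ := μ - 1 / e - k * h with he₁
      have hE : e₁ + η ≤ ν - 1 / e - k * h' := by rw [he₁, hηdef]; linarith
      have hkh0 : 0 ≤ k * h := by positivity
      have hse₁ : s ≤ e₁ := by linarith
      have htd : 0 < t - d₁ := by linarith
      calc K * C * ((t - (ν - 1 / e - k * h')) * (d₁ - s))
          ≤ K * C * ((t - e₁) * (d₁ - s)) := by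
            apply mul_le_mul_of_nonneg_left _ (by positivity)
            apply mul_le_mul_of_nonneg_right _ (by linarith)
            linarith
        _ = C * (K * ((t - e₁) * (d₁ - s))) := by ring
        _ ≤ C * ((e₁ - s) * (t - d₁)) := mul_le_mul_of_nonneg_left hK'' (by linarith)
        _ = (C * (e₁ - s)) * (t - d₁) := by ring
        _ ≤ _ := by
            apply mul_le_mul_of_nonneg_right _ htd.le
            have : η / (t - s) * (e₁ - s) ≤ η := by
              rw [div_mul_eq_mul_div, div_le_iff₀ (by linarith)]
              exact mul_le_mul_of_nonneg_left (by linarith) hη0.le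
            rw [hC]
            linarith
    · linarith
  have hphase : ∀ n : ℕ, ∃ d e, P d e ∧ s ≤ d ∧ d < s + h ∧
      C ^ n * ((t - e) * (d - s)) ≤ (e - s) * (t - d) := by
    intro n
    induction n with
    | zero =>
      obtain ⟨k, hk1, hk2⟩ := hgreedy μ (by linarith)
      have hP := S.pendant S.single hμ0 k
      refine ⟨_, _, hP, hk1, hk2, ?_⟩
      have := S.gap hP
      set d := μ - k * (1 / μ)
      set e := ν - k * (1 / ν)
      have h1 : (e - s) * (t - d) - (t - e) * (d - s) = (e - d) * (t - s) := by ring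
      have h2 : 0 ≤ (e - d) * (t - s) := mul_nonneg (by linarith) (by linarith)
      rw [pow_zero]
      linarith
    | succ n ih =>
      obtain ⟨d, e, hP, h1, h2, h3⟩ := ih
      obtain ⟨d', e', hP', h1', h2', h3', -⟩ := hstep d e _ hP h1 h2 (by positivity) h3
      exact ⟨d', e', hP', h1', h2', by rwa [pow_succ]⟩
  have hτ : 0 < t - s - h := by linarith
  obtain ⟨N, hN⟩ := pow_unbounded_of_one_lt ((t - s) ^ 2 * t / (s * (t - s - h) ^ 2)) hC1
  have hgrow : ∀ m : ℕ, ∃ d e, P d e ∧ s ≤ d ∧ d < s + h ∧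
      C ^ (N + m) * ((t - e) * (d - s)) ≤ (e - s) * (t - d) ∧ m * η ≤ e - d := by
    intro m
    induction m with
    | zero =>
      obtain ⟨d, e, hP, h1, h2, h3⟩ := hphase N
      exact ⟨d, e, hP, h1, h2, h3, by have := S.gap hP; push_cast; linarith⟩
    | succ m ih =>
      obtain ⟨d, e, hP, h1, h2, h3, h4⟩ := ih
      obtain ⟨d', e', hP', h1', h2', h3', h4'⟩ := hstep d e _ hP h1 h2 (by positivity) h3
      refine ⟨d', e', hP', h1', h2', by rwa [← add_assoc, pow_succ], ?_⟩
      have hd0 : 0 < d := by linarith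
      have hde : d < e := by have := S.gap hP; linarith
      have he0 : 0 < e := by linarith
      have heh := hupper d e hP h2
      have hsmall : (d - s) * t ≤ s * (t - s - h) := by
        have hCN : (t - s) ^ 2 * t / (s * (t - s - h) ^ 2) ≤ C ^ (N + m) :=
          hN.le.trans (pow_le_pow_right₀ hC1.le (by omega))
        rw [div_le_iff₀ (by positivity)] at hCN
        have e1 : (e - s) * (t - d) ≤ (t - s) ^ 2 := by
          rw [sq]
          exact mul_le_mul (by linarith) (by linarith) (by linarith) (by linarith)
        have e2 : C ^ (N + m) * ((t - s - h) * (d - s)) ≤ (t - s) ^ 2 := by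
          refine (mul_le_mul_of_nonneg_left ?_ (by positivity)).trans (h3.trans e1)
          exact mul_le_mul_of_nonneg_right (by linarith) (by linarith)
        have hCpos : 0 < C ^ (N + m) := by positivity
        have hpos : 0 < C ^ (N + m) * (t - s - h) := by positivity
        refine le_of_mul_le_mul_left ?_ hpos
        calc C ^ (N + m) * (t - s - h) * ((d - s) * t)
            = C ^ (N + m) * ((t - s - h) * (d - s)) * t := by ring
          _ ≤ (t - s) ^ 2 * t := mul_le_mul_of_nonneg_right e2 ht0.le
          _ ≤ _ := hCN
          _ = _ := by ring
      have hprod : d * e ≤ 1 := by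
        have e1 : d * e ≤ d * (t - (t - s - h)) :=
          mul_le_mul_of_nonneg_left (by linarith) hd0.le
        have e2 : s * (t - s - h) ≤ d * (t - s - h) :=
          mul_le_mul_of_nonneg_right h1 hτ.le
        have e3 : (d - s) * t = d * t - 1 := by rw [sub_mul, hst]
        have e4 : d * (t - (t - s - h)) = d * t - d * (t - s - h) := by ring
        linarith
      have : e - d ≤ (e - d) / (d * e) := by
        rw [le_div_iff₀ (by positivity)]
        exact mul_le_of_le_one_right (by linarith) hprod
      push_cast
      linarith
  obtain ⟨m, hm⟩ := exists_nat_gt (t / η)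
  rw [div_lt_iff₀ hη0] at hm
  obtain ⟨d, e, hP, h1, h2, -, h4⟩ := hgrow m
  have := hupper d e hP h2
  linarith

end PivotSystem

namespace PivotSystem

lemma bounds_sub_inv {m y ml mh yl yh l u : ℝ} (hml : ml ≤ m) (hmh : m ≤ mh) (hyl : yl ≤ y)
    (hyh : y ≤ yh) (hpos : 0 < yl) (hl : l ≤ ml - 1 / yl) (hu : mh - 1 / yh ≤ u) :
    l ≤ m - 1 / y ∧ m - 1 / y ≤ u := by
  have h1 := one_div_le_one_div_of_le hpos hyl
  have h2 := one_div_le_one_div_of_le (hpos.trans_le hyl) hyh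
  constructor <;> linarith

lemma trap_lower {s μ β y yl : ℝ} (hs : 0 < s) (hμs : s ^ 2 + 1 = μ * s) (hsβ : s ≤ β)
    (hy : yl ≤ y)
    (h : 2 * s ^ 2 + 1 - (β + 2) * s - 2 * s ^ 3 + 2 * β * s ^ 2 ≤ yl * (β * s ^ 2 - s ^ 3)) :
    μ - β + s - 2 * s * (μ - β) ≤ y * (1 - s * (μ - β)) := by
  have h1 : 1 - s * (μ - β) = s * (β - s) := by linarith
  rw [h1]
  refine le_trans ?_ (mul_le_mul_of_nonneg_right hy (mul_nonneg hs.le (by linarith)))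
  refine le_of_mul_le_mul_left ?_ hs
  have h2 : s * (μ - β + s - 2 * s * (μ - β)) = (μ * s) * (1 - 2 * s) - β * s + s ^ 2 +
    2 * β * s ^ 2 := by ring
  rw [h2, ← hμs]
  linarith

variable {P : ℝ → ℝ → Prop} {μ ν : ℝ} (S : PivotSystem P μ ν)
include S

lemma false_of_mem_first {s s₀ : ℝ} (hμs : s ^ 2 + 1 = μ * s) (ha : 0.8325 ≤ s)
    (hs₀ : s₀ ^ 6 + s₀ ^ 4 = 1) (hb : s ≤ s₀) (hb' : s₀ < 0.868837) : False := by
  have hs : 0 < s := by linarith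
  have hb₁ : s ≤ 0.868837 := by linarith
  have hml : 2.0198 ≤ μ := by nlinarith
  have hmh : μ ≤ 2.0338 := by nlinarith
  obtain ⟨y2l, y2h⟩ := bounds_sub_inv (l := 1.5246) (u := 1.5422) hml hmh hml hmh
    (by norm_num) (by norm_num) (by norm_num)
  obtain ⟨y3l, y3h⟩ := bounds_sub_inv (l := 1.36) (u := 1.39) hml hmh y2l y2h
    (by norm_num) (by norm_num) (by norm_num)
  have hP2 := S.plain S.single (by linarith)
  have hP3 := S.plain hP2 (by linarith)
  have hP := S.pendant hP3 (by linarith) 1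
  rw [Nat.cast_one, one_mul, one_mul] at hP
  have hinv : 0.49 ≤ 1 / μ := by rw [le_div_iff₀ (by linarith)]; linarith
  have hpoly : s ^ 6 + s ^ 4 ≤ 1 := by rw [← hs₀]; gcongr
  have hstart : s ≤ μ - 1 / (μ - 1 / μ) - 1 / μ := by
    have hμ : μ = (s ^ 2 + 1) / s := by field_simp; linarith
    have hpos : 0 < s ^ 4 + s ^ 2 + 1 := by positivity
    have e1 : μ - 1 / μ = (s ^ 4 + s ^ 2 + 1) / (s * (s ^ 2 + 1)) := by
      rw [hμ]; field_simp; ring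
    rw [e1, hμ, one_div_div, one_div_div]
    have e2 : (s ^ 2 + 1) / s - s * (s ^ 2 + 1) / (s ^ 4 + s ^ 2 + 1) - s / (s ^ 2 + 1) - s =
        (1 - (s ^ 6 + s ^ 4)) / (s * (s ^ 4 + s ^ 2 + 1) * (s ^ 2 + 1)) := by
      field_simp; ring
    have e3 : 0 ≤ (1 - (s ^ 6 + s ^ 4)) / (s * (s ^ 4 + s ^ 2 + 1) * (s ^ 2 + 1)) :=
      div_nonneg (by linarith) (by positivity)
    linarith
  refine S.false_of_trap (β := 0.904) hs hμs (by norm_num) hP2 hP hstart ?_ ?_ ?_ ?_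
  · linarith
  · linarith
  · nlinarith
  · refine trap_lower hs hμs (by linarith) y2l ?_
    nlinarith [mul_nonneg (sub_nonneg.2 ha) (sub_nonneg.2 hb₁),
      mul_nonneg hs.le (mul_nonneg (sub_nonneg.2 ha) (sub_nonneg.2 hb₁))]

lemma false_of_mem_second {s : ℝ} (hμs : s ^ 2 + 1 = μ * s) (ha : 0.819 ≤ s) (hb : s ≤ 0.8325) :
    False := by
  have hs : 0 < s := by linarith
  have hml : 2.0337 ≤ μ := by nlinarith
  have hmh : μ ≤ 2.04001 := by nlinarith
  obtain ⟨y2l, y2h⟩ := bounds_sub_inv (l := 1.54198) (u := 1.54982) hml hmh hml hmh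
    (by norm_num) (by norm_num) (by norm_num)
  obtain ⟨y3l, y3h⟩ := bounds_sub_inv (l := 1.38518) (u := 1.39478) hml hmh y2l y2h
    (by norm_num) (by norm_num) (by norm_num)
  have hP1 := S.single
  have hP2 := S.plain hP1 (by linarith)
  have hP3 := S.plain hP2 (by linarith)
  have hP := S.pendant hP3 (by linarith) 1
  rw [Nat.cast_one, one_mul, one_mul] at hP
  have hil : 0.4901 ≤ 1 / μ := by rw [le_div_iff₀ (by linarith)]; linarith
  have hih : 1 / μ ≤ 0.4918 := by rw [div_le_iff₀ (by linarith)]; linarith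
  refine S.false_of_trap (β := 0.908) hs hμs (by norm_num) hP3 hP ?_ ?_ ?_ ?_ ?_
  · linarith
  · linarith
  · linarith
  · nlinarith
  · refine trap_lower hs hμs (by linarith) y3l ?_
    nlinarith [mul_nonneg (sub_nonneg.2 ha) (sub_nonneg.2 hb),
      mul_nonneg hs.le (mul_nonneg (sub_nonneg.2 ha) (sub_nonneg.2 hb))]

lemma false_of_mem_third {s : ℝ} (hμs : s ^ 2 + 1 = μ * s) (ha : 0.798 ≤ s) (hb : s ≤ 0.819) :
    False := by
  have hs : 0 < s := by linarith
  have hml : 2.04 ≤ μ := by nlinarith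
  have hmh : μ ≤ 2.05114 := by nlinarith
  obtain ⟨y2l, y2h⟩ := bounds_sub_inv (l := 1.5498) (u := 1.56361) hml hmh hml hmh
    (by norm_num) (by norm_num) (by norm_num)
  obtain ⟨y3l, y3h⟩ := bounds_sub_inv (l := 1.39475) (u := 1.4116) hml hmh y2l y2h
    (by norm_num) (by norm_num) (by norm_num)
  obtain ⟨y4l, y4h⟩ := bounds_sub_inv (l := 1.32302) (u := 1.34273) hml hmh y3l y3h
    (by norm_num) (by norm_num) (by norm_num)
  have hP1 := S.single
  have hP2 := S.plain hP1 (by linarith)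
  have hP3 := S.plain hP2 (by linarith)
  have hP4 := S.plain hP3 (by linarith)
  have hP := S.pendant hP4 (by linarith) 1
  rw [Nat.cast_one, one_mul, one_mul] at hP
  have hil : 0.4875 ≤ 1 / μ := by rw [le_div_iff₀ (by linarith)]; linarith
  have hih : 1 / μ ≤ 0.4902 := by rw [div_le_iff₀ (by linarith)]; linarith
  refine S.false_of_trap (β := 0.861) hs hμs (by norm_num) hP1 hP ?_ ?_ ?_ ?_ ?_
  · linarith
  · linarith
  · linarith
  · nlinarith
  · refine trap_lower hs hμs (by linarith) hml ?_
    nlinarith [mul_nonneg (sub_nonneg.2 ha) (sub_nonneg.2 hb),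
      mul_nonneg hs.le (mul_nonneg (sub_nonneg.2 ha) (sub_nonneg.2 hb))]

lemma false_of_mem_fourth {s : ℝ} (hμs : s ^ 2 + 1 = μ * s) (ha : 0.7859 ≤ s) (hb : s ≤ 0.798) :
    False := by
  have hs : 0 < s := by linarith
  have hml : 2.05113 ≤ μ := by nlinarith
  have hmh : μ ≤ 2.05833 := by nlinarith
  obtain ⟨y2l, y2h⟩ := bounds_sub_inv (l := 1.56359) (u := 1.5725) hml hmh hml hmh
    (by norm_num) (by norm_num) (by norm_num)
  obtain ⟨y3l, y3h⟩ := bounds_sub_inv (l := 1.41157) (u := 1.4224) hml hmh y2l y2h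
    (by norm_num) (by norm_num) (by norm_num)
  obtain ⟨y4l, y4h⟩ := bounds_sub_inv (l := 1.34269) (u := 1.3553) hml hmh y3l y3h
    (by norm_num) (by norm_num) (by norm_num)
  have hP1 := S.single
  have hP2 := S.plain hP1 (by linarith)
  have hP3 := S.plain hP2 (by linarith)
  have hP4 := S.plain hP3 (by linarith)
  have hP := S.pendant hP4 (by linarith) 1
  rw [Nat.cast_one, one_mul, one_mul] at hP
  have hil : 0.4858 ≤ 1 / μ := by rw [le_div_iff₀ (by linarith)]; linarith
  have hih : 1 / μ ≤ 0.4876 := by rw [div_le_iff₀ (by linarith)]; linarith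
  refine S.false_of_trap (β := 0.88) hs hμs (by norm_num) hP2 hP ?_ ?_ ?_ ?_ ?_
  · linarith
  · linarith
  · linarith
  · nlinarith
  · refine trap_lower hs hμs (by linarith) y2l ?_
    nlinarith [mul_nonneg (sub_nonneg.2 ha) (sub_nonneg.2 hb),
      mul_nonneg hs.le (mul_nonneg (sub_nonneg.2 ha) (sub_nonneg.2 hb))]

end PivotSystem

namespace PivotSystem

lemma exists_small_root {m : ℝ} (hm : 2 < m) :
    ∃ s : ℝ, 0 < s ∧ s < 1 ∧ s ^ 2 + 1 = m * s ∧ ∀ x, x ^ 2 + 1 < m * x → s < x := by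
  have hD : 0 < m ^ 2 - 4 := by nlinarith
  have hr := Real.sq_sqrt hD.le
  have hr0 := Real.sqrt_pos.2 hD
  set r := √(m ^ 2 - 4)
  have h1 : r < m := by nlinarith
  have h2 : m - 2 < r := by nlinarith
  refine ⟨(m - r) / 2, by linarith, by linarith, by linarith, fun x hx => ?_⟩
  by_contra hlt
  push Not at hlt
  nlinarith

variable {P : ℝ → ℝ → Prop} {μ ν : ℝ} (S : PivotSystem P μ ν)
include S

theorem false_of_lt {s₀ : ℝ} (hs₀ : 0 < s₀) (hcrit : s₀ ^ 6 + s₀ ^ 4 = 1)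
    (hs₀' : s₀ < 0.868837) (hμ : s₀ ^ 2 + 1 < μ * s₀) : False := by
  have hη := S.lt
  have hμ2 : 2 < μ := by nlinarith [sq_nonneg (s₀ - 1)]
  obtain ⟨s, hs, hs1, hμs, hmin⟩ := exists_small_root hμ2
  obtain ⟨s', hs', hs1', hνs, hmin'⟩ := exists_small_root (hμ2.trans hη)
  have hss₀ := hmin _ hμ
  have hss' : s' < s := hmin' _ (by rw [hμs]; exact mul_lt_mul_of_pos_right hη hs)
  rcases le_total s 0.786 with h1 | h1
  · have hinv : 1 / μ = s / (s ^ 2 + 1) := by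
      rw [hμs]; field_simp
    have hsq : s ^ 2 ≤ 0.786 ^ 2 := by gcongr
    refine S.false_of_greedy hs hs1 hμs hs' hss'.le hνs ?_ ?_
    · rw [hinv, lt_div_iff₀ hs]
      have e : (s + s / (s ^ 2 + 1)) * s = s ^ 2 * (s ^ 2 + 2) / (s ^ 2 + 1) := by
        field_simp; ring
      rw [e, div_lt_one (by positivity)]
      nlinarith [sq_nonneg s]
    · have hμ' : μ = (s ^ 2 + 1) / s := by field_simp; linarith
      rw [hinv, hμ']
      have e : ((s ^ 2 + 1) / s - s / (s ^ 2 + 1)) * (s + s / (s ^ 2 + 1)) =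
          ((s ^ 2 + 1) ^ 2 - s ^ 2) * (s ^ 2 + 2) / (s ^ 2 + 1) ^ 2 := by
        field_simp; ring
      rw [e, div_le_iff₀ (by positivity)]
      nlinarith [sq_nonneg s, sq_nonneg (s ^ 2)]
  rcases le_total s 0.798 with h2 | h2
  · exact S.false_of_mem_fourth hμs (by linarith) h2
  rcases le_total s 0.819 with h3 | h3
  · exact S.false_of_mem_third hμs h2 h3
  rcases le_total s 0.8325 with h4 | h4
  · exact S.false_of_mem_second hμs h3 h4
  · exact S.false_of_mem_first hμs h4 hcrit hss₀.le hs₀'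

end PivotSystem

open Matrix in
lemma qf_fromBlocks {V W : Type*} [Fintype V] [Fintype W] (A : Matrix V V ℝ) (B : Matrix V W ℝ)
    (D : Matrix W W ℝ) (z : V ⊕ W → ℝ) :
    qf (fromBlocks A B Bᵀ D) z = qf A (z ∘ Sum.inl) +
      2 * ((z ∘ Sum.inl) ⬝ᵥ B.mulVec (z ∘ Sum.inr)) + qf D (z ∘ Sum.inr) := by
  have h : (z ∘ Sum.inr) ⬝ᵥ Bᵀ.mulVec (z ∘ Sum.inl) = (z ∘ Sum.inl) ⬝ᵥ B.mulVec (z ∘ Sum.inr) := by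
    rw [Matrix.mulVec_transpose, dotProduct_comm, Matrix.dotProduct_mulVec]
  unfold qf
  rw [fromBlocks_mulVec, dotProduct_block]
  simp only [Sum.elim_comp_inl, Sum.elim_comp_inr, dotProduct_add]
  rw [h]
  ring

lemma qf_smul {V : Type*} [Fintype V] (A : Matrix V V ℝ) (a : ℝ) (x : V → ℝ) :
    qf A (a • x) = a ^ 2 * qf A x := by
  simp only [qf, Matrix.mulVec_smul, dotProduct_smul, smul_dotProduct, smul_eq_mul]
  ring

/-- The quadratic form of `A + m`. -/
def shiftForm {V : Type*} [Fintype V] (A : Matrix V V ℝ) (m : ℝ) (x : V → ℝ) : ℝ :=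
  qf A x + m * (x ⬝ᵥ x)

lemma shiftForm_fromBlocks {V W : Type*} [Fintype V] [Fintype W] (A : Matrix V V ℝ)
    (B : Matrix V W ℝ) (D : Matrix W W ℝ) (m : ℝ) (z : V ⊕ W → ℝ) :
    shiftForm (Matrix.fromBlocks A B B.transpose D) m z = shiftForm A m (z ∘ Sum.inl) +
      2 * ((z ∘ Sum.inl) ⬝ᵥ B.mulVec (z ∘ Sum.inr)) + shiftForm D m (z ∘ Sum.inr) := by
  unfold shiftForm
  rw [qf_fromBlocks, Matrix.dotProduct_block]
  ring

lemma shiftForm_smul {V : Type*} [Fintype V] (A : Matrix V V ℝ) (m a : ℝ) (x : V → ℝ) :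
    shiftForm A m (a • x) = a ^ 2 * shiftForm A m x := by
  unfold shiftForm
  rw [qf_smul, dotProduct_smul, smul_dotProduct, smul_eq_mul, smul_eq_mul]
  ring

lemma dotProduct_single_mulVec {V W : Type*} [Fintype V] [Fintype W] [DecidableEq V]
    [DecidableEq W] (r : V) (r' : W) (b : ℝ) (x : V → ℝ) (y : W → ℝ) :
    x ⬝ᵥ (Matrix.single r r' b).mulVec y = b * (x r * y r') := by
  rw [Matrix.single_mulVec, ← Pi.single, dotProduct_single]
  ring

/-- A signed graph on an arbitrary vertex type together with a valid colouring. -/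
structure IsColoredSigned {V : Type*} {p : ℕ} (A : Matrix V V ℝ) (c : V → Fin p) : Prop where
  symm : A.IsSymm
  diag : ∀ i, A i i = 0
  entry : ∀ i j, A i j = 0 ∨ (A i j = -1 ∧ c i = c j) ∨ (A i j = 1 ∧ c i ≠ c j)

namespace IsColoredSigned
variable {V W : Type*} {p : ℕ} {A : Matrix V V ℝ} {c : V → Fin p} {D : Matrix W W ℝ}
  {c' : W → Fin p}

lemma recolor (h : IsColoredSigned A c) (σ : Equiv.Perm (Fin p)) : IsColoredSigned A (σ ∘ c) where
  symm := h.symm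
  diag := h.diag
  entry i j := by simpa using h.entry i j

lemma fromBlocks (h : IsColoredSigned A c) (h' : IsColoredSigned D c') {B : Matrix V W ℝ}
    (hB : ∀ i j, B i j = 0 ∨ (B i j = -1 ∧ c i = c' j) ∨ (B i j = 1 ∧ c i ≠ c' j)) :
    IsColoredSigned (Matrix.fromBlocks A B B.transpose D) (Sum.elim c c') where
  symm := h.symm.fromBlocks rfl h'.symm
  diag i := by
    rcases i with i | i
    · exact h.diag i
    · exact h'.diag i
  entry i j := by
    rcases i with i | i <;> rcases j with j | j
    · exact h.entry i j
    · exact hB i j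
    · simpa [eq_comm] using hB j i
    · exact h'.entry i j

end IsColoredSigned

lemma one_le_dotProduct_self {V : Type*} [Fintype V] {x : V → ℝ} {r : V} (hx : x r = 1) :
    1 ≤ x ⬝ᵥ x := by
  have := Finset.single_le_sum (f := fun i => x i * x i) (fun i _ => mul_self_nonneg (x i))
    (Finset.mem_univ r)
  rwa [hx, one_mul] at this

/-- `d` is the pivot of `A + m` at the root `r`. -/
def IsPivot {V : Type*} [Fintype V] (A : Matrix V V ℝ) (r : V) (m d : ℝ) : Prop :=
  (∀ x, d * x r ^ 2 ≤ shiftForm A m x) ∧ ∃ x, x r = 1 ∧ shiftForm A m x = d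

namespace IsPivot
variable {V W : Type*} [Fintype V] [Fintype W] [DecidableEq V] [DecidableEq W]
  {A : Matrix V V ℝ} {D : Matrix W W ℝ} {r : V} {r' : W} {m : ℝ}

lemma join {d d' : ℝ} (h : IsPivot A r m d) (h' : IsPivot D r' m d') (hd' : 0 < d') :
    IsPivot (Matrix.fromBlocks A (Matrix.single r r' (-1))
      (Matrix.single r r' (-1)).transpose D) (Sum.inl r) m (d - 1 / d') := by
  obtain ⟨h1, x₀, hx₀, h2⟩ := h
  obtain ⟨h1', y₀, hy₀, h2'⟩ := h'
  refine ⟨fun z => ?_, Sum.elim x₀ ((1 / d') • y₀), by simpa using hx₀, ?_⟩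
  · rw [shiftForm_fromBlocks, dotProduct_single_mulVec]
    have e1 := h1 (z ∘ Sum.inl)
    have e2 := h1' (z ∘ Sum.inr)
    simp only [Function.comp_apply] at e1 e2 ⊢
    have e3 : 0 ≤ d' * (z (Sum.inr r') - z (Sum.inl r) / d') ^ 2 :=
      mul_nonneg hd'.le (sq_nonneg _)
    have e4 : d' * (z (Sum.inr r') - z (Sum.inl r) / d') ^ 2 = d' * z (Sum.inr r') ^ 2 -
        2 * (z (Sum.inl r) * z (Sum.inr r')) + z (Sum.inl r) ^ 2 * (1 / d') := by
      field_simp; ring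
    linarith
  · rw [shiftForm_fromBlocks, dotProduct_single_mulVec]
    simp only [Sum.elim_comp_inl, Sum.elim_comp_inr, shiftForm_smul, Pi.smul_apply, hx₀, h2, hy₀,
      h2', smul_eq_mul]
    field_simp
    ring

/-- The column joining a new vertex to two roots. -/
abbrev apexBlock (r : V) (r' : W) : Matrix (V ⊕ W) Unit ℝ :=
  Matrix.single (Sum.inl r) () 1 + Matrix.single (Sum.inr r') () 1

/-- The matrix obtained from two rooted matrices by joining their roots and a new vertex to a
positive triangle. -/
abbrev triMatrix (A : Matrix V V ℝ) (r : V) (D : Matrix W W ℝ) (r' : W) :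
    Matrix ((V ⊕ W) ⊕ Unit) ((V ⊕ W) ⊕ Unit) ℝ :=
  Matrix.fromBlocks
    (Matrix.fromBlocks A (Matrix.single r r' 1) (Matrix.single r r' 1).transpose D)
    (apexBlock r r')
    (apexBlock r r').transpose 0

lemma shiftForm_triMatrix (z : (V ⊕ W) ⊕ Unit → ℝ) :
    shiftForm (triMatrix A r D r') m z =
      shiftForm A m (z ∘ Sum.inl ∘ Sum.inl) + shiftForm D m (z ∘ Sum.inl ∘ Sum.inr) +
      2 * (z (Sum.inl (Sum.inl r)) * z (Sum.inl (Sum.inr r'))) +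
      2 * ((z (Sum.inl (Sum.inl r)) + z (Sum.inl (Sum.inr r'))) * z (Sum.inr ())) +
      m * z (Sum.inr ()) ^ 2 := by
  rw [shiftForm_fromBlocks, shiftForm_fromBlocks, Matrix.add_mulVec, dotProduct_add,
    dotProduct_single_mulVec, dotProduct_single_mulVec, dotProduct_single_mulVec]
  have h0 : shiftForm (0 : Matrix Unit Unit ℝ) m (z ∘ Sum.inr) = m * z (Sum.inr ()) ^ 2 := by
    simp [shiftForm, qf, dotProduct, sq]
  rw [h0]
  simp only [Function.comp_apply, Function.comp_assoc]
  ring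

lemma tri {Q d : ℝ} (h : IsPivot A r m Q) (h' : IsPivot D r' m d) (hQ : 0 < Q)
    (hd : 1 / Q < d) :
    IsPivot (triMatrix A r D r') (Sum.inr ()) m
      (m - 1 / Q - (1 - 1 / Q) ^ 2 / (d - 1 / Q)) := by
  obtain ⟨h1, x₀, hx₀, h2⟩ := h
  obtain ⟨h1', y₀, hy₀, h2'⟩ := h'
  set q := 1 / Q with hq
  have hQq : Q * q = 1 := by rw [hq]; field_simp
  have hdq : 0 < d - q := by linarith
  set u := (1 - q) / (d - q) with hu
  have hu' : (d - q) * u = 1 - q := by rw [hu]; field_simp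
  have hval : (1 - q) ^ 2 / (d - q) = (d - q) * u ^ 2 := by
    rw [hu]; field_simp
  rw [hval]
  have key : ∀ f e z : ℝ, Q * f ^ 2 + d * e ^ 2 + 2 * (f * e) + 2 * ((f + e) * z) + m * z ^ 2 =
      Q * (f + q * (e + z)) ^ 2 + (d - q) * (e + u * z) ^ 2 +
        (m - q - (d - q) * u ^ 2) * z ^ 2 := by
    intro f e z
    have e1 : Q * (f + q * (e + z)) ^ 2 = Q * f ^ 2 + 2 * (Q * q) * (f * (e + z)) +
      (Q * q) * q * (e + z) ^ 2 := by ring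
    have e2 : (d - q) * (e + u * z) ^ 2 = (d - q) * e ^ 2 + 2 * ((d - q) * u) * (e * z) +
      (d - q) * u ^ 2 * z ^ 2 := by ring
    rw [e1, e2, hQq, hu']
    ring
  refine ⟨fun z => ?_,
    Sum.elim (Sum.elim ((-(q * (1 - u))) • x₀) ((-u) • y₀)) (fun _ => 1), rfl, ?_⟩
  · rw [shiftForm_triMatrix]
    have e1 := h1 (z ∘ Sum.inl ∘ Sum.inl)
    have e2 := h1' (z ∘ Sum.inl ∘ Sum.inr)
    simp only [Function.comp_apply] at e1 e2
    have e3 := key (z (Sum.inl (Sum.inl r))) (z (Sum.inl (Sum.inr r'))) (z (Sum.inr ()))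
    have e4 : 0 ≤ Q * (z (Sum.inl (Sum.inl r)) +
        q * (z (Sum.inl (Sum.inr r')) + z (Sum.inr ()))) ^ 2 := mul_nonneg hQ.le (sq_nonneg _)
    have e5 : 0 ≤ (d - q) * (z (Sum.inl (Sum.inr r')) + u * z (Sum.inr ())) ^ 2 :=
      mul_nonneg hdq.le (sq_nonneg _)
    linarith
  · rw [shiftForm_triMatrix]
    have e1 : (Sum.elim (Sum.elim ((-(q * (1 - u))) • x₀) ((-u) • y₀)) (fun _ => (1 : ℝ)) :
        (V ⊕ W) ⊕ Unit → ℝ) ∘ Sum.inl ∘ Sum.inl = (-(q * (1 - u))) • x₀ := rfl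
    have e2 : (Sum.elim (Sum.elim ((-(q * (1 - u))) • x₀) ((-u) • y₀)) (fun _ => (1 : ℝ)) :
        (V ⊕ W) ⊕ Unit → ℝ) ∘ Sum.inl ∘ Sum.inr = (-u) • y₀ := rfl
    rw [e1, e2, shiftForm_smul, shiftForm_smul, h2, h2']
    simp only [Sum.elim_inl, Sum.elim_inr, Pi.smul_apply, hx₀, hy₀, smul_eq_mul, mul_one]
    have e3 := key (-(q * (1 - u))) (-u) 1
    have e4 : -(q * (1 - u)) + q * (-u + 1) = 0 := by ring
    have e5 : -u + u * 1 = 0 := by ring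
    rw [e4, e5] at e3
    linarith

lemma gap {μ ν d e : ℝ} (hμν : μ ≤ ν) (h : IsPivot A r μ d) (h' : IsPivot A r ν e) :
    ν - μ ≤ e - d := by
  obtain ⟨h1, -⟩ := h
  obtain ⟨-, x, hx, h2⟩ := h'
  have h3 := h1 x
  have h4 := one_le_dotProduct_self hx
  rw [hx] at h3
  unfold shiftForm at h2 h3
  nlinarith

end IsPivot

/-- Pairs of pivots at `μ` and `ν` of `p`-colourable rooted signed graphs. -/
def PivotPair (p : ℕ) (μ ν d e : ℝ) : Prop :=
  ∃ (V : Type) (_ : Fintype V) (_ : DecidableEq V) (A : Matrix V V ℝ) (c : V → Fin p) (r : V),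
    IsColoredSigned A c ∧ IsPivot A r μ d ∧ IsPivot A r ν e

lemma isPivot_zero (m : ℝ) : IsPivot (0 : Matrix Unit Unit ℝ) () m m := by
  refine ⟨fun x => ?_, fun _ => 1, rfl, ?_⟩ <;> simp [shiftForm, qf, dotProduct, sq]

lemma isColoredSigned_zero {p : ℕ} (k : Fin p) :
    IsColoredSigned (0 : Matrix Unit Unit ℝ) (fun _ => k) :=
  ⟨Matrix.isSymm_zero, fun _ => rfl, fun _ _ => Or.inl rfl⟩

lemma pivotSystem_pivotPair {p : ℕ} (hp : 3 ≤ p) {lam μ ν : ℝ} (hlam : lam < μ) (hμν : μ < ν)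
    (hrigid : ∀ (V : Type) [Fintype V] [DecidableEq V] (A : Matrix V V ℝ) (c : V → Fin p),
      IsColoredSigned A c → (∀ x, 0 ≤ shiftForm A ν x) → ∀ x, 0 ≤ shiftForm A lam x) :
    PivotSystem (PivotPair p μ ν) μ ν where
  lt := hμν
  single := ⟨Unit, inferInstance, inferInstance, 0, fun _ => ⟨0, by omega⟩, (),
    isColoredSigned_zero _, isPivot_zero μ, isPivot_zero ν⟩
  join := by
    rintro d e d' e' ⟨V, _, _, A, c, r, hA, hd, he⟩ ⟨W, _, _, D, c', r', hD, hd', he'⟩ h h'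
    refine ⟨V ⊕ W, inferInstance, inferInstance, _, _, Sum.inl r,
      hA.fromBlocks (hD.recolor (Equiv.swap (c' r') (c r))) (B := Matrix.single r r' (-1))
        fun i j => ?_, hd.join hd' h, he.join he' h'⟩
    by_cases hij : r = i ∧ r' = j
    · obtain ⟨rfl, rfl⟩ := hij
      exact Or.inr (Or.inl ⟨Matrix.single_apply_same _ _ _, by simp⟩)
    · exact Or.inl (Matrix.single_apply_of_ne _ _ _ _ _ hij)
  tri := by
    rintro Q Q' d e ⟨V, _, _, A, c, r, hA, hQ, hQ'⟩ ⟨W, _, _, D, c', r', hD, hd, he⟩ h1 h2 h3 h4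
    have : Nontrivial (Fin p) := Fin.nontrivial_iff_two_le.2 (by omega)
    obtain ⟨k, hk⟩ := exists_ne (c r)
    obtain ⟨l, hl⟩ : ∃ l, l ∉ ({c r, k} : Finset (Fin p)) := by
      by_contra hall
      push Not at hall
      have := Finset.card_le_two (a := c r) (b := k)
      rw [Finset.eq_univ_iff_forall.2 hall, Finset.card_univ, Fintype.card_fin] at this
      omega
    simp only [Finset.mem_insert, Finset.mem_singleton, not_or] at hl
    have hcol : Equiv.swap (c' r') k (c' r') = k := Equiv.swap_apply_left _ _
    refine ⟨(V ⊕ W) ⊕ Unit, inferInstance, inferInstance, _, _, Sum.inr (),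
      (hA.fromBlocks (hD.recolor (Equiv.swap (c' r') k)) (B := Matrix.single r r' 1)
        fun i j => ?_).fromBlocks (isColoredSigned_zero l)
        (B := IsPivot.apexBlock r r') fun i j => ?_,
      hQ.tri hd h1 h3, hQ'.tri he h2 h4⟩
    · by_cases hij : r = i ∧ r' = j
      · obtain ⟨rfl, rfl⟩ := hij
        exact Or.inr (Or.inr ⟨Matrix.single_apply_same _ _ _, by simpa using hk.symm⟩)
      · exact Or.inl (Matrix.single_apply_of_ne _ _ _ _ _ hij)
    · rcases i with i | i
      · by_cases hi : r = i
        · subst hi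
          exact Or.inr (Or.inr ⟨by simp, by simpa using (Ne.symm hl.1)⟩)
        · exact Or.inl (by simp [hi])
      · by_cases hi : r' = i
        · subst hi
          exact Or.inr (Or.inr ⟨by simp, by simpa using (Ne.symm hl.2)⟩)
        · exact Or.inl (by simp [hi])
  rigid := by
    rintro d e ⟨V, _, _, A, c, r, hA, ⟨-, x, hx, hdx⟩, he, -⟩ hpos
    have h0 := hrigid V A c hA (fun y => le_trans (by positivity) (he y)) x
    have h4 := one_le_dotProduct_self hx
    unfold shiftForm at hdx h0
    nlinarith
  gap := by
    rintro d e ⟨V, _, _, A, c, r, hA, hd, he⟩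
    exact hd.gap hμν.le he

/-- At and above the critical value there is no finite forbidden subgraph characterization. -/
theorem not_hasFFSC_of_le {p : ℕ} (hp : 3 ≤ p) {lam s₀ : ℝ} (hs₀ : 0 < s₀)
    (hcrit : s₀ ^ 6 + s₀ ^ 4 = 1) (hs₀' : s₀ < 0.868837) (hlam : s₀ ^ 2 + 1 ≤ lam * s₀) :
    ¬ HasFFSC (classGp p) (classGpLam p lam) := by
  rintro ⟨ℱ, hfin, hsub, hiff⟩
  have hlam0 : 0 < lam := by
    by_contra hneg
    push Not at hneg
    nlinarith [sq_nonneg s₀]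
  have hbad : ∀ F ∈ ℱ, sgLam1 F < -lam := by
    intro F hF
    by_contra hle
    push Not at hle
    exact (hiff F (hsub hF)).1 ⟨hsub hF, hle⟩ F hF ⟨id, Function.injective_id, fun _ _ => rfl⟩
  obtain ⟨δ, hδ, hgap⟩ : ∃ δ : ℝ, 0 < δ ∧ ∀ F ∈ ℱ, sgLam1 F < -(lam + δ) := by
    rcases ℱ.eq_empty_or_nonempty with rfl | hne
    · exact ⟨1, one_pos, fun F hF => absurd hF (Set.notMem_empty F)⟩
    · obtain ⟨F₀, hF₀, hmax⟩ := Set.exists_max_image ℱ sgLam1 hfin hne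
      refine ⟨(-lam - sgLam1 F₀) / 2, by have := hbad F₀ hF₀; linarith, fun F hF => ?_⟩
      have := hbad F₀ hF₀
      have := hmax F hF
      linarith
  have S := pivotSystem_pivotPair hp (lam := lam) (μ := lam + δ / 2) (ν := lam + δ)
    (by linarith) (by linarith) fun V _ _ A c hA hpos x => by
      let ε := Fintype.equivFin V
      let G : SG := ⟨Fintype.card V, A.submatrix ε.symm ε.symm⟩
      have hG : G ∈ classGp p := by
        refine ⟨⟨hA.symm.submatrix _, fun i => hA.diag _, fun i j _ => ?_⟩,
          c ∘ ε.symm, fun u v => ⟨fun huv => ?_, fun huv => ?_⟩⟩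
        · change A (ε.symm i) (ε.symm j) = -1 ∨ A (ε.symm i) (ε.symm j) = 0 ∨
            A (ε.symm i) (ε.symm j) = 1
          rcases hA.entry (ε.symm i) (ε.symm j) with h | ⟨h, -⟩ | ⟨h, -⟩ <;> simp [h]
        · change A (ε.symm u) (ε.symm v) = -1 at huv
          rcases hA.entry (ε.symm u) (ε.symm v) with h | ⟨h, h'⟩ | ⟨h, -⟩
          · rw [h] at huv; norm_num at huv
          · exact h'
          · rw [h] at huv; norm_num at huv
        · change A (ε.symm u) (ε.symm v) = 1 at huv
          rcases hA.entry (ε.symm u) (ε.symm v) with h | ⟨h, -⟩ | ⟨h, h'⟩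
          · rw [h] at huv; norm_num at huv
          · rw [h] at huv; norm_num at huv
          · exact h'
      have hGl : G ∈ classGpLam p lam := by
        refine (hiff G hG).2 fun F hF ⟨f, hf, hFG⟩ => ?_
        refine absurd (le_sgLam1_of_qf_add_nonneg (G := F) (lam := lam + δ) (by linarith)
          fun y => ?_) (not_le.2 (hgap F hF))
        have hinj : (fun i => ε.symm (f i)).Injective := fun i j hij =>
          hf (ε.symm.injective hij)
        have h1 := hpos (pushVec (fun i => ε.symm (f i)) y)
        unfold shiftForm at h1
        rw [qf_pushVec, pushVec_self hinj] at h1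
        rwa [show F.2 = A.submatrix (fun i => ε.symm (f i)) (fun i => ε.symm (f i)) from by
          ext u v; exact hFG u v]
      have h1 := qf_add_nonneg_of_le_sgLam1 hG.1 hGl.2 (x ∘ ε.symm)
      have h2 : x = pushVec ε.symm (x ∘ ε.symm) := by
        ext v
        obtain ⟨i, rfl⟩ := ε.symm.surjective v
        rw [pushVec_apply ε.symm.injective]; rfl
      unfold shiftForm
      rw [h2, qf_pushVec, pushVec_self ε.symm.injective]
      exact h1
  exact S.false_of_lt hs₀ hcrit hs₀' (by nlinarith)

lemma crit_of_cube_eq {ρ : ℝ} (hρ : ρ ^ 3 = ρ + 1) :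
    RTree.Crit (√ρ)⁻¹ (√ρ + (√ρ)⁻¹ - 2) := by
  have h0 : 1 < ρ := by
    by_contra! h
    nlinarith [sq_nonneg (ρ + 1), sq_nonneg (ρ + 1 / 2), mul_nonneg (sq_nonneg ρ) (sub_nonneg.2 h)]
  have hlo : 1.3247179 < ρ := by
    by_contra! h
    nlinarith [mul_nonneg (sub_nonneg.2 h0.le) (sub_nonneg.2 h), mul_nonneg
      (mul_nonneg (sub_nonneg.2 h0.le) (sub_nonneg.2 h0.le)) (sub_nonneg.2 h)]
  have hhi : ρ < 1.324718 := by
    by_contra! h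
    nlinarith [mul_nonneg (sub_nonneg.2 h) (sub_nonneg.2 h), mul_nonneg
      (mul_nonneg (sub_nonneg.2 h) (sub_nonneg.2 h)) (sub_nonneg.2 h)]
  have hpos : 0 < √ρ := Real.sqrt_pos.2 (by linarith)
  have hsq : √ρ ^ 2 = ρ := Real.sq_sqrt (by linarith)
  refine ⟨?_, ?_, ?_, ?_⟩
  · rw [lt_inv_comm₀ (by norm_num) hpos, Real.sqrt_lt' (by norm_num)]
    exact hhi.trans (by norm_num)
  · rw [inv_lt_comm₀ hpos (by norm_num), Real.lt_sqrt (by norm_num)]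
    exact lt_trans (by norm_num) hlo
  · have h2 : (√ρ)⁻¹ ^ 2 = ρ⁻¹ := by rw [inv_pow, hsq]
    have h3 : (√ρ)⁻¹ ^ 6 + (√ρ)⁻¹ ^ 4 = ρ⁻¹ ^ 3 + ρ⁻¹ ^ 2 := by rw [← h2]; ring
    rw [h3]
    have : ρ ≠ 0 := by linarith
    field_simp
    linarith
  · field_simp
    ring

/-- For every `p ≥ 3` and every real `λ`, the family `𝒢_p(λ)` has a finite forbidden
subgraph characterization within `𝒢_p` if and only if `λ < λ*`, where `λ* = √ρ + 1/√ρ`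
and `ρ` is the unique real root of `x³ = x + 1`. -/
theorem ffsc_colorable_iff (p : ℕ) (hp : 3 ≤ p) (lam : ℝ)
    (ρ : ℝ) (hρ : ρ ^ 3 = ρ + 1)
    (lamStar : ℝ) (hlamStar : lamStar = Real.sqrt ρ + (Real.sqrt ρ)⁻¹) :
    HasFFSC (classGp p) (classGpLam p lam) ↔ lam < lamStar := by
  have hc := crit_of_cube_eq hρ
  have hpos := inv_pos.1 hc.pos
  subst hlamStar
  constructor
  · intro h
    by_contra! hle
    refine not_hasFFSC_of_le hp hc.pos hc.eq hc.hi ?_ h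
    calc (√ρ)⁻¹ ^ 2 + 1 = (√ρ + (√ρ)⁻¹) * (√ρ)⁻¹ := by field_simp; ring
      _ ≤ lam * (√ρ)⁻¹ := mul_le_mul_of_nonneg_right hle hc.pos.le
  · intro h
    exact hasFFSC_of_lt p hc (by linarith)
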